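/- Let k be a field of characteristic zero and G a finite subgroup of SL_d(k) acting on S = k[x_1,…,x_d] with invariant subring R = S^G, and assume R is an isolated singularity. Then for every finitely generated maximal Cohen–Macaulay R-module X (i.e., Ext^i_R(X, R) = 0 for all i > 0) there exists an exact sequence 0 → C_{d−2} → ⋯ → C_1 → C_0 → X → 0 of finitely generated R-modules in which each C_i is a direct summand of a finite direct sum of copies of S, and such that the induced sequence 0 → Hom_R(S, C_{d−2}) → ⋯ → Hom_R(S, C_0) → Hom_R(S, X) → 0 is exact. -/

import Mathlib

open MvPolynomial Matrix

noncomputable section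

variable (k : Type) [Field k] (d : ℕ)

def matAct (M : Matrix (Fin d) (Fin d) k) :
    MvPolynomial (Fin d) k →ₐ[k] MvPolynomial (Fin d) k :=
  aeval fun i => ∑ j, M j i • X j

/-- The invariant subalgebra `R = S^G` of a subgroup `G ≤ SL_d(k)`. -/
def invRSL (G : Subgroup (Matrix.SpecialLinearGroup (Fin d) k)) :
    Subalgebra k (MvPolynomial (Fin d) k) where
  carrier := {s | ∀ g ∈ G, matAct k d (g : Matrix (Fin d) (Fin d) k) s = s}
  mul_mem' ha hb := fun g hg => by rw [_root_.map_mul, ha g hg, hb g hg]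
  add_mem' ha hb := fun g hg => by rw [_root_.map_add, ha g hg, hb g hg]
  algebraMap_mem' r := fun g hg => (matAct k d _).commutes r

/-- A commutative ring is regular local if it is Noetherian local and its maximal ideal
is generated by `dim A` elements. -/
def IsRegularLocal (A : Type) [CommRing A] : Prop :=
  IsNoetherianRing A ∧ ∃ (h : IsLocalRing A) (n : ℕ) (s : Fin n → A),
    Ideal.span (Set.range s) = @IsLocalRing.maximalIdeal A _ h ∧ ringKrullDim A = n

/-- The graded ('irrelevant') maximal ideal `m` of `R = S^G`: the contraction of the
irrelevant ideal `(x_1,…,x_d)` of `S`. -/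
def irrId (G : Subgroup (Matrix.SpecialLinearGroup (Fin d) k)) : Ideal ↥(invRSL k d G) :=
  Ideal.comap (algebraMap ↥(invRSL k d G) (MvPolynomial (Fin d) k))
    (Ideal.span (Set.range (X : Fin d → MvPolynomial (Fin d) k)))

/-- `R = S^G` is an isolated singularity: `R_p` is regular for every prime `p ≠ m`. -/
def IsIsolatedSing (G : Subgroup (Matrix.SpecialLinearGroup (Fin d) k)) : Prop :=
  ∀ (p : Ideal ↥(invRSL k d G)) (hp : p.IsPrime), p ≠ irrId k d G →
    IsRegularLocal (Localization (@Ideal.primeCompl _ _ p hp))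

set_option linter.unusedSectionVars false
set_option linter.unusedSimpArgs false
set_option linter.style.haveILetI false
set_option linter.unusedVariables false

-- part 1
namespace Inv17

open SkewMonoidAlgebra

section skew
variable {R S G : Type} [CommRing R] [CommRing S] [Group G] [MulSemiringAction G S]

/-- the inclusion of `S` in the skew group ring -/
def sg : S →+* SkewMonoidAlgebra S G where
  toFun s := single 1 s
  map_one' := rfl
  map_mul' a b := by rw [single_mul_single]; simp
  map_zero' := by simp
  map_add' a b := by simp [SkewMonoidAlgebra.single_add]

/-- the group elements in the skew group ring -/
def gm (g : G) : SkewMonoidAlgebra S G := single g 1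

lemma gm_mul (g h : G) : (gm g : SkewMonoidAlgebra S G) * gm h = gm (g * h) := by
  simp [gm, single_mul_single]

lemma gm_one : (gm 1 : SkewMonoidAlgebra S G) = 1 := rfl

lemma gm_sg (g : G) (s : S) : (gm g : SkewMonoidAlgebra S G) * sg s = sg (g • s) * gm g := by
  simp [gm, sg, single_mul_single]

lemma sg_gm (g : G) (s : S) : sg s * (gm g : SkewMonoidAlgebra S G) = single g s := by
  simp [gm, sg, single_mul_single]

lemma smul_eq_sg (s : S) (l : SkewMonoidAlgebra S G) : s • l = sg s * l := by
  induction l using SkewMonoidAlgebra.induction_on with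
  | zero => simp
  | single g a => simp [sg, single_mul_single, SkewMonoidAlgebra.smul_single]
  | add f g hf hg => rw [smul_add, hf, hg, mul_add]

lemma algMap_eq [Algebra R S] [SMulCommClass G R S] (r : R) :
    algebraMap R (SkewMonoidAlgebra S G) r = sg (algebraMap R S r) := by
  rfl

variable {M N : Type} [AddCommGroup M] [AddCommGroup N]

lemma gm_smul_smul [Module (SkewMonoidAlgebra S G) M] (g h : G) (m : M) :
    (gm g : SkewMonoidAlgebra S G) • (gm h : SkewMonoidAlgebra S G) • m
      = (gm (g * h) : SkewMonoidAlgebra S G) • m := by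
  rw [smul_smul, gm_mul]

/-- module structure over the skew group ring from a semilinear action -/
@[reducible]
def skewModule [Module S M] [DistribMulAction G M]
    (h : ∀ (g : G) (s : S) (m : M), g • (s • m) = (g • s) • g • m) :
    Module (SkewMonoidAlgebra S G) M :=
  Module.compHom M (liftNCRingHom (R := AddMonoid.End M) (Module.toAddMonoidEnd S M)
    (DistribMulAction.toAddMonoidEnd G M) (by
      intro x y
      ext m
      exact (h y x m).symm))

lemma skewModule_sg [Module S M] [DistribMulAction G M]
    (h : ∀ (g : G) (s : S) (m : M), g • (s • m) = (g • s) • g • m) (s : S) (m : M) :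
    letI := skewModule h
    (sg s : SkewMonoidAlgebra S G) • m = s • m := by
  change (liftNC (R := AddMonoid.End M) ((Module.toAddMonoidEnd S M : S →+* _) : S →+ _)
    (DistribMulAction.toAddMonoidEnd G M) (single 1 s)) m = _
  rw [liftNC_single]
  change s • ((1 : G) • m) = s • m
  rw [one_smul]

lemma skewModule_gm [Module S M] [DistribMulAction G M]
    (h : ∀ (g : G) (s : S) (m : M), g • (s • m) = (g • s) • g • m) (g : G) (m : M) :
    letI := skewModule h
    (gm g : SkewMonoidAlgebra S G) • m = g • m := by
  change (liftNC (R := AddMonoid.End M) ((Module.toAddMonoidEnd S M : S →+* _) : S →+ _)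
    (DistribMulAction.toAddMonoidEnd G M) (single g 1)) m = _
  rw [liftNC_single]
  change (1 : S) • (g • m) = g • m
  rw [one_smul]

variable [Module (SkewMonoidAlgebra S G) M] [Module (SkewMonoidAlgebra S G) N]

/-- a linear map over the skew group ring from `S`-linearity and equivariance -/
def mkLin (f : M →+ N) (h1 : ∀ (s : S) m, f ((sg s : SkewMonoidAlgebra S G) • m)
      = (sg s : SkewMonoidAlgebra S G) • f m)
    (h2 : ∀ (g : G) m, f ((gm g : SkewMonoidAlgebra S G) • m)
      = (gm g : SkewMonoidAlgebra S G) • f m) : M →ₗ[SkewMonoidAlgebra S G] N where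
  toFun := f
  map_add' := f.map_add
  map_smul' l m := by
    induction l using SkewMonoidAlgebra.induction_on with
    | zero => simp
    | single g a => simp only [RingHom.id_apply, ← sg_gm, mul_smul, h1, h2]
    | add a b ha hb => simp only [RingHom.id_apply] at *; rw [add_smul, map_add, ha, hb, add_smul]

@[simp] lemma mkLin_apply (f : M →+ N) (h1 h2) (m : M) :
  (mkLin (S := S) (G := G) f h1 h2) m = f m := rfl

lemma tower_of_sg [Module S M] (h : ∀ (s : S) (m : M), (sg s : SkewMonoidAlgebra S G) • m = s • m) :
    IsScalarTower S (SkewMonoidAlgebra S G) M :=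
  ⟨fun s l m => by rw [smul_eq_sg, mul_smul, h]⟩

lemma sg_smul_of_tower [Module S M] [IsScalarTower S (SkewMonoidAlgebra S G) M] (s : S) (m : M) :
    (sg s : SkewMonoidAlgebra S G) • m = s • m := by
  rw [← mul_one (sg s), ← smul_eq_sg, smul_assoc, one_smul]

instance finite_skew [Finite G] : Module.Finite S (SkewMonoidAlgebra S G) :=
  Module.Finite.of_basis (basisSingleOne)

instance noeth_skew [Finite G] [IsNoetherianRing S] : IsNoetherianRing (SkewMonoidAlgebra S G) :=
  isNoetherian_of_tower S inferInstance

/-! averaging -/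
variable [Fintype G] [Invertible (Fintype.card G : S)]

variable (S G) in
/-- the inverse of the group order, in the skew group ring -/
def cinv : SkewMonoidAlgebra S G := sg (⅟(Fintype.card G : S))

lemma cinv_comm (l : SkewMonoidAlgebra S G) : Commute (cinv S G) l := by
  have : Commute (Fintype.card G : SkewMonoidAlgebra S G) l := Nat.cast_commute _ _
  have h1 : (Fintype.card G : SkewMonoidAlgebra S G) = sg (Fintype.card G : S) := by simp
  have h2 : cinv S G * (Fintype.card G : SkewMonoidAlgebra S G) = 1 := by
    rw [h1, cinv, ← map_mul, invOf_mul_self, map_one]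
  have h3 : (Fintype.card G : SkewMonoidAlgebra S G) * cinv S G = 1 := by
    rw [h1, cinv, ← map_mul, mul_invOf_self, map_one]
  unfold Commute SemiconjBy at *
  calc cinv S G * l = cinv S G * l * ((Fintype.card G : SkewMonoidAlgebra S G) * cinv S G) := by
        rw [h3, mul_one]
    _ = cinv S G * (l * (Fintype.card G : SkewMonoidAlgebra S G)) * cinv S G := by noncomm_ring
    _ = (cinv S G * (Fintype.card G : SkewMonoidAlgebra S G)) * l * cinv S G := by
        rw [← this]; noncomm_ring
    _ = l * cinv S G := by rw [h2, one_mul]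

lemma cinv_card (m : M) : cinv S G • (Fintype.card G • m) = m := by
  have h1 : (Fintype.card G : SkewMonoidAlgebra S G) = sg (Fintype.card G : S) := by simp
  have h2 : cinv S G * (Fintype.card G : SkewMonoidAlgebra S G) = 1 := by
    rw [h1, cinv, ← map_mul, invOf_mul_self, map_one]
  rw [← Nat.cast_smul_eq_nsmul (SkewMonoidAlgebra S G), smul_smul, h2, one_smul]

/-- averaging an `S`-linear map -/
def avgMap (f : M →+ N) (h1 : ∀ (s : S) m, f ((sg s : SkewMonoidAlgebra S G) • m)
      = (sg s : SkewMonoidAlgebra S G) • f m) : M →ₗ[SkewMonoidAlgebra S G] N :=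
  mkLin
    { toFun := fun m => cinv S G • ∑ g : G, (gm g : SkewMonoidAlgebra S G) •
          f ((gm g⁻¹ : SkewMonoidAlgebra S G) • m)
      map_zero' := by simp
      map_add' := fun a b => by simp [smul_add, Finset.sum_add_distrib] }
    (by
      intro s m
      simp only [AddMonoidHom.coe_mk, ZeroHom.coe_mk]
      rw [smul_smul, ← (cinv_comm (sg s)).eq, ← smul_smul, Finset.smul_sum (r := sg s)]
      refine congrArg _ (Finset.sum_congr rfl fun g _ => ?_)
      rw [smul_smul, gm_sg, mul_smul, h1, smul_smul, gm_sg, ← mul_smul, mul_inv_cancel, one_smul, mul_smul])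
    (by
      intro h m
      simp only [AddMonoidHom.coe_mk, ZeroHom.coe_mk]
      rw [smul_smul, ← (cinv_comm (gm h)).eq, ← smul_smul, Finset.smul_sum (r := gm h)]
      refine congrArg _ (Fintype.sum_equiv (Equiv.mulLeft h⁻¹) _ _ fun g => ?_)
      simp [gm_smul_smul])

lemma avgMap_apply (f : M →+ N) (h1) (m : M) :
    (avgMap (S := S) (G := G) f h1) m = cinv S G • ∑ g : G, (gm g : SkewMonoidAlgebra S G) •
          f ((gm g⁻¹ : SkewMonoidAlgebra S G) • m) := rfl

/-- value of the averaging if `f` is equivariant at the relevant places -/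
lemma avgMap_eq (f : M →+ N) (h1) (m : M) (n : N)
    (h : ∀ g : G, (gm g : SkewMonoidAlgebra S G) •
          f ((gm g⁻¹ : SkewMonoidAlgebra S G) • m) = n) :
    (avgMap (S := S) (G := G) f h1) m = n := by
  rw [avgMap_apply, Finset.sum_congr rfl (fun g _ => h g)]
  rw [Finset.sum_const, Finset.card_univ, cinv_card]

/-- invariants vanish if the average vanishes etc. -/
def inv (M : Type) [AddCommGroup M] [Module (SkewMonoidAlgebra S G) M] : AddSubgroup M where
  carrier := {m | ∀ g : G, (gm g : SkewMonoidAlgebra S G) • m = m}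
  zero_mem' := by simp
  add_mem' := by intro a b ha hb g; rw [smul_add, ha g, hb g]
  neg_mem' := by intro a ha g; rw [smul_neg, ha g]

variable (S G) in
/-- the Reynolds operator -/
def rey (m : M) : M := cinv S G • ∑ g : G, (gm g : SkewMonoidAlgebra S G) • m

lemma gm_rey (h : G) (m : M) : (gm h : SkewMonoidAlgebra S G) • rey S G m = rey S G m := by
  unfold rey
  rw [smul_smul, ← (cinv_comm (gm h)).eq, ← smul_smul, Finset.smul_sum (r := gm h)]
  refine congrArg _ (Fintype.sum_equiv (Equiv.mulLeft h) _ _ fun g => ?_)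
  simp [gm_smul_smul]

lemma rey_of_inv (m : M) (hm : ∀ g : G, (gm g : SkewMonoidAlgebra S G) • m = m) :
    rey S G m = m := by
  unfold rey
  rw [Finset.sum_congr rfl (fun g _ => hm g), Finset.sum_const, Finset.card_univ, cinv_card]

lemma map_rey (f : M →ₗ[SkewMonoidAlgebra S G] N) (m : M) : f (rey S G m) = rey S G (f m) := by
  simp [rey]

lemma rey_add (a b : M) : rey S G (a + b) = rey S G a + rey S G b := by
  simp [rey, smul_add, Finset.sum_add_distrib]

/-- modules that are projective over `S` are projective over the skew group ring -/
lemma projective_skew [Module S M] [IsScalarTower S (SkewMonoidAlgebra S G) M]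
    [Module.Projective S M] : Module.Projective (SkewMonoidAlgebra S G) M := by
  refine Module.Projective.of_lifting_property'' fun f hf => ?_
  obtain ⟨h, hh⟩ := Module.projective_lifting_property (f.restrictScalars S) LinearMap.id hf
  refine ⟨avgMap h.toAddMonoidHom (fun s m => ?_), ?_⟩
  · simp only [LinearMap.toAddMonoidHom_coe, sg_smul_of_tower, map_smul]
  · ext m
    rw [LinearMap.comp_apply, avgMap_apply, map_smul, _root_.map_sum]
    have : ∀ x, f (h x) = x := fun x => LinearMap.congr_fun hh x
    simp [this, gm_smul_smul, gm_one, cinv_card]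

end skew
end Inv17

-- part 2
namespace Inv17

section auslander
variable {R S G : Type} [CommRing R] [CommRing S] [Group G] [MulSemiringAction G S]
  [IsDomain S] [UniqueFactorizationMonoid S]

lemma dvd_of_relPrime {D b x y : S} (h : IsRelPrime x y) (hx : D ∣ b * x) (hy : D ∣ b * y) :
    D ∣ b := by
  letI := UniqueFactorizationMonoid.toGCDMonoid S
  have h1 : D ∣ gcd (b * x) (b * y) := dvd_gcd hx hy
  have h2 : Associated (gcd (b * x) (b * y)) (b * gcd x y) := gcd_mul_left' b x y
  have h3 : IsUnit (gcd x y) := h (gcd_dvd_left _ _) (gcd_dvd_right _ _)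
  exact (h1.trans h2.dvd).trans ((IsUnit.dvd_mul_right h3).1 dvd_rfl)

lemma relPrime_smul (g : G) {x y : S} (h : IsRelPrime x y) : IsRelPrime (g • x) (g • y) := by
  intro p hx hy
  have : IsUnit (g⁻¹ • p) := by
    apply h
    · obtain ⟨q, hq⟩ := hx
      exact ⟨g⁻¹ • q, by rw [← smul_mul', ← hq, inv_smul_smul]⟩
    · obtain ⟨q, hq⟩ := hy
      exact ⟨g⁻¹ • q, by rw [← smul_mul', ← hq, inv_smul_smul]⟩
  have h2 := this.map (MulSemiringAction.toRingHom G S g)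
  simpa using h2

/-- the codimension two hypothesis -/
def Codim2 (S G : Type) [CommRing S] [Group G] [MulSemiringAction G S] : Prop :=
  ∀ g : G, g ≠ 1 → ∃ a b : S, IsRelPrime (g • a - a) (g • b - b)

lemma Codim2.pair (hc : Codim2 S G) {g h : G} (hgh : g ≠ h) :
    ∃ a b : S, IsRelPrime (g • a - h • a) (g • b - h • b) := by
  obtain ⟨a, b, hab⟩ := hc (h⁻¹ * g) (fun e => hgh (inv_mul_eq_one.1 e).symm)
  refine ⟨a, b, ?_⟩
  have := relPrime_smul h hab
  simpa [smul_sub, smul_smul] using this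

lemma dvd_coeff (hc : Codim2 S G) (D : S) (n : ℕ) : ∀ (H : Finset G) (_ : H.card = n)
    (c : G → S) (_ : ∀ s : S, D ∣ ∑ g ∈ H, c g * g • s) (h : G) (_ : h ∈ H), D ∣ c h := by
  classical
  induction n with
  | zero =>
    intro H hH c _ h hh
    rw [Finset.card_eq_zero] at hH
    simp [hH] at hh
  | succ n ih =>
    intro H hH c hD h hh
    by_cases hex : ∃ g0 ∈ H, g0 ≠ h
    · obtain ⟨g0, hg0, hne⟩ := hex
      have key : ∀ a : S, D ∣ c h * (h • a - g0 • a) := by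
        intro a
        refine ih (H.erase g0) (by rw [Finset.card_erase_of_mem hg0, hH]; rfl)
          (fun g => c g * (g • a - g0 • a)) ?_ h (Finset.mem_erase.2 ⟨hne.symm, hh⟩)
        intro s
        have e : ∑ g ∈ H.erase g0, c g * (g • a - g0 • a) * g • s
            = (∑ g ∈ H, c g * g • (a * s)) - g0 • a * ∑ g ∈ H, c g * g • s := by
          rw [Finset.mul_sum, ← Finset.sum_sub_distrib, ← Finset.sum_erase_add H _ hg0]
          rw [smul_mul']
          rw [show c g0 * (g0 • a * g0 • s) - g0 • a * (c g0 * g0 • s) = 0 by ring, add_zero]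
          refine Finset.sum_congr rfl fun g _ => ?_
          rw [smul_mul']; ring
        rw [e]
        exact dvd_sub (hD _) (Dvd.dvd.mul_left (hD _) _)
      obtain ⟨a, b, hab⟩ := hc.pair hne.symm
      exact dvd_of_relPrime hab (key a) (key b)
    · push Not at hex
      have : H = {h} := Finset.eq_singleton_iff_unique_mem.2 ⟨hh, hex⟩
      have h1 := hD 1
      rw [this] at h1
      simpa using h1

variable [Fintype G]

lemma indep (hc : Codim2 S G) (c : G → S) (h : ∀ s : S, ∑ g, c g * g • s = 0) : c = 0 := by
  funext g
  exact zero_dvd_iff.1 (dvd_coeff hc 0 _ Finset.univ rfl c (fun s => by rw [h s]) g (by simp))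

variable [Algebra R S] [SMulCommClass G R S]

open TensorProduct

/-- evaluation of a tensor `s ⊗ t ↦ φ s * g t`. -/
def tev (φ : S →ₗ[R] S) (g : G) : S ⊗[R] S →ₗ[R] S :=
  (LinearMap.mul' R S).comp (TensorProduct.map φ (MulSemiringAction.toAlgHom R S g).toLinearMap)

@[simp] lemma tev_tmul (φ : S →ₗ[R] S) (g : G) (s t : S) : tev φ g (s ⊗ₜ[R] t) = φ s * g • t := rfl

lemma tev_mul (g : G) (s t : S) (u : S ⊗[R] S) :
    tev LinearMap.id g ((s ⊗ₜ[R] t) * u) = s * g • t * tev LinearMap.id g u := by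
  induction u with
  | zero => simp
  | tmul a b => simp [smul_mul']; ring
  | add a b ha hb => rw [mul_add, map_add, ha, hb, map_add, mul_add]

lemma exists_sep (hc : Codim2 S G) (H : Finset G) (hH : 1 ∉ H) :
    ∃ u : S ⊗[R] S, (∀ g ∈ H, tev LinearMap.id g u = 0) ∧ tev LinearMap.id (1 : G) u ≠ 0 := by
  classical
  induction H using Finset.induction_on with
  | empty => exact ⟨1 ⊗ₜ 1, by simp, by simp⟩
  | insert h H hh ih =>
    obtain ⟨u, hu, hu1⟩ := ih (fun h1 => hH (Finset.mem_insert_of_mem h1))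
    have hne : h ≠ 1 := fun e => hH (e ▸ Finset.mem_insert_self _ _)
    obtain ⟨a, ha⟩ : ∃ a : S, h • a - a ≠ 0 := by
      by_contra! hcon
      obtain ⟨a, b, hab⟩ := hc h hne
      rw [hcon a, hcon b] at hab
      exact not_isUnit_zero (hab dvd_rfl dvd_rfl)
    refine ⟨((h • a) ⊗ₜ[R] 1) * u - (1 ⊗ₜ[R] a) * u, ?_, ?_⟩
    · intro g hg
      rw [map_sub, tev_mul, tev_mul]
      rcases Finset.mem_insert.1 hg with rfl | hg
      · simp
      · rw [hu g hg]; simp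
    · rw [map_sub, tev_mul, tev_mul]
      simpa [sub_mul] using (mul_ne_zero ha hu1 : (h • a - a) * _ ≠ 0)

lemma exists_inv [Algebra.IsInvariant R S G] (s : S) (hs : ∀ g : G, g • s = s) :
    ∃ r : R, algebraMap R S r = s :=
  Algebra.IsInvariant.isInvariant (A := R) (B := S) (G := G) s hs

lemma exists_sep2 [Algebra.IsInvariant R S G] (hc : Codim2 S G) :
    ∃ (u : S ⊗[R] S) (D : R), algebraMap R S D ≠ 0 ∧ (∀ g : G, g ≠ 1 → tev LinearMap.id g u = 0) ∧
      tev LinearMap.id (1 : G) u = algebraMap R S D := by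
  classical
  obtain ⟨u, hu, hu1⟩ := exists_sep (R := R) hc (Finset.univ.erase (1 : G)) (by simp)
  set D := tev LinearMap.id (1 : G) u with hDdef
  obtain ⟨r, hr⟩ := exists_inv (R := R) (G := G) (∏ g : G, g • D) (by
    intro h
    rw [Finset.smul_prod']
    exact Fintype.prod_equiv (Equiv.mulLeft h) _ _ (fun g => by simp [smul_smul]))
  refine ⟨((∏ g ∈ Finset.univ.erase (1 : G), g • D) ⊗ₜ[R] 1) * u, r, ?_, ?_, ?_⟩
  · rw [hr]
    exact Finset.prod_ne_zero_iff.2 fun g _ => by rwa [ne_eq, smul_eq_zero_iff_eq]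
  · intro g hg
    rw [tev_mul, hu g (by simp [hg]), mul_zero]
  · rw [tev_mul, ← hDdef, hr, ← Finset.prod_erase_mul _ _ (Finset.mem_univ (1 : G))]
    simp

/-- Auslander: every `R`-endomorphism of `S` comes from the skew group ring. -/
theorem auslander [Algebra.IsInvariant R S G] (hc : Codim2 S G) (φ : S →ₗ[R] S) :
    ∃ b : G → S, ∀ s, φ s = ∑ g, b g * g • s := by
  classical
  obtain ⟨u, D, hD, hu, hu1⟩ := exists_sep2 (R := R) (S := S) (G := G) hc
  have key : ∀ s, algebraMap R S D * φ s = ∑ g : G, tev φ g u * g • s := by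
    intro s
    have h1 : ∀ w : S ⊗[R] S, φ (∑ g : G, tev LinearMap.id g w * g • s)
        = ∑ g : G, tev φ g w * g • s := by
      intro w
      induction w with
      | zero => simp
      | tmul a b =>
        obtain ⟨r, hr⟩ := exists_inv (R := R) (G := G) (∑ g : G, g • (b * s)) (by
          intro h
          rw [Finset.smul_sum]
          exact Fintype.sum_equiv (Equiv.mulLeft h) _ _ (fun g => by simp [smul_smul]))
        have e : ∀ c : S, ∑ g : G, (c * g • b) * g • s = r • c := by
          intro c
          rw [Algebra.smul_def, hr, Finset.sum_mul]
          exact Finset.sum_congr rfl fun g _ => by rw [smul_mul']; ring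
        simp only [tev_tmul, LinearMap.id_coe, id_eq]
        rw [e, e, map_smul]
      | add a b ha hb =>
        simp only [map_add, add_mul, Finset.sum_add_distrib, ha, hb]
    rw [← h1, Finset.sum_eq_single (1 : G) (fun g _ hg => by rw [hu g hg, zero_mul]) (by simp),
      hu1, one_smul, ← Algebra.smul_def, ← Algebra.smul_def, map_smul]
  have hdiv : ∀ g : G, algebraMap R S D ∣ tev φ g u := fun g =>
    dvd_coeff hc _ _ Finset.univ rfl _ (fun s => ⟨φ s, (key s).symm⟩) g (by simp)
  choose b hb using hdiv
  refine ⟨b, fun s => mul_left_cancel₀ hD ?_⟩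
  rw [key, Finset.mul_sum]
  exact Finset.sum_congr rfl fun g _ => by rw [hb]; ring

end auslander
end Inv17

-- part 3
namespace Inv17

section linforms
variable {K : Type} [Field K] {n : ℕ}

/-- linear form with given coefficients -/
def lf (u : Fin n → K) : MvPolynomial (Fin n) K := ∑ j, u j • X j

lemma coeff_lf (u : Fin n → K) (i : Fin n) : coeff (Finsupp.single i 1) (lf u) = u i := by
  classical
  simp [lf, coeff_sum, coeff_smul, coeff_X, Finsupp.single_left_inj]

lemma lf_ne {u : Fin n → K} (hu : u ≠ 0) : lf u ≠ 0 := by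
  intro h
  apply hu
  funext i
  rw [← coeff_lf u i, h]; simp

lemma lf_deg (u : Fin n → K) : (lf u).totalDegree ≤ 1 := by
  refine totalDegree_finsetSum_le fun i _ => ?_
  exact (totalDegree_smul_le _ _).trans (by simp)

lemma relPrime_lf {u w : Fin n → K} (hu : u ≠ 0) (h : ¬ IsRelPrime (lf u) (lf w)) :
    ∃ c : K, w = c • u := by
  classical
  unfold IsRelPrime at h
  push Not at h
  obtain ⟨p, hpu, hpw, hp⟩ := h
  obtain ⟨q, hq⟩ := hpu
  obtain ⟨q', hq'⟩ := hpw
  have hp0 : p ≠ 0 := by rintro rfl; exact lf_ne hu (by rw [hq, zero_mul])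
  have hq0 : q ≠ 0 := by rintro rfl; exact lf_ne hu (by rw [hq, mul_zero])
  have hdp : 1 ≤ p.totalDegree := by
    by_contra hcon
    have h0 : p.totalDegree = 0 := by omega
    rw [totalDegree_eq_zero_iff_eq_C] at h0
    apply hp
    rw [h0]
    refine IsUnit.map C (IsUnit.mk0 _ ?_)
    intro h1
    rw [h1] at h0
    exact hp0 (by rw [h0]; simp)
  have hdq : q.totalDegree = 0 := by
    have := totalDegree_mul_of_isDomain hp0 hq0
    rw [← hq] at this
    have := lf_deg u
    omega
  have hdq' : q'.totalDegree = 0 := by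
    by_cases h0 : q' = 0
    · simp [h0]
    have := totalDegree_mul_of_isDomain hp0 h0
    rw [← hq'] at this
    have := lf_deg w
    omega
  rw [totalDegree_eq_zero_iff_eq_C] at hdq hdq'
  set c := coeff 0 q
  set c' := coeff 0 q'
  have hc : c ≠ 0 := by
    intro h; rw [h] at hdq; exact hq0 (by rw [hdq]; simp)
  refine ⟨c' * c⁻¹, ?_⟩
  funext i
  rw [Pi.smul_apply, ← coeff_lf u i, ← coeff_lf w i, hq, hq', hdq, hdq', mul_comm p, mul_comm p,
    coeff_C_mul, coeff_C_mul, smul_eq_mul]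
  field_simp

/-- a matrix of determinant one and finite order with rank one difference from identity -/
lemma unip [CharZero K] (M : Matrix (Fin n) (Fin n) K) (hM : M.det = 1) (m : ℕ) (hm : 0 < m)
    (hMm : M ^ m = 1) (u v : Fin n → K) (h : ∀ j i, (M - 1) j i = u j * v i) : M = 1 := by
  have hB : M - 1 = vecMulVec u v := by ext j i; rw [h]; rfl
  have hM' : M = 1 + vecMulVec u v := by rw [← hB]; abel
  have hdot : v ⬝ᵥ u = 0 := by
    have := det_one_add_replicateCol_mul_replicateRow (ι := Unit) u v
    rw [← vecMulVec_eq, ← hM', hM] at this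
    linear_combination -this
  have hsq : vecMulVec u v * vecMulVec u v = 0 := by
    rw [vecMulVec_mul_vecMulVec, hdot, zero_smul]
    simp
  have hpow : ∀ j : ℕ, M ^ j = 1 + (j : K) • vecMulVec u v := by
    intro j
    induction j with
    | zero => simp
    | succ j ih =>
      rw [pow_succ, ih, hM', mul_add, add_mul, add_mul, smul_mul_assoc, smul_mul_assoc, hsq]
      push_cast
      rw [add_smul]
      simp
      abel
  rw [hpow m] at hMm
  have h0 : (m : K) • vecMulVec u v = 0 := by simpa using hMm
  have h1 : vecMulVec u v = 0 := (smul_eq_zero.1 h0).resolve_left (by exact_mod_cast hm.ne')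
  rw [hM', h1, add_zero]

end linforms

section concrete
variable {K : Type} [Field K] {n : ℕ}

lemma matAct_X (M : Matrix (Fin n) (Fin n) K) (i : Fin n) : matAct K n M (X i) = lf (fun j => M j i) := by
  simp [matAct, lf]

lemma matAct_lf (M : Matrix (Fin n) (Fin n) K) (u : Fin n → K) :
    matAct K n M (lf u) = lf (M.mulVec u) := by
  simp only [lf, _root_.map_sum, map_smul, matAct_X, mulVec, dotProduct, Finset.sum_smul,
    Finset.smul_sum]
  rw [Finset.sum_comm]
  refine Finset.sum_congr rfl fun i _ => Finset.sum_congr rfl fun j _ => ?_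
  rw [smul_smul, mul_comm]

lemma matAct_mul (M N : Matrix (Fin n) (Fin n) K) :
    matAct K n (M * N) = (matAct K n M).comp (matAct K n N) := by
  apply MvPolynomial.algHom_ext
  intro i
  rw [AlgHom.comp_apply, matAct_X, matAct_X, matAct_lf]
  rfl

lemma matAct_one : matAct K n (1 : Matrix (Fin n) (Fin n) K) = AlgHom.id K _ := by
  classical
  apply MvPolynomial.algHom_ext
  intro i
  rw [matAct_X]
  simp [lf, Matrix.one_apply]

variable (G : Subgroup (Matrix.SpecialLinearGroup (Fin n) K))

/-- the action of `G` on the polynomial ring -/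
@[reducible]
def actG : MulSemiringAction G (MvPolynomial (Fin n) K) where
  smul g s := matAct K n (g : Matrix.SpecialLinearGroup (Fin n) K).1 s
  one_smul s := by
    change matAct K n 1 s = s
    rw [matAct_one]; rfl
  mul_smul g h s := by
    change matAct K n (g.1.1 * h.1.1) s = _
    rw [matAct_mul]; rfl
  smul_zero g := _root_.map_zero _
  smul_add g := _root_.map_add _
  smul_one g := _root_.map_one _
  smul_mul g := _root_.map_mul _

attribute [local instance] actG

lemma actG_def (g : G) (s : MvPolynomial (Fin n) K) :
    g • s = matAct K n (g : Matrix.SpecialLinearGroup (Fin n) K).1 s := rfl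

instance commK : SMulCommClass G K (MvPolynomial (Fin n) K) :=
  ⟨fun g c s => by rw [actG_def, actG_def, map_smul]⟩

instance commR : SMulCommClass G (invRSL K n G) (MvPolynomial (Fin n) K) :=
  ⟨fun g r s => by
    rw [actG_def, actG_def, Algebra.smul_def, Algebra.smul_def, _root_.map_mul]
    congr 1
    exact r.2 g.1 g.2⟩

instance isInvR : Algebra.IsInvariant (invRSL K n G) (MvPolynomial (Fin n) K) G :=
  ⟨fun s hs => ⟨⟨s, fun g hg => hs ⟨g, hg⟩⟩, rfl⟩⟩

lemma codim2 [CharZero K] [Finite G] : Codim2 (MvPolynomial (Fin n) K) G := by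
  classical
  intro g hg
  by_contra! hcon
  have hcol : ∀ i, g • (X i : MvPolynomial (Fin n) K) - X i = lf (fun j => (g.1.1 - 1) j i) := by
    intro i
    rw [actG_def, matAct_X]
    simp [lf, sub_smul, Finset.sum_sub_distrib, Matrix.one_apply]
  by_cases h0 : ∃ i, (fun j => (g.1.1 - 1) j i) ≠ 0
  · obtain ⟨i, hi⟩ := h0
    have hex : ∀ l, ∃ c : K, (fun j => (g.1.1 - 1) j l) = c • (fun j => (g.1.1 - 1) j i) := by
      intro l
      have := hcon (X i) (X l)
      rw [hcol, hcol] at this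
      exact relPrime_lf hi this
    choose v hv using hex
    have h1 := unip g.1.1 g.1.2 (orderOf g) (orderOf_pos g) (by
      have := pow_orderOf_eq_one g
      have h2 := congrArg (fun x : G => x.1.1) this
      have h3 : (g ^ orderOf g).1.1 = g.1.1 ^ orderOf g := rfl
      rw [← h3]
      exact h2) (fun j => (g.1.1 - 1) j i) v (by
        intro j l
        have := congrFun (hv l) j
        rw [mul_comm]
        simpa using this)
    apply hi
    funext j
    rw [h1, sub_self]; rfl
  · push Not at h0
    apply hg
    apply Subtype.ext
    apply Subtype.ext
    rw [← sub_eq_zero]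
    ext j i
    exact congrFun (h0 i) j

instance finS [Finite G] : Module.Finite (invRSL K n G) (MvPolynomial (Fin n) K) := by
  have h1 : Algebra.IsIntegral (invRSL K n G) (MvPolynomial (Fin n) K) :=
    Algebra.IsInvariant.isIntegral (invRSL K n G) (MvPolynomial (Fin n) K) G
  have h2 : Algebra.FiniteType (invRSL K n G) (MvPolynomial (Fin n) K) :=
    Algebra.FiniteType.of_restrictScalars_finiteType K _ _
  exact Algebra.IsIntegral.finite

instance ftR [Finite G] : Algebra.FiniteType K (invRSL K n G) := by
  refine ⟨fg_of_fg_of_fg K (invRSL K n G) (MvPolynomial (Fin n) K) Algebra.FiniteType.out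
    (Module.Finite.fg_top) Subtype.val_injective⟩

instance noethR [Finite G] : IsNoetherianRing (invRSL K n G) :=
  Algebra.FiniteType.isNoetherianRing K _

end concrete
end Inv17

-- part 4
namespace Inv17

section ext
variable {K : Type} [Field K] {n : ℕ}

variable (K n) in
/-- the exterior algebra of the standard space -/
abbrev EA := ExteriorAlgebra K (Fin n → K)

/-- exterior multiplication by a basis vector -/
def eps (i : Fin n) : Module.End K (EA K n) :=
  LinearMap.mulLeft K (ExteriorAlgebra.ι K (Pi.single i (1 : K)))

/-- contraction with a functional -/
def ctr (f : Module.Dual K (Fin n → K)) : Module.End K (EA K n) :=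
  CliffordAlgebra.contractLeft (Q := (0 : QuadraticForm K (Fin n → K))) f

lemma ctr_ι_mul (f : Module.Dual K (Fin n → K)) (v : Fin n → K) (b : EA K n) :
    ctr f (ExteriorAlgebra.ι K v * b) = f v • b - ExteriorAlgebra.ι K v * ctr f b :=
  CliffordAlgebra.contractLeft_ι_mul (Q := (0 : QuadraticForm K (Fin n → K))) f v b

lemma ctr_algebraMap (f : Module.Dual K (Fin n → K)) (r : K) :
    ctr f (algebraMap K _ r) = 0 :=
  CliffordAlgebra.contractLeft_algebraMap _ _ r

lemma ctr_add (f f' : Module.Dual K (Fin n → K)) : ctr (f + f') = ctr f + ctr f' :=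
  map_add _ _ _
lemma ctr_smul (c : K) (f : Module.Dual K (Fin n → K)) : ctr (c • f) = c • ctr f :=
  map_smul _ _ _
lemma ctr_sum {ι : Type} (s : Finset ι) (f : ι → Module.Dual K (Fin n → K)) :
    ctr (∑ i ∈ s, f i) = ∑ i ∈ s, ctr (f i) :=
  _root_.map_sum _ _ _

/-- contraction with a coordinate -/
def io (i : Fin n) : Module.End K (EA K n) := ctr (LinearMap.proj i)

lemma ext_induction {P : EA K n → Prop} (h0 : ∀ r, P (algebraMap K _ r))
    (h1 : ∀ v b, P b → P (ExteriorAlgebra.ι K v * b)) (h2 : ∀ a b, P a → P b → P (a + b))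
    (x : EA K n) : P x := by
  refine CliffordAlgebra.left_induction (Q := (0 : QuadraticForm K (Fin n → K))) h0 ?_ ?_ x
  · intro x y; exact h2 x y
  · intro x m hx; exact h1 m x hx

lemma io_eps (i j : Fin n) : (io i : Module.End K (EA K n)) * eps j + eps j * io i
    = if i = j then 1 else 0 := by
  refine LinearMap.ext fun b => ?_
  simp only [LinearMap.add_apply, Module.End.mul_apply, eps, io, LinearMap.mulLeft_apply,
    ctr_ι_mul]
  by_cases h : i = j
  · subst h; simp
  · simp [h]

lemma io_io (i j : Fin n) : (io i : Module.End K (EA K n)) * io j = - (io j * io i) := by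
  refine LinearMap.ext fun b => ?_
  exact CliffordAlgebra.contractLeft_comm (Q := (0 : QuadraticForm K (Fin n → K))) (LinearMap.proj i) (LinearMap.proj j) b

lemma eps_eps (i j : Fin n) : (eps i : Module.End K (EA K n)) * eps j = - (eps j * eps i) := by
  refine LinearMap.ext fun b => ?_
  simp only [eps, Module.End.mul_apply, LinearMap.mulLeft_apply, LinearMap.neg_apply, ← mul_assoc]
  rw [eq_neg_of_add_eq_zero_left (ExteriorAlgebra.ι_add_mul_swap _ _), neg_mul]

variable (K n) in
/-- the number operator -/
def num : Module.End K (EA K n) := ∑ i, eps i * io i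

lemma num_algebraMap (r : K) : num K n (algebraMap K _ r) = 0 := by
  simp only [num, LinearMap.sum_apply, Module.End.mul_apply, io, ctr_algebraMap, map_zero,
    Finset.sum_const_zero]

lemma num_ι_mul (v : Fin n → K) (b : EA K n) :
    num K n (ExteriorAlgebra.ι K v * b) = ExteriorAlgebra.ι K v * b
      + ExteriorAlgebra.ι K v * num K n b := by
  classical
  simp only [num, LinearMap.sum_apply, Module.End.mul_apply, io, ctr_ι_mul, map_sub,
    Finset.sum_sub_distrib, eps, LinearMap.mulLeft_apply, Finset.mul_sum]
  have h1 : ∑ i, ExteriorAlgebra.ι K (Pi.single i (1 : K)) * ((LinearMap.proj i : Module.Dual K (Fin n → K)) v • b)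
      = ExteriorAlgebra.ι K v * b := by
    have : v = ∑ i, v i • (Pi.single i (1 : K) : Fin n → K) := by
      simpa using (pi_eq_sum_univ' v)
    conv_rhs => rw [this, _root_.map_sum, Finset.sum_mul]
    refine Finset.sum_congr rfl fun i _ => ?_
    rw [map_smul, mul_smul_comm, smul_mul_assoc]; rfl
  rw [h1, sub_eq_add_neg, ← Finset.sum_neg_distrib]
  congr 1
  refine Finset.sum_congr rfl fun i _ => ?_
  rw [← mul_assoc, ← mul_assoc, eq_neg_of_add_eq_zero_left (ExteriorAlgebra.ι_add_mul_swap _ _)]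
  rw [neg_mul, neg_neg]

lemma num_of_mem (m : ℕ) (x : EA K n) (hx : x ∈ ⋀[K]^m (Fin n → K)) : num K n x = (m : K) • x := by
  rw [← ExteriorAlgebra.ιMulti_span_fixedDegree] at hx
  induction hx using Submodule.span_induction with
  | mem x hx =>
    obtain ⟨v, rfl⟩ := hx
    induction m with
    | zero =>
      rw [ExteriorAlgebra.ιMulti_zero_apply, ← map_one (algebraMap K (EA K n)), num_algebraMap]; simp
    | succ m ih =>
      rw [ExteriorAlgebra.ιMulti_succ_apply, num_ι_mul, ih, mul_smul_comm]
      push_cast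
      rw [add_smul, one_smul, add_comm]
  | zero => simp
  | add a b _ _ ha hb => rw [map_add, ha, hb, smul_add]
  | smul c a _ ha => rw [map_smul, ha, smul_comm]

/-- projection to a graded piece -/
def pr (m : ℕ) : Module.End K (EA K n) :=
    { toFun := fun x => DirectSum.decompose (fun i : ℕ ↦ ⋀[K]^i (Fin n → K)) x m
      map_add' := by intro a b; simp
      map_smul' := by
        intro c a
        rw [DirectSum.decompose_smul]; rfl }

lemma pr_mem (m : ℕ) (x : EA K n) : pr m x ∈ ⋀[K]^m (Fin n → K) :=
  (DirectSum.decompose (fun i : ℕ ↦ ⋀[K]^i (Fin n → K)) x m).2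

lemma power_eq_bot (m : ℕ) (hm : n < m) : ⋀[K]^m (Fin n → K) = ⊥ := by
  rw [← ExteriorAlgebra.ιMulti_span_fixedDegree, Submodule.span_eq_bot]
  rintro _ ⟨v, rfl⟩
  refine AlternatingMap.map_linearDependent _ v fun hv => ?_
  have := hv.fintype_card_le_finrank
  simp at this
  omega

lemma pr_zero_of_lt (m : ℕ) (hm : n < m) : (pr m : Module.End K (EA K n)) = 0 := by
  refine LinearMap.ext fun x => ?_
  have := pr_mem m x
  rw [power_eq_bot m hm] at this
  simpa using this

lemma sum_pr : ∑ m ∈ Finset.range (n + 1), (pr m : Module.End K (EA K n)) = 1 := by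
  classical
  refine LinearMap.ext fun x => ?_
  rw [LinearMap.sum_apply, Module.End.one_apply]
  conv_rhs => rw [← DirectSum.sum_support_decompose (fun i : ℕ ↦ ⋀[K]^i (Fin n → K)) x]
  symm
  apply Finset.sum_subset
  · intro m hm
    rw [DFinsupp.mem_support_iff] at hm
    by_contra hcon
    apply hm
    apply Subtype.ext
    have := pr_mem m x
    rw [power_eq_bot m (by simpa using hcon)] at this
    exact (Submodule.mem_bot K).1 this
  · intro m _ hm
    rw [DFinsupp.mem_support_iff, not_not] at hm
    rw [hm]; rfl

lemma pr_of_mem (m : ℕ) (x : EA K n) (hx : x ∈ ⋀[K]^m (Fin n → K)) : pr m x = x :=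
  DirectSum.decompose_of_mem_same (fun i : ℕ ↦ ⋀[K]^i (Fin n → K)) hx

lemma pr_of_mem_ne (m l : ℕ) (hml : l ≠ m) (x : EA K n) (hx : x ∈ ⋀[K]^l (Fin n → K)) : pr m x = 0 :=
  DirectSum.decompose_of_mem_ne (fun i : ℕ ↦ ⋀[K]^i (Fin n → K)) hx hml

lemma num_pr (m : ℕ) : num K n * pr m = (m : K) • pr m := by
  refine LinearMap.ext fun x => ?_
  exact num_of_mem m _ (pr_mem m x)

lemma pr_num (m : ℕ) : pr m * num K n = (m : K) • pr m := by
  have h : ∀ l, pr m * (num K n * pr l) = (m : K) • (pr m * pr l) := by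
    intro l
    refine LinearMap.ext fun x => ?_
    rw [num_pr]
    simp only [Module.End.mul_apply, LinearMap.smul_apply, map_smul]
    by_cases hl : l = m
    · rw [hl]
    · rw [pr_of_mem_ne m l hl _ (pr_mem l x)]; simp
  calc pr m * num K n = ∑ l ∈ Finset.range (n + 1), pr m * (num K n * pr l) := by
        rw [← Finset.mul_sum, ← Finset.mul_sum, sum_pr, mul_one]
    _ = (m : K) • pr m := by
        simp only [h, ← Finset.smul_sum, ← Finset.mul_sum, sum_pr, mul_one]

lemma pr_zero (x : EA K n) : ∃ c : K, pr 0 x = algebraMap K _ c := by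
  have := pr_mem 0 x
  rw [ExteriorAlgebra.exteriorPower, pow_zero] at this
  obtain ⟨c, hc⟩ := this
  exact ⟨c, by rw [← hc, Algebra.algebraMap_eq_smul_one]; rfl⟩

/-- action of a matrix on the exterior algebra -/
def emap (M : Matrix (Fin n) (Fin n) K) : Module.End K (EA K n) :=
  (ExteriorAlgebra.map M.mulVecLin).toLinearMap

lemma emap_mul (M N : Matrix (Fin n) (Fin n) K) : emap (M * N) = emap M * emap N := by
  refine LinearMap.ext fun x => ?_
  simp only [emap, Matrix.mulVecLin_mul, Module.End.mul_apply, AlgHom.toLinearMap_apply]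
  rw [← ExteriorAlgebra.map_comp_map]; rfl

lemma emap_one : emap (1 : Matrix (Fin n) (Fin n) K) = 1 := by
  refine LinearMap.ext fun x => ?_
  simp [emap]

lemma emap_ι_mul (M : Matrix (Fin n) (Fin n) K) (v : Fin n → K) (b : EA K n) :
    emap M (ExteriorAlgebra.ι K v * b) = ExteriorAlgebra.ι K (M.mulVec v) * emap M b := by
  simp [emap]

lemma emap_algebraMap (M : Matrix (Fin n) (Fin n) K) (r : K) :
    emap M (algebraMap K _ r) = algebraMap K _ r := by
  simp [emap]

lemma emap_ctr (M : Matrix (Fin n) (Fin n) K) (f : Module.Dual K (Fin n → K)) (b : EA K n) :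
    emap M (ctr (f.comp M.mulVecLin) b) = ctr f (emap M b) := by
  induction b using ext_induction with
  | h0 r => simp [ctr_algebraMap, emap_algebraMap]
  | h1 v b hb =>
    rw [ctr_ι_mul, emap_ι_mul, ctr_ι_mul, map_sub, map_smul, emap_ι_mul, hb]; rfl
  | h2 a b ha hb => rw [map_add, map_add, map_add, map_add, ha, hb]

lemma proj_comp (M : Matrix (Fin n) (Fin n) K) (i : Fin n) :
    (LinearMap.proj i : Module.Dual K (Fin n → K)).comp M.mulVecLin
      = ∑ j, M i j • (LinearMap.proj j : Module.Dual K (Fin n → K)) := by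
  refine LinearMap.ext fun v => ?_
  simp [Matrix.mulVec, dotProduct]

lemma io_emap (M : Matrix (Fin n) (Fin n) K) (i : Fin n) (b : EA K n) :
    io i (emap M b) = ∑ j, M i j • emap M (io j b) := by
  rw [io, ← emap_ctr, proj_comp, ctr_sum]
  simp [ctr_smul, io, LinearMap.sum_apply]

lemma emap_eps (M : Matrix (Fin n) (Fin n) K) (i : Fin n) (b : EA K n) :
    emap M (eps i b) = ∑ j, M j i • eps j (emap M b) := by
  classical
  simp only [eps, LinearMap.mulLeft_apply, emap_ι_mul]
  have : M.mulVec (Pi.single i 1) = ∑ j, M j i • (Pi.single j (1 : K) : Fin n → K) := by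
    rw [Matrix.mulVec_single_one]
    simpa using (pi_eq_sum_univ' (M.col i))
  rw [this, _root_.map_sum, Finset.sum_mul]
  simp

lemma emap_num (M : Matrix (Fin n) (Fin n) K) : emap M * num K n = num K n * emap M := by
  refine LinearMap.ext fun x => ?_
  induction x using ext_induction with
  | h0 r => simp only [Module.End.mul_apply, num_algebraMap, emap_algebraMap, map_zero]
  | h1 v b hb =>
    simp only [Module.End.mul_apply] at *
    rw [num_ι_mul, emap_ι_mul, num_ι_mul, map_add, emap_ι_mul, emap_ι_mul, hb]
  | h2 a b ha hb => rw [map_add, map_add, ha, hb]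

lemma alt_det {W : Type} [AddCommGroup W] [Module K W] (f : (Fin n → K) [⋀^Fin n]→ₗ[K] W)
    (v : Fin n → Fin n → K) : f v = (Matrix.of v).det • f (fun i => Pi.single i 1) := by
  classical
  have : f = (LinearMap.toSpanSingleton K W (f (fun i => Pi.single i 1))).compAlternatingMap
      (Matrix.detRowAlternating (R := K) (n := Fin n)) := by
    refine Module.Basis.ext_alternating (Pi.basisFun K (Fin n)) fun σ hσ => ?_
    obtain ⟨τ, rfl⟩ : ∃ τ : Equiv.Perm (Fin n), σ = τ :=
      ⟨Equiv.ofBijective σ (Finite.injective_iff_bijective.1 hσ), rfl⟩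
    have h1 := f.map_perm (fun i => (Pi.single i 1 : Fin n → K)) τ
    have h2 := (Matrix.detRowAlternating (R := K) (n := Fin n)).map_perm
      (fun i => (Pi.single i 1 : Fin n → K)) τ
    simp only [Pi.basisFun_apply, LinearMap.compAlternatingMap_apply, Function.comp_def] at *
    rw [h1, h2]
    have h3 : (Matrix.detRowAlternating (R := K) (n := Fin n)) (fun i => (Pi.single i 1 : Fin n → K))
        = 1 := by
      have : (fun i => (Pi.single i 1 : Fin n → K)) = (1 : Matrix (Fin n) (Fin n) K) := by
        ext i j; simp [Matrix.one_apply, Pi.single_apply, eq_comm]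
      rw [this]; exact Matrix.det_one
    rw [h3]
    simp [Units.smul_def, Int.cast_smul_eq_zsmul]
  conv_lhs => rw [this]
  rfl

lemma emap_pr_top (M : Matrix (Fin n) (Fin n) K) (hM : M.det = 1) (x : EA K n) :
    emap M (pr n x) = pr n x := by
  have hx := pr_mem n x
  rw [← ExteriorAlgebra.ιMulti_span_fixedDegree] at hx
  generalize pr n x = y at hx
  induction hx using Submodule.span_induction with
  | mem x hx =>
    obtain ⟨v, rfl⟩ := hx
    rw [emap, AlgHom.toLinearMap_apply, ExteriorAlgebra.map_apply_ιMulti, alt_det, alt_det _ v]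
    congr 1
    have : Matrix.of (M.mulVecLin ∘ v) = Matrix.of v * Mᵀ := by
      ext i j
      simp [Matrix.mul_apply, Matrix.mulVec, dotProduct, mul_comm]
    rw [this, Matrix.det_mul, Matrix.det_transpose, hM, mul_one]
  | zero => simp
  | add a b _ _ ha hb => rw [map_add, ha, hb]
  | smul c a _ ha => rw [map_smul, ha]

end ext
end Inv17

-- part 5
namespace Inv17

section ringid
variable {A : Type} [Ring A] {n : ℕ}

/-- commutation relations for bosonic and fermionic operators -/
structure Rels (a p α β : Fin n → A) : Prop where
  aa : ∀ i j, a i * a j = a j * a i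
  pa : ∀ i j, p j * a i = a i * p j + if i = j then 1 else 0
  aα : ∀ i j, a i * α j = α j * a i
  aβ : ∀ i j, a i * β j = β j * a i
  pα : ∀ i j, p i * α j = α j * p i
  pβ : ∀ i j, p i * β j = β j * p i
  αβ : ∀ i j, α i * β j + β j * α i = if i = j then 1 else 0
  αα : ∀ i j, α i * α j = - (α j * α i)
  ββ : ∀ i j, β i * β j = - (β j * β i)

variable {a p α β : Fin n → A} (h : Rels a p α β)

lemma Rels.sq [Algebra ℚ A] (h : Rels a p α β) : (∑ i, a i * α i) * (∑ i, a i * α i) = 0 := by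
  have e : (∑ i, a i * α i) * (∑ i, a i * α i) = - ((∑ i, a i * α i) * (∑ i, a i * α i)) := by
    conv_rhs => rw [Finset.sum_mul_sum, Finset.sum_comm, ← Finset.sum_neg_distrib]
    rw [Finset.sum_mul_sum]
    refine Finset.sum_congr rfl fun i _ => ?_
    rw [← Finset.sum_neg_distrib]
    refine Finset.sum_congr rfl fun j _ => ?_
    calc a i * α i * (a j * α j) = a i * (α i * a j) * α j := by noncomm_ring
      _ = (a i * a j) * (α i * α j) := by rw [← h.aα]; noncomm_ring
      _ = - (a j * (a i * α j) * α i) := by rw [h.aa, h.αα]; noncomm_ring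
      _ = - (a j * α j * (a i * α i)) := by rw [h.aα]; noncomm_ring
  have e2 : (2 : ℚ) • ((∑ i, a i * α i) * (∑ i, a i * α i)) = 0 := by
    rw [two_smul]; nth_rewrite 1 [e]; simp
  have := congrArg (fun x => (1 / 2 : ℚ) • x) e2
  simpa [smul_smul] using this

lemma Rels.homotopy (h : Rels a p α β) :
    (∑ i, a i * α i) * (∑ i, p i * β i) + (∑ i, p i * β i) * (∑ i, a i * α i)
      = (∑ i, a i * p i) + ∑ i, β i * α i := by
  rw [Finset.sum_mul_sum, Finset.sum_mul_sum]
  rw [Finset.sum_comm (f := fun i j => p i * β i * (a j * α j)), ← Finset.sum_add_distrib,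
    ← Finset.sum_add_distrib]
  refine Finset.sum_congr rfl fun i _ => ?_
  rw [← Finset.sum_add_distrib]
  have e : ∀ j, a i * α i * (p j * β j) + p j * β j * (a i * α i)
      = a i * p j * (if i = j then 1 else 0) + (if i = j then 1 else 0) * (β j * α i) := by
    intro j
    calc a i * α i * (p j * β j) + p j * β j * (a i * α i)
        = a i * (α i * p j) * β j + p j * (β j * a i) * α i := by noncomm_ring
      _ = a i * p j * (α i * β j) + (p j * a i) * (β j * α i) := by
          rw [← h.pα, ← h.aβ]; noncomm_ring
      _ = a i * p j * (α i * β j + β j * α i) + (if i = j then 1 else 0) * (β j * α i) := by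
          rw [h.pa, add_mul, mul_add]; abel
      _ = _ := by rw [h.αβ]
  rw [Finset.sum_congr rfl fun j _ => e j, Finset.sum_add_distrib]
  simp

lemma Rels.num_h (h : Rels a p α β) :
    (∑ i, β i * α i) * (∑ i, p i * β i) = (∑ i, p i * β i) * (∑ i, β i * α i) + ∑ i, p i * β i := by
  rw [Finset.sum_mul_sum, Finset.sum_mul_sum, Finset.sum_comm, ← Finset.sum_add_distrib]
  refine Finset.sum_congr rfl fun i _ => ?_
  have e : ∀ j, β j * α j * (p i * β i) = p i * β i * (β j * α j)
      + p i * β j * (if j = i then 1 else 0) := by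
    intro j
    calc β j * α j * (p i * β i) = β j * (α j * p i) * β i := by noncomm_ring
      _ = (β j * p i) * (α j * β i) := by rw [← h.pα]; noncomm_ring
      _ = p i * β j * (α j * β i) := by rw [h.pβ]
      _ = p i * β j * ((α j * β i + β i * α j) - β i * α j) := by rw [add_sub_cancel_right]
      _ = p i * β j * (if j = i then 1 else 0) - p i * (β j * β i) * α j := by
          rw [h.αβ]; noncomm_ring
      _ = _ := by rw [h.ββ]; noncomm_ring
  rw [Finset.sum_congr rfl fun j _ => e j, Finset.sum_add_distrib]
  simp

lemma Rels.num_D (h : Rels a p α β) :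
    (∑ i, β i * α i) * (∑ i, a i * α i) + (∑ i, a i * α i) = (∑ i, a i * α i) * (∑ i, β i * α i) := by
  rw [Finset.sum_mul_sum, Finset.sum_mul_sum, Finset.sum_comm, ← Finset.sum_add_distrib]
  refine Finset.sum_congr rfl fun i _ => ?_
  have e : ∀ j, β j * α j * (a i * α i) = a i * α i * (β j * α j)
      - a i * (if i = j then 1 else 0) * α j := by
    intro j
    calc β j * α j * (a i * α i) = β j * (α j * a i) * α i := by noncomm_ring
      _ = (β j * a i) * (α j * α i) := by rw [← h.aα]; noncomm_ring
      _ = - (a i * (β j * α i) * α j) := by rw [h.αα, ← h.aβ]; noncomm_ring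
      _ = - (a i * ((α i * β j + β j * α i) - α i * β j) * α j) := by rw [add_sub_cancel_left]
      _ = _ := by rw [h.αβ]; noncomm_ring
  rw [Finset.sum_congr rfl fun j _ => e j, Finset.sum_sub_distrib]
  simp

end ringid

section descent
variable {K W : Type} [Field K] [CharZero K] [AddCommGroup W] [Module K W]
  {n : ℕ} {a p α β : Fin n → Module.End K W}

/-- exactness by descending induction on a filtration -/
lemma descent (h : Rels a p α β) (F : ℕ → Submodule K W) (hF0 : F 0 = ⊥)
    (hF : ∀ q w, w ∈ F (q + 1) → (∑ i, a i * p i) w - (q : K) • w ∈ F q)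
    (m q : ℕ) : ∀ (w : W), w ∈ F q → (∑ i, a i * α i) w = 0 → (∑ i, β i * α i) w = (m : K) • w →
      ∃ w1 w0, w = (∑ i, a i * α i) w1 + w0 ∧ (∑ i, β i * α i) w1 = ((m + 1 : ℕ) : K) • w1 ∧
        w0 ∈ F 1 ∧ (∑ i, β i * α i) w0 = (m : K) • w0 ∧ (0 < m → w0 = 0) := by
  haveI : Algebra ℚ (Module.End K W) := by
    letI : Algebra ℚ K := DivisionRing.toRatAlgebra
    letI : Module ℚ W := Module.compHom W (algebraMap ℚ K)
    haveI : IsScalarTower ℚ K W := ⟨fun a b c => by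
      rw [Algebra.smul_def, mul_smul]; rfl⟩
    infer_instance
  have hsq := h.sq
  have hhom := h.homotopy
  have hnh := h.num_h
  have hnD := h.num_D
  set D := ∑ i, a i * α i
  set H := ∑ i, p i * β i
  set N := ∑ i, β i * α i
  set E := ∑ i, a i * p i
  have hsq' : ∀ w, D (D w) = 0 := fun w => LinearMap.congr_fun hsq w
  have hhom' : ∀ w, D (H w) + H (D w) = E w + N w := fun w => LinearMap.congr_fun hhom w
  have hnh' : ∀ w, N (H w) = H (N w) + H w := fun w => LinearMap.congr_fun hnh w
  have hnD' : ∀ w, N (D w) + D w = D (N w) := fun w => LinearMap.congr_fun hnD w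
  induction q with
  | zero =>
    intro w hw _ _
    rw [hF0, Submodule.mem_bot] at hw
    exact ⟨0, 0, by simp [hw], by simp, zero_mem _, by simp, fun _ => rfl⟩
  | succ q ih =>
    intro w hw hD hN
    by_cases hqm : q + m = 0
    · have hq : q = 0 := by omega
      have hm : m = 0 := by omega
      subst hq hm
      exact ⟨0, w, by simp, by simp, hw, hN, fun h => absurd h (lt_irrefl _)⟩
    have hc : ((q : K) + m) ≠ 0 := by exact_mod_cast hqm
    have e1 : D (H w) = E w + (m : K) • w := by
      rw [← hN, ← hhom', hD, map_zero, add_zero]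
    have hNH : N (H w) = ((m + 1 : ℕ) : K) • H w := by
      rw [hnh', hN, map_smul]; push_cast; rw [add_smul, one_smul]
    have hNDH : N (D (H w)) = (m : K) • D (H w) := by
      have := hnD' (H w)
      rw [hNH, map_smul] at this
      push_cast at this
      rw [add_smul, one_smul] at this
      exact add_right_cancel this
    obtain ⟨w1, w0, h1, h2, h3, h4, h5⟩ := ih (((q : K) + m) • w - D (H w)) (by
        have := hF q w hw
        have e2 : ((q : K) + m) • w - D (H w) = - (E w - (q : K) • w) := by
          rw [e1, add_smul]; abel
        rw [e2]
        exact neg_mem this)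
      (by rw [map_sub, map_smul, hD, hsq', smul_zero, sub_zero])
      (by rw [map_sub, map_smul, hN, hNDH, smul_sub, smul_comm])
    refine ⟨((q : K) + m)⁻¹ • (w1 + H w), ((q : K) + m)⁻¹ • w0, ?_, ?_, ?_, ?_, ?_⟩
    · rw [map_smul, map_add, ← smul_add]
      rw [eq_inv_smul_iff₀ hc]
      rw [sub_eq_iff_eq_add] at h1
      rw [h1]; abel
    · rw [map_smul, map_add, h2, hNH, ← smul_add, smul_comm]
    · exact Submodule.smul_mem _ _ h3
    · rw [map_smul, h4, smul_comm]
    · intro hm; rw [h5 hm, smul_zero]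

end descent

section polydeg
variable {K : Type} [Field K] {n : ℕ}

variable (K n) in
/-- polynomials of degree less than `q` -/
def Sd (q : ℕ) : Submodule K (MvPolynomial (Fin n) K) :=
  Submodule.span K ((fun m => monomial m (1 : K)) '' {m | m.degree < q})

lemma Sd_zero : Sd K n 0 = ⊥ := by
  simp [Sd]

lemma Sd_mono {q r : ℕ} (h : q ≤ r) : Sd K n q ≤ Sd K n r :=
  Submodule.span_mono (Set.image_mono fun _ hm => lt_of_lt_of_le hm h)

lemma mem_Sd (s : MvPolynomial (Fin n) K) : ∃ q, s ∈ Sd K n q := by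
  induction s using MvPolynomial.induction_on' with
  | monomial u a =>
    refine ⟨u.degree + 1, ?_⟩
    have : monomial u a = a • monomial u (1 : K) := by rw [smul_monomial, smul_eq_mul, mul_one]
    rw [this]
    exact Submodule.smul_mem _ _ (Submodule.subset_span ⟨u, Nat.lt_succ_self _, rfl⟩)
  | add p q hp hq =>
    obtain ⟨a, ha⟩ := hp
    obtain ⟨b, hb⟩ := hq
    exact ⟨max a b, add_mem (Sd_mono (le_max_left _ _) ha) (Sd_mono (le_max_right _ _) hb)⟩

lemma Sd_one {s : MvPolynomial (Fin n) K} (hs : s ∈ Sd K n 1) : ∃ c : K, s = C c := by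
  induction hs using Submodule.span_induction with
  | mem x hx =>
    obtain ⟨m, hm, rfl⟩ := hx
    have : m.degree = 0 := by simpa using hm
    rw [Finsupp.degree_eq_zero_iff] at this
    exact ⟨1, by rw [this]; rfl⟩
  | zero => exact ⟨0, by simp⟩
  | add a b _ _ ha hb =>
    obtain ⟨c, rfl⟩ := ha
    obtain ⟨e, rfl⟩ := hb
    exact ⟨c + e, by simp⟩
  | smul c a _ ha =>
    obtain ⟨e, rfl⟩ := ha
    exact ⟨c * e, by simp [smul_eq_C_mul]⟩

lemma pderiv_Sd (i : Fin n) (q : ℕ) {s : MvPolynomial (Fin n) K} (hs : s ∈ Sd K n (q + 1)) :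
    pderiv i s ∈ Sd K n q := by
  induction hs using Submodule.span_induction with
  | mem x hx =>
    obtain ⟨m, hm, rfl⟩ := hx
    simp only [pderiv_monomial, one_mul]
    by_cases h0 : m i = 0
    · simp [h0]
    have : monomial (m - Finsupp.single i 1) ((m i : ℕ) : K)
        = (m i : K) • monomial (m - Finsupp.single i 1) (1 : K) := by
      rw [smul_monomial, smul_eq_mul, mul_one]
    rw [this]
    refine Submodule.smul_mem _ _ (Submodule.subset_span ⟨_, ?_, rfl⟩)
    have h1 : m - Finsupp.single i 1 + Finsupp.single i 1 = m :=
      tsub_add_cancel_of_le (by simpa [Nat.one_le_iff_ne_zero] using h0)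
    have h2 := congrArg Finsupp.degree h1
    rw [map_add, Finsupp.degree_single] at h2
    simp only [Set.mem_ofPred_eq] at *
    omega
  | zero => simp
  | add a b _ _ ha hb => rw [map_add]; exact add_mem ha hb
  | smul c a _ ha => rw [Derivation.map_smul]; exact Submodule.smul_mem _ _ ha

lemma euler_Sd (q : ℕ) {s : MvPolynomial (Fin n) K} (hs : s ∈ Sd K n (q + 1)) :
    (∑ i, X i * pderiv i s) - (q : K) • s ∈ Sd K n q := by
  induction hs using Submodule.span_induction with
  | mem x hx =>
    obtain ⟨m, hm, rfl⟩ := hx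
    have e : ∑ i, X i * pderiv i (monomial m (1 : K)) = (m.degree : K) • monomial m (1 : K) := by
      simp only [X_mul_pderiv_monomial, Finsupp.degree_eq_sum]
      push_cast
      rw [Finset.sum_smul]
      refine Finset.sum_congr rfl fun i _ => ?_
      rw [Nat.cast_smul_eq_nsmul]
    simp only [e, ← sub_smul]
    simp only [Set.mem_ofPred_eq] at hm
    rcases Nat.lt_succ_iff_lt_or_eq.1 hm with h1 | h1
    · exact Submodule.smul_mem _ _ (Submodule.subset_span ⟨m, h1, rfl⟩)
    · rw [h1, sub_self, zero_smul]; exact zero_mem _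
  | zero => simp
  | add a b _ _ ha hb =>
    have : (∑ i, X i * pderiv i (a + b)) - (q : K) • (a + b)
      = ((∑ i, X i * pderiv i a) - (q : K) • a) + ((∑ i, X i * pderiv i b) - (q : K) • b) := by
      simp only [map_add, mul_add, Finset.sum_add_distrib, smul_add]; abel
    rw [this]; exact add_mem ha hb
  | smul c a _ ha =>
    have : (∑ i, X i * pderiv i (c • a)) - (q : K) • (c • a)
      = c • ((∑ i, X i * pderiv i a) - (q : K) • a) := by
      simp only [Derivation.map_smul, mul_smul_comm, smul_sub, Finset.smul_sum, smul_comm c]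
    rw [this]; exact Submodule.smul_mem _ _ ha

end polydeg
end Inv17

-- part 6
namespace Inv17

section ext
open CategoryTheory Abelian

variable {A : Type} [Ring A]

variable (A) in
/-- vanishing of `Ext^j(Y, Z)` -/
def EV (Y Z : Type) [AddCommGroup Y] [Module A Y] [AddCommGroup Z] [Module A Z] (j : ℕ) : Prop :=
  ∀ x : Abelian.Ext (ModuleCat.of A Y) (ModuleCat.of A Z) j, x = 0

variable (A) in
/-- projective dimension less than `m` -/
def PD (Y : Type) [AddCommGroup Y] [Module A Y] (m : ℕ) : Prop :=
  HasProjectiveDimensionLT (ModuleCat.of A Y) m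

variable {M₁ M₂ M₃ Z : Type} [AddCommGroup M₁] [AddCommGroup M₂] [AddCommGroup M₃] [AddCommGroup Z]
  [Module A M₁] [Module A M₂] [Module A M₃] [Module A Z]

/-- the short complex of an exact pair -/
abbrev sc (f : M₁ →ₗ[A] M₂) (g : M₂ →ₗ[A] M₃) (he : Function.Exact f g) :
    ShortComplex (ModuleCat A) :=
  ShortComplex.mk (ModuleCat.ofHom f) (ModuleCat.ofHom g) (by
    ext x; exact he.apply_apply_eq_zero x)

lemma sc_exact {f : M₁ →ₗ[A] M₂} {g : M₂ →ₗ[A] M₃} (hf : Function.Injective f)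
    (he : Function.Exact f g) (hg : Function.Surjective g) : (sc f g he).ShortExact :=
  ModuleCat.shortComplex_shortExact _ he hf hg

lemma EV_mid {f : M₁ →ₗ[A] M₂} {g : M₂ →ₗ[A] M₃} (hf : Function.Injective f)
    (he : Function.Exact f g) (hg : Function.Surjective g) {j : ℕ}
    (h1 : EV A M₁ Z j) (h3 : EV A M₃ Z j) : EV A M₂ Z j := by
  intro x
  obtain ⟨y, rfl⟩ := Ext.contravariant_sequence_exact₂ (sc_exact hf he hg) _ x (h1 _)
  rw [h3 y, Ext.comp_zero]

lemma EV_right {f : M₁ →ₗ[A] M₂} {g : M₂ →ₗ[A] M₃} (hf : Function.Injective f)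
    (he : Function.Exact f g) (hg : Function.Surjective g) {j : ℕ}
    (h1 : EV A M₁ Z j) (h2 : EV A M₂ Z (j + 1)) : EV A M₃ Z (j + 1) := by
  intro x
  obtain ⟨y, rfl⟩ := Ext.contravariant_sequence_exact₃ (sc_exact hf he hg) _ x (h2 _) (add_comm 1 j)
  rw [h1 y, Ext.comp_zero]

lemma EV_left {f : M₁ →ₗ[A] M₂} {g : M₂ →ₗ[A] M₃} (hf : Function.Injective f)
    (he : Function.Exact f g) (hg : Function.Surjective g) {j : ℕ}
    (h2 : EV A M₂ Z j) (h3 : EV A M₃ Z (j + 1)) : EV A M₁ Z j := by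
  intro x
  obtain ⟨y, rfl⟩ := Ext.contravariant_sequence_exact₁ (sc_exact hf he hg) _ x (add_comm 1 j) (h3 _)
  rw [h2 y, Ext.comp_zero]

lemma EV_zero_iff : EV A M₁ Z 0 ↔ ∀ f : M₁ →ₗ[A] Z, f = 0 := by
  constructor
  · intro h f
    have := h (Ext.mk₀ (ModuleCat.ofHom f))
    rw [Ext.mk₀_eq_zero_iff] at this
    ext x
    exact congrArg (fun φ => φ.hom x) this
  · intro h x
    obtain ⟨f, rfl⟩ := Ext.homEquiv₀.symm.surjective x
    have : f = 0 := by
      ext y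
      exact LinearMap.congr_fun (h f.hom) y
    subst this
    exact Ext.mk₀_zero _ _

lemma EV_subsingleton [Subsingleton M₁] (j : ℕ) : EV A M₁ Z j := by
  intro x
  have h : (𝟙 (ModuleCat.of A M₁)) = 0 := by
    ext y; exact Subsingleton.elim (α := M₁) _ _
  rw [← Ext.mk₀_id_comp x, h, Ext.mk₀_zero, Ext.zero_comp]

lemma EV_projective [Module.Projective A M₁] (j : ℕ) : EV A M₁ Z (j + 1) := by
  intro x
  have : Projective (ModuleCat.of A M₁) := (IsProjective.iff_projective _).1 ‹_›
  exact Ext.eq_zero_of_projective _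

lemma EV_congr (e : M₁ ≃ₗ[A] M₂) {j : ℕ} (h : EV A M₁ Z j) : EV A M₂ Z j := by
  intro x
  have h1 := h ((Ext.mk₀ (ModuleCat.ofHom e.toLinearMap)).comp x (zero_add _))
  have h2 : x = (Ext.mk₀ (ModuleCat.ofHom e.symm.toLinearMap)).comp
      ((Ext.mk₀ (ModuleCat.ofHom e.toLinearMap)).comp x (zero_add _)) (zero_add _) := by
    rw [Ext.mk₀_comp_mk₀_assoc, ← ModuleCat.ofHom_comp]
    simp
  rw [h2, h1, Ext.comp_zero]

/-- vanishing of `Ext¹` gives extension of maps -/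
lemma EV_extend {f : M₁ →ₗ[A] M₂} {g : M₂ →ₗ[A] M₃} (hf : Function.Injective f)
    (he : Function.Exact f g) (hg : Function.Surjective g)
    (h : EV A M₃ Z 1) (φ : M₁ →ₗ[A] Z) : ∃ ψ : M₂ →ₗ[A] Z, ψ ∘ₗ f = φ := by
  obtain ⟨y, hy⟩ := Ext.contravariant_sequence_exact₁ (sc_exact hf he hg)
    (ModuleCat.of A Z) (Ext.mk₀ (ModuleCat.ofHom φ)) (add_comm 1 0) (h _)
  obtain ⟨y, rfl⟩ := Ext.homEquiv₀.symm.surjective y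
  change (Ext.mk₀ _).comp (Ext.mk₀ y) _ = _ at hy
  rw [Ext.mk₀_comp_mk₀] at hy
  have := Ext.homEquiv₀.symm.injective hy
  refine ⟨y.hom, ?_⟩
  ext x
  exact congrArg (fun φ => φ.hom x) this

lemma EV_one_of_extend {f : M₁ →ₗ[A] M₂} {g : M₂ →ₗ[A] M₃} (hf : Function.Injective f)
    (he : Function.Exact f g) (hg : Function.Surjective g) [Module.Projective A M₂]
    (h : ∀ φ : M₁ →ₗ[A] Z, ∃ ψ : M₂ →ₗ[A] Z, ψ ∘ₗ f = φ) : EV A M₃ Z 1 := by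
  intro x
  obtain ⟨y, rfl⟩ := Ext.contravariant_sequence_exact₃ (sc_exact hf he hg) _ x
    (EV_projective (Z := Z) (M₁ := M₂) 0 _) (add_comm 1 0)
  obtain ⟨y, rfl⟩ := Ext.homEquiv₀.symm.surjective y
  obtain ⟨ψ, hψ⟩ := h y.hom
  have : y = (sc f g he).f ≫ ModuleCat.ofHom ψ := by
    ext x; exact (LinearMap.congr_fun hψ x).symm
  rw [this]
  change Ext.comp _ (Ext.mk₀ _) _ = _
  rw [← Ext.mk₀_comp_mk₀, ← Ext.comp_assoc _ _ _ (add_zero 1) (zero_add 0) (by omega)]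
  have : (sc_exact hf he hg).extClass.comp (Ext.mk₀ (sc f g he).f) (add_zero 1) = 0 :=
    (sc_exact hf he hg).extClass_comp
  rw [this, Ext.zero_comp]

/-! chain of projectives -/

section chain
variable {T : Type} [AddCommGroup T] [Module A T] (P : ℕ → Type) [∀ m, AddCommGroup (P m)]
  [∀ m, Module A (P m)] [∀ m, Module.Projective A (P m)]
  (D : ∀ m, P (m + 1) →ₗ[A] P m) (ε : P 0 →ₗ[A] T)

/-- generic step: kernel inclusion for a range -/
lemma range_ses {L M N : Type} [AddCommGroup L] [AddCommGroup M] [AddCommGroup N]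
    [Module A L] [Module A M] [Module A N] {f : L →ₗ[A] M} {g : M →ₗ[A] N}
    (h : Function.Exact f g) :
    Function.Injective (LinearMap.range f).subtype ∧
    Function.Exact (LinearMap.range f).subtype g.rangeRestrict ∧
    Function.Surjective g.rangeRestrict := by
  refine ⟨Subtype.val_injective, ?_, g.surjective_rangeRestrict⟩
  intro y
  rw [Subtype.ext_iff]
  refine (h y).trans ?_
  simp

lemma chain_pd (hε : Function.Surjective ε)
    (he0 : Function.Exact (D 0) ε) (he : ∀ m, Function.Exact (D (m + 1)) (D m)) (b : ℕ) (hb : ∀ m, b ≤ m → Subsingleton (P m)) : PD A T b := by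
  have h1 : ∀ i m, b ≤ m + 1 + i → PD A (LinearMap.range (D m)) i := by
    intro i
    induction i with
    | zero =>
      intro m hm
      have := hb (m + 1) hm
      have : Subsingleton (LinearMap.range (D m)) := (LinearMap.surjective_rangeRestrict (D m)).subsingleton
      exact (ModuleCat.isZero_of_subsingleton _).hasProjectiveDimensionLT_zero
    | succ i ih =>
      intro m hm
      obtain ⟨a1, a2, a3⟩ := range_ses (he m)
      have : Projective (ModuleCat.of A (P (m + 1))) := (IsProjective.iff_projective _).1 inferInstance
      exact (sc_exact a1 a2 a3).hasProjectiveDimensionLT_X₃ i (ih (m + 1) (by omega))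
        (hasProjectiveDimensionLT_of_ge _ 1 _ (by omega))
  rcases b with _ | b
  · have := hb 0 le_rfl
    have : Subsingleton T := hε.subsingleton
    exact (ModuleCat.isZero_of_subsingleton _).hasProjectiveDimensionLT_zero
  · have : Projective (ModuleCat.of A (P 0)) := (IsProjective.iff_projective _).1 inferInstance
    have a2 : Function.Exact (LinearMap.range (D 0)).subtype ε := by
      intro y; rw [he0 y]; simp
    exact (sc_exact Subtype.val_injective a2 hε).hasProjectiveDimensionLT_X₃ b (h1 b 0 (by omega))
        (hasProjectiveDimensionLT_of_ge _ 1 _ (by omega))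

lemma chain_EV (hε : Function.Surjective ε)
    (he0 : Function.Exact (D 0) ε) (he : ∀ m, Function.Exact (D (m + 1)) (D m)) (h0 : ∀ ψ : P 0 →ₗ[A] Z, ψ ∘ₗ D 0 = 0 → ψ = 0)
    (h : ∀ m, ∀ ψ : P (m + 1) →ₗ[A] Z, ψ ∘ₗ D (m + 1) = 0 → ∃ ψ' : P m →ₗ[A] Z, ψ' ∘ₗ D m = ψ)
    (j : ℕ) : EV A T Z j := by
  have hext : ∀ m, ∀ φ : LinearMap.range (D m) →ₗ[A] Z, ∃ ψ : P m →ₗ[A] Z,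
      ψ ∘ₗ (LinearMap.range (D m)).subtype = φ := by
    intro m φ
    obtain ⟨ψ, hψ⟩ := h m (φ ∘ₗ (D m).rangeRestrict) (by
      ext x
      have : (D m).rangeRestrict (D (m + 1) x) = 0 :=
        Subtype.ext ((he m).apply_apply_eq_zero x)
      simp [this])
    refine ⟨ψ, ?_⟩
    ext ⟨_, x, rfl⟩
    exact LinearMap.congr_fun hψ x
  have h1 : ∀ j m, EV A (LinearMap.range (D m)) Z (j + 1) := by
    intro j
    induction j with
    | zero =>
      intro m
      obtain ⟨a1, a2, a3⟩ := range_ses (he m)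
      exact EV_one_of_extend a1 a2 a3 (hext (m + 1))
    | succ j ih =>
      intro m
      obtain ⟨a1, a2, a3⟩ := range_ses (he m)
      exact EV_right a1 a2 a3 (ih (m + 1)) (EV_projective _)
  have a2 : Function.Exact (LinearMap.range (D 0)).subtype ε := by
    intro y; rw [he0 y]; simp
  rcases j with _ | _ | j
  · rw [EV_zero_iff]
    intro f
    have := h0 (f ∘ₗ ε) (by ext x; simp [he0.apply_apply_eq_zero])
    ext y
    obtain ⟨y, rfl⟩ := hε y
    exact LinearMap.congr_fun this y
  · exact EV_one_of_extend Subtype.val_injective a2 hε (hext 0)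
  · exact EV_right Subtype.val_injective a2 hε (h1 j 0) (EV_projective _)

end chain

end ext
end Inv17

-- part 7
namespace Inv17

section dev
open CategoryTheory Abelian
open scoped ModuleCat.Algebra

variable {R A : Type} [CommRing R] [Ring A] [Algebra R A]
variable {Z : Type} [AddCommGroup Z] [Module A Z]

variable (A) in
/-- multiplication by a central element -/
def mulr (r : R) (T : Type) [AddCommGroup T] [Module A T] : T →ₗ[A] T where
  toFun t := algebraMap R A r • t
  map_add' := smul_add _
  map_smul' a t := by
    simp only [RingHom.id_apply, smul_smul]; rw [Algebra.commutes]

@[simp] lemma mulr_apply (r : R) {T : Type} [AddCommGroup T] [Module A T] (t : T) :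
    mulr A r T t = algebraMap R A r • t := rfl

lemma ext_fg [IsNoetherianRing A] [IsNoetherianRing R] (hZ : ∀ m : ℕ, ∀ (H : Type) [AddCommGroup H] [Module R H]
      (f : H →+ (Fin m → Z)), Function.Injective f →
        (∀ (r : R) h, f (r • h) = fun i => algebraMap R A r • f h i) → Module.Finite R H) (j : ℕ) :
    ∀ (Y : Type) [AddCommGroup Y] [Module A Y] [Module.Finite A Y],
      Module.Finite R (Abelian.Ext (ModuleCat.of A Y) (ModuleCat.of A Z) j) := by
  induction j with
  | zero =>
    intro Y _ _ _
    have : Module.Finite R (ModuleCat.of A Y ⟶ ModuleCat.of A Z) := by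
      obtain ⟨m, f, hf⟩ := Module.Finite.exists_fin' A Y
      refine hZ m _ ⟨⟨fun φ i => φ.hom (f (Pi.single i 1)), ?_⟩, ?_⟩ ?_ ?_
      · ext; simp
      · intro a b; ext; simp
      · intro φ ψ h
        ext y
        obtain ⟨v, rfl⟩ := hf y
        have : φ.hom ∘ₗ f = ψ.hom ∘ₗ f := by
          refine LinearMap.pi_ext' fun i => ?_
          ext
          exact congrFun h i
        exact LinearMap.congr_fun this v
      · intro r φ
        rfl
    exact Module.Finite.equiv (Ext.linearEquiv₀ (R := R)).symm
  | succ j ih =>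
    intro Y _ _ _
    obtain ⟨m, f, hf⟩ := Module.Finite.exists_fin' A Y
    have he : Function.Exact (LinearMap.ker f).subtype f := by
      intro y; simp
    have := ih (LinearMap.ker f)
    have hs := sc_exact Subtype.val_injective he hf
    refine Module.Finite.of_surjective (M := Abelian.Ext (ModuleCat.of A (LinearMap.ker f)) (ModuleCat.of A Z) j)
      (Ext.bilinearCompOfLinear R _ _ _ 1 j (j + 1) (add_comm 1 j) hs.extClass) ?_
    intro x
    exact Ext.contravariant_sequence_exact₃ hs _ x (EV_projective (Z := Z) (M₁ := Fin m → A) j _) (add_comm 1 j)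

lemma ext_bij {M₁ M₂ M₃ : Type} [AddCommGroup M₁] [AddCommGroup M₂] [AddCommGroup M₃]
    [Module A M₁] [Module A M₂] [Module A M₃]
    {f : M₁ →ₗ[A] M₂} {g : M₂ →ₗ[A] M₃} (hf : Function.Injective f)
    (he : Function.Exact f g) (hg : Function.Surjective g) (h1 : ∀ j, EV A M₁ Z j) (j : ℕ) :
    Function.Bijective (fun x : Abelian.Ext (ModuleCat.of A M₃) (ModuleCat.of A Z) j =>
      (Ext.mk₀ (ModuleCat.ofHom g)).comp x (zero_add j)) := by
  constructor
  · rw [show (fun x : Abelian.Ext (ModuleCat.of A M₃) (ModuleCat.of A Z) j =>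
      (Ext.mk₀ (ModuleCat.ofHom g)).comp x (zero_add j))
      = (Ext.mk₀ (ModuleCat.ofHom g)).precomp (ModuleCat.of A Z) (zero_add j) from rfl]
    rw [injective_iff_map_eq_zero]
    intro x hx
    rcases j with _ | j
    · obtain ⟨φ, rfl⟩ := Ext.homEquiv₀.symm.surjective x
      change (Ext.mk₀ _).comp (Ext.mk₀ φ) (zero_add 0) = 0 at hx
      rw [Ext.mk₀_comp_mk₀, Ext.mk₀_eq_zero_iff] at hx
      have : φ = 0 := by
        ext y
        obtain ⟨y, rfl⟩ := hg y
        exact congrArg (fun ψ => ψ.hom y) hx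
      subst this
      exact Ext.mk₀_zero _ _
    · obtain ⟨y, rfl⟩ := Ext.contravariant_sequence_exact₃ (sc_exact hf he hg) _ x hx (add_comm 1 j)
      rw [h1 j y, Ext.comp_zero]
  · intro x
    exact Ext.contravariant_sequence_exact₂ (sc_exact hf he hg) _ x (h1 j _)

lemma ext_bij' {M₁ M₂ M₃ : Type} [AddCommGroup M₁] [AddCommGroup M₂] [AddCommGroup M₃]
    [Module A M₁] [Module A M₂] [Module A M₃]
    {f : M₁ →ₗ[A] M₂} {g : M₂ →ₗ[A] M₃} (hf : Function.Injective f)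
    (he : Function.Exact f g) (hg : Function.Surjective g) (h1 : ∀ j, EV A M₃ Z j) (j : ℕ) :
    Function.Bijective (fun x : Abelian.Ext (ModuleCat.of A M₂) (ModuleCat.of A Z) j =>
      (Ext.mk₀ (ModuleCat.ofHom f)).comp x (zero_add j)) := by
  constructor
  · rw [show (fun x : Abelian.Ext (ModuleCat.of A M₂) (ModuleCat.of A Z) j =>
      (Ext.mk₀ (ModuleCat.ofHom f)).comp x (zero_add j))
      = (Ext.mk₀ (ModuleCat.ofHom f)).precomp (ModuleCat.of A Z) (zero_add j) from rfl]
    rw [injective_iff_map_eq_zero]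
    intro x hx
    obtain ⟨y, rfl⟩ := Ext.contravariant_sequence_exact₂ (sc_exact hf he hg) _ x hx
    rw [h1 j y, Ext.comp_zero]
  · intro x
    exact Ext.contravariant_sequence_exact₁ (sc_exact hf he hg) _ x (add_comm 1 j) (h1 (j+1) _)

lemma ext_smul_bij (r : R) {T : Type} [AddCommGroup T] [Module A T]
    (h1 : ∀ j, EV A (LinearMap.ker (mulr A r T)) Z j)
    (h2 : ∀ j, EV A (T ⧸ LinearMap.range (mulr A r T)) Z j) (j : ℕ) :
    Function.Bijective (fun x : Abelian.Ext (ModuleCat.of A T) (ModuleCat.of A Z) j => r • x) := by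
  set f := mulr A r T
  have b1 := ext_bij (Z := Z) (f := (LinearMap.ker f).subtype) (g := f.rangeRestrict) Subtype.val_injective
    (by intro y; rw [Subtype.ext_iff]; simp) f.surjective_rangeRestrict h1 j
  have b2 := ext_bij' (Z := Z) (f := (LinearMap.range f).subtype) (g := (LinearMap.range f).mkQ)
    Subtype.val_injective (by intro y; simp) (Submodule.mkQ_surjective _) h2 j
  convert b1.comp b2 using 1
  funext x
  simp only [Function.comp]
  rw [Ext.mk₀_comp_mk₀_assoc]
  have : ModuleCat.ofHom f.rangeRestrict ≫ ModuleCat.ofHom (LinearMap.range f).subtype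
    = r • 𝟙 (ModuleCat.of A T) := by
    ext y; rfl
  rw [this, Ext.mk₀_smul, Ext.smul_comp, Ext.mk₀_id_comp]

theorem devissage [IsNoetherianRing A] [IsNoetherianRing R]
    (hZ : ∀ m : ℕ, ∀ (H : Type) [AddCommGroup H] [Module R H]
      (f : H →+ (Fin m → Z)), Function.Injective f →
        (∀ (r : R) h, f (r • h) = fun i => algebraMap R A r • f h i) → Module.Finite R H)
    (𝒯 : ∀ (T : Type) [AddCommGroup T] [Module A T], Prop)
    (hsub : ∀ (T : Type) [AddCommGroup T] [Module A T], 𝒯 T → ∀ U : Submodule A T, 𝒯 U)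
    (hquo : ∀ (T : Type) [AddCommGroup T] [Module A T], 𝒯 T → ∀ U : Submodule A T, 𝒯 (T ⧸ U))
    (hmax : ∀ (I : Ideal R), I.IsMaximal → ∀ (T : Type) [AddCommGroup T] [Module A T] [Module.Finite A T],
      𝒯 T → (∀ r ∈ I, ∀ t : T, algebraMap R A r • t = 0) → ∀ j, EV A T Z j)
    (T : Type) [AddCommGroup T] [Module A T] [Module.Finite A T] (hT : 𝒯 T) (j : ℕ) : EV A T Z j := by
  have key : ∀ I : Ideal R, ∀ (T : Type) [AddCommGroup T] [Module A T] [Module.Finite A T],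
      𝒯 T → (∀ r ∈ I, ∀ t : T, algebraMap R A r • t = 0) → ∀ j, EV A T Z j := by
    intro I
    induction I using IsNoetherian.induction with
    | hgt I ih =>
    intro T _ _ _ hT hI
    have hlt : ∀ r, r ∉ I → I < I ⊔ Ideal.span {r} := fun r hr =>
      left_lt_sup.2 fun h => hr (h (Ideal.mem_span_singleton_self r))
    have hkill : ∀ (r : R) (U : Type) [AddCommGroup U] [Module A U] [Module.Finite A U], 𝒯 U → r ∉ I →
        (∀ s ∈ I, ∀ t : U, algebraMap R A s • t = 0) → (∀ t : U, algebraMap R A r • t = 0) →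
        ∀ j, EV A U Z j := by
      intro r U _ _ _ hU hr h1 h2
      refine ih _ (hlt r hr) U hU ?_
      intro s hs t
      obtain ⟨a, ha, b, hb, rfl⟩ := Submodule.mem_sup.1 hs
      obtain ⟨c, rfl⟩ := Ideal.mem_span_singleton.1 hb
      rw [map_add, add_smul, h1 a ha, mul_comm r c, map_mul, mul_smul, h2, smul_zero, zero_add]
    have hIs : ∀ U : Submodule A T, ∀ s ∈ I, ∀ t : U, algebraMap R A s • t = 0 :=
      fun U s hs t => Subtype.ext (hI s hs t)
    have hIq : ∀ U : Submodule A T, ∀ s ∈ I, ∀ t : T ⧸ U, algebraMap R A s • t = 0 := by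
      intro U s hs t
      obtain ⟨t, rfl⟩ := U.mkQ_surjective t
      rw [← map_smul, hI s hs, map_zero]
    by_cases htop : I = ⊤
    · have : Subsingleton T := ⟨fun a b => by
        have h := fun t => hI 1 (by rw [htop]; trivial) t
        simp only [map_one, one_smul] at h
        rw [h a, h b]⟩
      exact fun j => EV_subsingleton j
    by_cases hp : Ideal.IsPrime I
    · by_cases hm : Ideal.IsMaximal I
      · exact hmax I hm T hT hI
      · intro j
        obtain ⟨M, hM, hIM⟩ := Ideal.exists_le_maximal I htop
        have hIM' : I < M := lt_of_le_of_ne hIM (fun h => hm (h ▸ hM))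
        obtain ⟨r, hrM, hrI⟩ := SetLike.exists_of_lt hIM'
        have hb : ∀ s, s ∉ I → Function.Bijective (fun x : Abelian.Ext (ModuleCat.of A T) (ModuleCat.of A Z) j => s • x) := by
          intro s hs
          refine ext_smul_bij s ?_ ?_ j
          · exact hkill s _ (hsub T hT _) hs (hIs _) (fun t => Subtype.ext t.2)
          · refine hkill s _ (hquo T hT _) hs (hIq _) (fun t => ?_)
            obtain ⟨t, rfl⟩ := Submodule.mkQ_surjective _ t
            rw [← map_smul, Submodule.mkQ_apply, Submodule.Quotient.mk_eq_zero]
            exact ⟨t, rfl⟩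
        have hfg := ext_fg hZ j T
        have := Submodule.exists_sub_one_mem_and_smul_eq_zero_of_fg_of_le_smul (Ideal.span {r})
          (⊤ : Submodule R (Abelian.Ext (ModuleCat.of A T) (ModuleCat.of A Z) j)) hfg.1 (by
            intro x _
            obtain ⟨y, rfl⟩ := (hb r hrI).2 x
            exact Submodule.smul_mem_smul (Ideal.mem_span_singleton_self r) trivial)
        obtain ⟨s, hs1, hs2⟩ := this
        have hsI : s ∉ I := by
          intro hsI
          apply hM.ne_top
          rw [Ideal.eq_top_iff_one]
          have h1 : s - 1 ∈ M := (Ideal.span_singleton_le_iff_mem M).2 hrM hs1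
          have := M.sub_mem (hIM hsI) h1
          simpa using this
        intro x
        apply (hb s hsI).1
        simp only [smul_zero]
        exact hs2 x trivial
    · rw [Ideal.isPrime_iff] at hp
      push Not at hp
      obtain ⟨a, b, hab, ha, hb⟩ := hp htop
      intro j
      refine EV_mid (f := (LinearMap.range (mulr A b T)).subtype) (g := (LinearMap.range (mulr A b T)).mkQ)
        Subtype.val_injective (by intro y; simp) (Submodule.mkQ_surjective _) ?_ ?_
      · refine hkill a _ (hsub T hT _) ha (hIs _) ?_ j
        rintro ⟨_, t, rfl⟩
        refine Subtype.ext ?_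
        change algebraMap R A a • algebraMap R A b • t = 0
        rw [smul_smul, ← map_mul, hI _ hab]
      · refine hkill b _ (hquo T hT _) hb (hIq _) (fun t => ?_) j
        obtain ⟨t, rfl⟩ := Submodule.mkQ_surjective _ t
        rw [← map_smul, Submodule.mkQ_apply, Submodule.Quotient.mk_eq_zero]
        exact ⟨t, rfl⟩
  exact key ⊥ T hT (fun r hr t => by rw [Ideal.mem_bot] at hr; rw [hr, map_zero, zero_smul]) j

end dev
end Inv17

-- part 8
namespace Inv17

section rels3
variable {A : Type} [Ring A] {n : ℕ}

lemma Rels.of3 {x ξ p α β : Fin n → A} (xx : ∀ i j, Commute (x i) (x j))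
    (ξξ : ∀ i j, Commute (ξ i) (ξ j)) (xξ : ∀ i j, Commute (x i) (ξ j))
    (px : ∀ i j, p j * x i = x i * p j + if i = j then 1 else 0) (pξ : ∀ i j, Commute (p i) (ξ j))
    (xα : ∀ i j, Commute (x i) (α j)) (xβ : ∀ i j, Commute (x i) (β j))
    (ξα : ∀ i j, Commute (ξ i) (α j)) (ξβ : ∀ i j, Commute (ξ i) (β j))
    (pα : ∀ i j, Commute (p i) (α j)) (pβ : ∀ i j, Commute (p i) (β j))
    (αβ : ∀ i j, α i * β j + β j * α i = if i = j then 1 else 0)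
    (αα : ∀ i j, α i * α j = - (α j * α i)) (ββ : ∀ i j, β i * β j = - (β j * β i)) :
    Rels (fun i => x i - ξ i) p α β where
  aa i j := (((xx i j).sub_left (xξ j i).symm).sub_right ((xξ i j).sub_left (ξξ i j))).eq
  pa i j := by rw [mul_sub, sub_mul, px, (pξ j i).eq]; abel
  aα i j := ((xα i j).sub_left (ξα i j)).eq
  aβ i j := ((xβ i j).sub_left (ξβ i j)).eq
  pα i j := (pα i j).eq
  pβ i j := (pβ i j).eq
  αβ := αβ
  αα := αα
  ββ := ββ

end rels3

section kos
open TensorProduct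
variable {K : Type} [Field K] {n : ℕ} {T : Type} [AddCommGroup T] [Module K T]

variable (K n T) in
/-- the total space of the Koszul complex -/
def Kos : Type := MvPolynomial (Fin n) K ⊗[K] (EA K n ⊗[K] T)

instance : AddCommGroup (Kos K n T) := inferInstanceAs (AddCommGroup (MvPolynomial (Fin n) K ⊗[K] (EA K n ⊗[K] T)))
instance : Module K (Kos K n T) := inferInstanceAs (Module K (MvPolynomial (Fin n) K ⊗[K] (EA K n ⊗[K] T)))
instance : Module (MvPolynomial (Fin n) K) (Kos K n T) :=
  inferInstanceAs (Module (MvPolynomial (Fin n) K) (MvPolynomial (Fin n) K ⊗[K] (EA K n ⊗[K] T)))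
instance : Module.Free (MvPolynomial (Fin n) K) (Kos K n T) :=
  inferInstanceAs (Module.Free (MvPolynomial (Fin n) K) (MvPolynomial (Fin n) K ⊗[K] (EA K n ⊗[K] T)))

/-- pure tensors -/
def kt (s : MvPolynomial (Fin n) K) (e : EA K n) (t : T) : Kos K n T := s ⊗ₜ[K] (e ⊗ₜ[K] t)

lemma kos_induction {P : Kos K n T → Prop} (h0 : P 0) (h1 : ∀ s e t, P (kt s e t))
    (h2 : ∀ a b, P a → P b → P (a + b)) (w : Kos K n T) : P w := by
  refine TensorProduct.induction_on (R := K) w h0 (fun s u => ?_) h2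
  refine TensorProduct.induction_on u ?_ (fun e t => h1 s e t) (fun a b ha hb => ?_)
  · rw [TensorProduct.tmul_zero]; exact h0
  · rw [TensorProduct.tmul_add]; exact h2 _ _ ha hb

lemma kos_ext {W : Type} [AddCommGroup W] [Module K W] {f g : Kos K n T →ₗ[K] W}
    (h : ∀ s e t, f (kt s e t) = g (kt s e t)) : f = g := by
  refine LinearMap.ext fun w => ?_
  induction w using kos_induction with
  | h0 => simp
  | h1 s e t => exact h s e t
  | h2 a b ha hb => rw [map_add, map_add, ha, hb]

lemma smul_kt (r s : MvPolynomial (Fin n) K) (e : EA K n) (t : T) : r • kt s e t = kt (r * s) e t := rfl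

lemma kt_add_l (s s' : MvPolynomial (Fin n) K) (e : EA K n) (t : T) :
    kt (s + s') e t = kt s e t + kt s' e t := TensorProduct.add_tmul _ _ _
lemma kt_smul_l (c : K) (s : MvPolynomial (Fin n) K) (e : EA K n) (t : T) :
    kt (c • s) e t = c • kt s e t := rfl
lemma kt_smul_m (c : K) (s : MvPolynomial (Fin n) K) (e : EA K n) (t : T) :
    kt s (c • e) t = c • kt s e t := by
  refine Eq.trans ?_ (TensorProduct.tmul_smul (R := K) c s (e ⊗ₜ[K] t))
  rfl
lemma kt_smul_r (c : K) (s : MvPolynomial (Fin n) K) (e : EA K n) (t : T) :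
    kt s e (c • t) = c • kt s e t := by
  rw [← kt_smul_m, kt, kt, TensorProduct.tmul_smul, TensorProduct.smul_tmul']
lemma kt_add_r (s : MvPolynomial (Fin n) K) (e : EA K n) (t t' : T) :
    kt s e (t + t') = kt s e t + kt s e t' := by
  refine Eq.trans ?_ (TensorProduct.tmul_add (R := K) s (e ⊗ₜ[K] t) (e ⊗ₜ[K] t'))
  rw [kt, TensorProduct.tmul_add]
lemma kt_add_m (s : MvPolynomial (Fin n) K) (e e' : EA K n) (t : T) :
    kt s (e + e') t = kt s e t + kt s e' t := by
  refine Eq.trans ?_ (TensorProduct.tmul_add (R := K) s (e ⊗ₜ[K] t) (e' ⊗ₜ[K] t))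
  rw [kt, TensorProduct.add_tmul]

variable (K n T) in
/-- `kt` as a linear map in the first variable -/
def ktl (e : EA K n) (t : T) : MvPolynomial (Fin n) K →ₗ[K] Kos K n T where
  toFun s := kt s e t
  map_add' _ _ := kt_add_l _ _ _ _
  map_smul' _ _ := kt_smul_l _ _ _ _

/-- operators on the polynomial factor -/
def LS : Module.End K (MvPolynomial (Fin n) K) →ₐ[K] Module.End K (Kos K n T) :=
  Module.End.rTensorAlgHom K _ _
/-- operators on the exterior factor -/
def LE : Module.End K (EA K n) →ₐ[K] Module.End K (Kos K n T) :=
  (Module.End.lTensorAlgHom K _ _).comp (Module.End.rTensorAlgHom K _ _)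
/-- operators on the module factor -/
def LT : Module.End K T →ₐ[K] Module.End K (Kos K n T) :=
  (Module.End.lTensorAlgHom K _ _).comp (Module.End.lTensorAlgHom K _ _)

@[simp] lemma LS_kt (f) (s : MvPolynomial (Fin n) K) (e : EA K n) (t : T) : LS f (kt s e t) = kt (f s) e t := rfl
@[simp] lemma LE_kt (f) (s : MvPolynomial (Fin n) K) (e : EA K n) (t : T) : LE f (kt s e t) = kt s (f e) t := rfl
@[simp] lemma LT_kt (f) (s : MvPolynomial (Fin n) K) (e : EA K n) (t : T) : LT f (kt s e t) = kt s e (f t) := rfl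

lemma comm_SE (f g) : Commute (LS f : Module.End K (Kos K n T)) (LE g) := kos_ext fun _ _ _ => rfl
lemma comm_ST (f g) : Commute (LS f : Module.End K (Kos K n T)) (LT g) := kos_ext fun _ _ _ => rfl
lemma comm_ET (f g) : Commute (LE f : Module.End K (Kos K n T)) (LT g) := kos_ext fun _ _ _ => rfl

/-- multiplication by a variable -/
def mx (i : Fin n) : Module.End K (MvPolynomial (Fin n) K) := LinearMap.mulLeft K (X i)
/-- partial derivative as an endomorphism -/
def px (i : Fin n) : Module.End K (MvPolynomial (Fin n) K) := (pderiv i).toLinearMap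

lemma mx_apply (i : Fin n) (s : MvPolynomial (Fin n) K) : mx i s = X i * s := rfl
lemma px_apply (i : Fin n) (s : MvPolynomial (Fin n) K) : px i s = pderiv i s := rfl
lemma ktl_apply (s : MvPolynomial (Fin n) K) (e : EA K n) (t : T) : ktl K n T e t s = kt s e t := rfl

lemma px_mx (i j : Fin n) : (px j * mx i : Module.End K (MvPolynomial (Fin n) K))
    = mx i * px j + if i = j then 1 else 0 := by
  have h1 : ∀ s : MvPolynomial (Fin n) K, pderiv j (X i * s) = X i * pderiv j s + if i = j then s else 0 := by
    intro s
    rw [Derivation.leibniz, smul_eq_mul, smul_eq_mul, pderiv_X]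
    by_cases h : i = j
    · subst h; simp
    · simp [h, Pi.single_apply, Ne.symm h, eq_comm]
  refine LinearMap.ext fun s => (h1 s).trans ?_
  rw [LinearMap.add_apply]
  split_ifs <;> rfl

lemma mx_comm (i j : Fin n) : Commute (mx i : Module.End K (MvPolynomial (Fin n) K)) (mx j) := by
  refine LinearMap.ext fun s => ?_
  exact mul_left_comm _ _ _

lemma kos_rels (ξ : Fin n → Module.End K T) (hξ : ∀ i j, Commute (ξ i) (ξ j)) :
    Rels (A := Module.End K (Kos K n T)) (fun i => LS (mx i) - LT (ξ i)) (fun i => LS (px i))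
      (fun i => LE (io i)) (fun i => LE (eps i)) := by
  refine Rels.of3 (fun i j => (mx_comm i j).map LS) (fun i j => (hξ i j).map LT) (fun i j => comm_ST _ _)
    (fun i j => ?_) (fun i j => comm_ST _ _) (fun i j => comm_SE _ _) (fun i j => comm_SE _ _)
    (fun i j => (comm_ET _ _).symm) (fun i j => (comm_ET _ _).symm) (fun i j => comm_SE _ _) (fun i j => comm_SE _ _)
    (fun i j => ?_) (fun i j => ?_) (fun i j => ?_)
  · rw [← _root_.map_mul, px_mx, _root_.map_add, _root_.map_mul]
    split_ifs <;> simp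
  · rw [← _root_.map_mul, ← _root_.map_mul, ← _root_.map_add, io_eps]
    split_ifs <;> simp
  · rw [← _root_.map_mul, io_io, _root_.map_neg, _root_.map_mul]
  · rw [← _root_.map_mul, eps_eps, _root_.map_neg, _root_.map_mul]

lemma kos_num : ∑ i, LE (eps i) * LE (io i) = (LE (num K n) : Module.End K (Kos K n T)) := by
  rw [num, _root_.map_sum]
  simp

/-- filtration by polynomial degree -/
def kF (q : ℕ) : Submodule K (Kos K n T) :=
  Submodule.span K {w | ∃ s e t, s ∈ Sd K n q ∧ w = kt s e t}

lemma kt_mem {q : ℕ} {s : MvPolynomial (Fin n) K} (hs : s ∈ Sd K n q) (e : EA K n) (t : T) : kt s e t ∈ kF q :=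
  Submodule.subset_span ⟨s, e, t, hs, rfl⟩

lemma kF_mono {q r : ℕ} (h : q ≤ r) : (kF q : Submodule K (Kos K n T)) ≤ kF r := by
  refine Submodule.span_le.2 ?_
  rintro _ ⟨s, e, t, hs, rfl⟩
  exact kt_mem (Sd_mono h hs) e t

lemma mem_kF (w : Kos K n T) : ∃ q, w ∈ kF q := by
  induction w using kos_induction with
  | h0 => exact ⟨0, zero_mem _⟩
  | h1 s e t =>
    obtain ⟨q, hq⟩ := mem_Sd s
    exact ⟨q, kt_mem hq e t⟩
  | h2 a b ha hb =>
    obtain ⟨q, hq⟩ := ha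
    obtain ⟨r, hr⟩ := hb
    exact ⟨max q r, add_mem (kF_mono (le_max_left _ _) hq) (kF_mono (le_max_right _ _) hr)⟩

lemma kF_zero : (kF 0 : Submodule K (Kos K n T)) = ⊥ := by
  rw [kF, Submodule.span_eq_bot]
  rintro _ ⟨s, e, t, hs, rfl⟩
  rw [Sd_zero, Submodule.mem_bot] at hs
  subst hs
  exact TensorProduct.zero_tmul _ _

lemma kF_euler (ξ : Fin n → Module.End K T) (q : ℕ) (w : Kos K n T) (hw : w ∈ kF (q + 1)) :
    (∑ i, (LS (mx i) - LT (ξ i)) * LS (px i) : Module.End K (Kos K n T)) w - (q : K) • w ∈ kF q := by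
  induction hw using Submodule.span_induction with
  | mem x hx =>
    obtain ⟨s, e, t, hs, rfl⟩ := hx
    have h1 : (∑ i, (LS (mx i) - LT (ξ i)) * LS (px i) : Module.End K (Kos K n T)) (kt s e t) - (q : K) • kt s e t
      = kt ((∑ i, X i * pderiv i s) - (q : K) • s) e t - ∑ i, kt (pderiv i s) e (ξ i t) := by
      simp only [LinearMap.sum_apply, Module.End.mul_apply, LinearMap.sub_apply, LS_kt, LT_kt,
        Finset.sum_sub_distrib, mx_apply, px_apply]
      have h2 : kt ((∑ i, X i * pderiv i s) - (q : K) • s) e t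
          = ∑ i, kt (X i * pderiv i s) e t - (q : K) • kt s e t := by
        simp only [← ktl_apply]
        rw [map_sub, _root_.map_sum, map_smul]
      rw [h2, sub_right_comm]
    rw [h1]
    exact sub_mem (kt_mem (euler_Sd q hs) e t) (sum_mem fun i _ => kt_mem (pderiv_Sd i q hs) _ _)
  | zero => rw [map_zero, smul_zero, sub_zero]; exact zero_mem _
  | add a b _ _ ha hb =>
    rw [map_add, smul_add, add_sub_add_comm]; exact add_mem ha hb
  | smul c a _ ha =>
    rw [map_smul, smul_comm, ← smul_sub]; exact Submodule.smul_mem _ _ ha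

/-- elements of polynomial degree zero -/
lemma kF_one (w : Kos K n T) (hw : w ∈ kF 1) (h0 : LE (pr 0) w = w) : ∃ t, w = kt 1 1 t := by
  rw [← h0]
  clear h0
  induction hw using Submodule.span_induction with
  | mem x hx =>
    obtain ⟨s, e, t, hs, rfl⟩ := hx
    obtain ⟨c, rfl⟩ := Sd_one hs
    obtain ⟨b, hb⟩ := pr_zero e
    refine ⟨(c * b) • t, ?_⟩
    rw [LE_kt, hb]
    rw [Algebra.algebraMap_eq_smul_one, kt_smul_m, kt_smul_r, mul_comm, mul_smul, ← kt_smul_l c, smul_eq_C_mul, mul_one]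
  | zero => exact ⟨0, by rw [map_zero, ← zero_smul K (0 : T), kt_smul_r, zero_smul]⟩
  | add a b _ _ ha hb =>
    obtain ⟨t, ht⟩ := ha
    obtain ⟨u, hu⟩ := hb
    refine ⟨t + u, ?_⟩
    rw [map_add, ht, hu, kt_add_r]
  | smul c a _ ha =>
    obtain ⟨t, ht⟩ := ha
    refine ⟨c • t, ?_⟩
    rw [map_smul, ht, kt_smul_r]

end kos
end Inv17

-- part 9
namespace Inv17

section kosG
open TensorProduct
variable {K : Type} [Field K] {n : ℕ} (G : Subgroup (Matrix.SpecialLinearGroup (Fin n) K))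

attribute [local instance] actG

/-- the skew group ring of the concrete action -/
abbrev Lam := SkewMonoidAlgebra (MvPolynomial (Fin n) K) G

lemma sg_smulK (c : K) (s : MvPolynomial (Fin n) K) : (sg (c • s) : Lam G) = c • sg s := by
  change SkewMonoidAlgebra.single 1 (c • s) = c • SkewMonoidAlgebra.single 1 s
  rw [SkewMonoidAlgebra.smul_single]

lemma sg_C (c : K) : (sg (C c : MvPolynomial (Fin n) K) : Lam G) = algebraMap K (Lam G) c := rfl

variable (T : Type) [AddCommGroup T] [Module K T] [Module (Lam G) T] [IsScalarTower K (Lam G) T]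

/-- action of a variable on the module -/
def xi (i : Fin n) : Module.End K T := Algebra.lsmul K K T (sg (X i) : Lam G)
/-- action of a group element on the module -/
def gT (g : G) : Module.End K T := Algebra.lsmul K K T (gm g : Lam G)
/-- action of a group element on polynomials -/
def gS (g : G) : Module.End K (MvPolynomial (Fin n) K) :=
  (matAct K n (g : Matrix.SpecialLinearGroup (Fin n) K).1).toLinearMap

variable {T}

lemma xi_apply (i : Fin n) (t : T) : xi G T i t = (sg (X i) : Lam G) • t := rfl
lemma gT_apply (g : G) (t : T) : gT G T g t = (gm g : Lam G) • t := rfl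
lemma gS_apply (g : G) (s : MvPolynomial (Fin n) K) : gS G g s = g • s := rfl

lemma xi_comm (i j : Fin n) : Commute (xi G T i) (xi G T j) := by
  have : Commute (sg (X i) : Lam G) (sg (X j)) := by
    unfold Commute SemiconjBy
    rw [← map_mul, ← map_mul, mul_comm]
  exact this.map (Algebra.lsmul K K T)

lemma gX (g : G) (i : Fin n) : g • (X i : MvPolynomial (Fin n) K) = ∑ j, (g.1.1 j i) • X j := by
  rw [actG_def, matAct_X]; rfl

lemma gT_xi (g : G) (i : Fin n) : gT G T g * xi G T i = ∑ j, g.1.1 j i • (xi G T j * gT G T g) := by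
  unfold gT xi
  rw [← map_mul, gm_sg, gX, map_sum, Finset.sum_mul, map_sum]
  refine Finset.sum_congr rfl fun j _ => ?_
  rw [sg_smulK, smul_mul_assoc, map_smul, map_mul]

lemma gS_mx (g : G) (i : Fin n) : gS G g * mx i = ∑ j, g.1.1 j i • (mx j * gS G g) := by
  refine LinearMap.ext fun s => ?_
  have : g • (X i * s) = ∑ j, g.1.1 j i • (X j * g • s) := by
    rw [smul_mul', gX, Finset.sum_mul]
    simp only [smul_mul_assoc]
  refine this.trans ?_
  simp only [LinearMap.sum_apply, LinearMap.smul_apply]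
  rfl

/-- diagonal action on the Koszul complex -/
def gK (g : G) : Module.End K (Kos K n T) := LS (gS G g) * LE (emap g.1.1) * LT (gT G T g)

lemma gK_kt (g : G) (s : MvPolynomial (Fin n) K) (e : EA K n) (t : T) :
    gK G g (kt s e t) = kt (g • s) (emap g.1.1 e) ((gm g : Lam G) • t) := rfl

lemma gK_mul (g h : G) : (gK G (g * h) : Module.End K (Kos K n T)) = gK G g * gK G h := by
  refine kos_ext fun s e t => ?_
  rw [Module.End.mul_apply, gK_kt, gK_kt, gK_kt, smul_smul, smul_smul, gm_mul]
  congr 1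
  change emap (g.1.1 * h.1.1) e = _
  rw [emap_mul]; rfl

lemma gK_one : (gK G 1 : Module.End K (Kos K n T)) = 1 := by
  refine kos_ext fun s e t => ?_
  rw [gK_kt, one_smul, gm_one, one_smul]
  change kt s (emap 1 e) t = _
  rw [emap_one]; rfl

instance kosAct : DistribMulAction G (Kos K n T) where
  smul g w := gK G g w
  one_smul w := by change gK G 1 w = w; rw [gK_one]; rfl
  mul_smul g h w := by change gK G (g * h) w = _; rw [gK_mul]; rfl
  smul_zero g := map_zero _
  smul_add g := map_add _

lemma kosAct_def (g : G) (w : Kos K n T) : g • w = gK G g w := rfl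

lemma kos_semi (g : G) (s : MvPolynomial (Fin n) K) (w : Kos K n T) : g • (s • w) = (g • s) • g • w := by
  induction w using kos_induction with
  | h0 => simp
  | h1 r e t => simp only [kosAct_def, smul_kt, gK_kt, smul_mul']
  | h2 a b ha hb => simp only [smul_add, ha, hb]

instance kosLam : Module (Lam G) (Kos K n T) := skewModule (kos_semi G)

lemma kos_sg (s : MvPolynomial (Fin n) K) (w : Kos K n T) : (sg s : Lam G) • w = s • w :=
  skewModule_sg (kos_semi G) s w
lemma kos_gm (g : G) (w : Kos K n T) : (gm g : Lam G) • w = gK G g w :=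
  skewModule_gm (kos_semi G) g w

variable (T) in
/-- the operator `x_i - ξ_i` -/
def aK (i : Fin n) : Module.End K (Kos K n T) := LS (mx i) - LT (xi G T i)

lemma gK_a (g : G) (i : Fin n) : gK G g * aK G T i = ∑ j, g.1.1 j i • (aK G T j * gK G g) := by
  have h1 : (gK G g * LS (mx i) : Module.End K (Kos K n T)) = ∑ j, g.1.1 j i • (LS (mx j) * gK G g) := by
    unfold gK
    rw [mul_assoc, ← (comm_ST _ _).eq, ← mul_assoc, mul_assoc (LS _), ← (comm_SE _ _).eq, ← mul_assoc,
      ← map_mul, gS_mx, map_sum, Finset.sum_mul, Finset.sum_mul]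
    refine Finset.sum_congr rfl fun j _ => ?_
    rw [map_smul, map_mul, smul_mul_assoc, smul_mul_assoc, mul_assoc, mul_assoc, mul_assoc]
  have h2 : (gK G g * LT (xi G T i) : Module.End K (Kos K n T)) = ∑ j, g.1.1 j i • (LT (xi G T j) * gK G g) := by
    unfold gK
    rw [mul_assoc, ← map_mul, gT_xi, map_sum, Finset.mul_sum]
    refine Finset.sum_congr rfl fun j _ => ?_
    rw [map_smul, map_mul, mul_smul_comm, ← mul_assoc, ← mul_assoc, ← mul_assoc, mul_assoc (LS _),
      (comm_ET _ _).eq, ← mul_assoc, (comm_ST _ _).eq]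
  unfold aK
  rw [mul_sub, h1, h2, ← Finset.sum_sub_distrib]
  refine Finset.sum_congr rfl fun j _ => ?_
  rw [sub_mul, smul_sub]

lemma io_gK (g : G) (i : Fin n) : (LE (io i) * gK G g : Module.End K (Kos K n T))
    = ∑ j, g.1.1 i j • (gK G g * LE (io j)) := by
  refine kos_ext fun s e t => ?_
  simp only [Module.End.mul_apply, LinearMap.sum_apply, LinearMap.smul_apply, LE_kt, gK_kt, io_emap]
  have h : ∀ (c : Fin n → K) (f : Fin n → EA K n) (r : MvPolynomial (Fin n) K) (u : T),
      kt r (∑ j, c j • f j) u = ∑ j, c j • kt r (f j) u := by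
    intro c f r u
    let L : EA K n →ₗ[K] Kos K n T :=
      { toFun := fun e => kt r e u
        map_add' := fun _ _ => kt_add_m _ _ _ _
        map_smul' := fun _ _ => kt_smul_m _ _ _ _ }
    change L _ = ∑ j, c j • L (f j)
    simp
  exact h _ _ _ _

variable (T) in
/-- the Koszul differential -/
def dK : Module.End K (Kos K n T) := ∑ i, aK G T i * LE (io i)

lemma gK_d (g : G) : gK G g * dK G T = dK G T * gK G g := by
  unfold dK
  rw [Finset.mul_sum, Finset.sum_mul]
  simp only [mul_assoc, io_gK]
  simp only [← mul_assoc, gK_a, Finset.sum_mul, Finset.mul_sum]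
  rw [Finset.sum_comm]
  refine Finset.sum_congr rfl fun j _ => Finset.sum_congr rfl fun i _ => ?_
  rw [mul_smul_comm, smul_mul_assoc, mul_assoc]

lemma aK_smul (i : Fin n) (s : MvPolynomial (Fin n) K) (w : Kos K n T) : aK G T i (s • w) = s • aK G T i w := by
  induction w using kos_induction with
  | h0 => simp
  | h1 r e t =>
    simp only [aK, smul_kt, LinearMap.sub_apply, LS_kt, LT_kt, smul_sub, mx_apply]
    rw [mul_left_comm]
  | h2 a b ha hb => simp only [smul_add, map_add, ha, hb]

lemma LE_smul (f : Module.End K (EA K n)) (s : MvPolynomial (Fin n) K) (w : Kos K n T) :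
    LE f (s • w) = s • LE f w := by
  induction w using kos_induction with
  | h0 => simp
  | h1 r e t => simp only [smul_kt, LE_kt]
  | h2 a b ha hb => simp only [smul_add, map_add, ha, hb]

lemma dK_smul (s : MvPolynomial (Fin n) K) (w : Kos K n T) : dK G T (s • w) = s • dK G T w := by
  simp only [dK, LinearMap.sum_apply, Module.End.mul_apply, LE_smul, aK_smul, Finset.smul_sum]

variable (T) in
/-- the differential as a linear map over the skew group ring -/
def dL : Kos K n T →ₗ[Lam G] Kos K n T :=
  mkLin (dK G T).toAddMonoidHom
    (by intro s m; simp only [kos_sg]; exact dK_smul G s m)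
    (by intro g m; simp only [kos_gm]; exact (LinearMap.congr_fun (gK_d G g) m).symm)

lemma dL_apply (w : Kos K n T) : dL G T w = dK G T w := rfl

lemma gK_num (g : G) : (gK G g * LE (num K n) : Module.End K (Kos K n T)) = LE (num K n) * gK G g := by
  unfold gK
  rw [mul_assoc, ← (comm_ET _ _).eq, ← mul_assoc, mul_assoc (LS _), ← map_mul, emap_num, map_mul, ← mul_assoc,
    (comm_SE _ _).eq, mul_assoc, mul_assoc, mul_assoc]

variable (T) in
/-- the number operator as a linear map over the skew group ring -/
def nL : Kos K n T →ₗ[Lam G] Kos K n T :=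
  mkLin (LE (num K n) : Module.End K (Kos K n T)).toAddMonoidHom
    (by intro s m; simp only [kos_sg]; exact LE_smul _ s m)
    (by intro g m; simp only [kos_gm]; exact (LinearMap.congr_fun (gK_num G g) m).symm)

lemma nL_apply (w : Kos K n T) : nL G T w = LE (num K n) w := rfl

variable (T) in
/-- the degree `m` part of the Koszul complex -/
def Km (m : ℕ) : Submodule (Lam G) (Kos K n T) := LinearMap.ker (nL G T - m • LinearMap.id)

lemma mem_Km (m : ℕ) (w : Kos K n T) : w ∈ Km G T m ↔ LE (num K n) w = (m : K) • w := by
  rw [Km, LinearMap.mem_ker, LinearMap.sub_apply, sub_eq_zero, nL_apply, Nat.cast_smul_eq_nsmul]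
  rfl

end kosG
end Inv17

-- part 10
namespace Inv17

section kosH
open TensorProduct
variable {K : Type} [Field K] [CharZero K] {n : ℕ} (G : Subgroup (Matrix.SpecialLinearGroup (Fin n) K))

attribute [local instance] actG

/-- the group order is invertible -/
instance invG [Fintype G] : Invertible (Fintype.card G : MvPolynomial (Fin n) K) := by
  have : IsUnit (Fintype.card G : MvPolynomial (Fin n) K) := by
    have h : ((Fintype.card G : K)) ≠ 0 := Nat.cast_ne_zero.2 Fintype.card_ne_zero
    have := (IsUnit.mk0 _ h).map (C : K →+* MvPolynomial (Fin n) K)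
    simpa using this
  exact this.invertible

variable {T : Type} [AddCommGroup T] [Module K T] [Module (Lam G) T] [IsScalarTower K (Lam G) T]

lemma pr_Km_ne {m l : ℕ} (h : l ≠ m) {w : Kos K n T} (hw : w ∈ Km G T m) : LE (pr l) w = 0 := by
  rw [mem_Km] at hw
  have h1 : (LE (pr l) * LE (num K n) : Module.End K (Kos K n T)) w = (l : K) • LE (pr l) w := by
    rw [← _root_.map_mul, pr_num, map_smul]; rfl
  rw [Module.End.mul_apply, hw, map_smul] at h1
  have h2 : ((m : K) - l) • LE (pr l) w = 0 := by rw [sub_smul, h1, sub_self]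
  rcases smul_eq_zero.1 h2 with h3 | h3
  · exact absurd (Nat.cast_injective (sub_eq_zero.1 h3)).symm h
  · exact h3

lemma sum_LE_pr (w : Kos K n T) : ∑ m ∈ Finset.range (n + 1), LE (pr m) w = w := by
  have : (LE (∑ m ∈ Finset.range (n + 1), pr m) : Module.End K (Kos K n T)) w = w := by
    rw [sum_pr, map_one]; rfl
  rw [_root_.map_sum, LinearMap.sum_apply] at this
  exact this

lemma Km_zero {m : ℕ} (hm : n < m) {w : Kos K n T} (hw : w ∈ Km G T m) : w = 0 := by
  rw [← sum_LE_pr w]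
  refine Finset.sum_eq_zero fun l hl => pr_Km_ne G ?_ hw
  rw [Finset.mem_range] at hl; omega

lemma pr_Km {m : ℕ} {w : Kos K n T} (hw : w ∈ Km G T m) : LE (pr m) w = w := by
  by_cases hm : n < m
  · rw [Km_zero G hm hw, map_zero]
  conv_rhs => rw [← sum_LE_pr w]
  rw [Finset.sum_eq_single m (fun l _ hl => pr_Km_ne G hl hw)]
  intro h; exact absurd (Finset.mem_range.2 (by omega)) h

lemma pr_mem_Km (m : ℕ) (w : Kos K n T) : LE (pr m) w ∈ Km G T m := by
  rw [mem_Km, ← Module.End.mul_apply, ← _root_.map_mul, num_pr, map_smul]; rfl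

lemma gK_mem (g : G) {m : ℕ} {w : Kos K n T} (hw : w ∈ Km G T m) : gK G g w ∈ Km G T m := by
  rw [← kos_gm]; exact Submodule.smul_mem _ _ hw

lemma gK_pr (g : G) (m : ℕ) (w : Kos K n T) : LE (pr m) (gK G g w) = gK G g (LE (pr m) w) := by
  by_cases hm : n < m
  · rw [pr_zero_of_lt m hm]; simp
  conv_lhs => rw [← sum_LE_pr w]
  rw [_root_.map_sum, _root_.map_sum, Finset.sum_eq_single m
    (fun l _ hl => pr_Km_ne G hl.symm (gK_mem G g (pr_mem_Km G l w))), pr_Km G (gK_mem G g (pr_mem_Km G m w))]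
  intro h; exact absurd (Finset.mem_range.2 (by omega)) h

variable (T) in
/-- projection to the degree `m` part -/
def prL (m : ℕ) : Kos K n T →ₗ[Lam G] Km G T m :=
  mkLin
    ({ toFun := fun w => ⟨LE (pr m) w, pr_mem_Km G m w⟩
       map_zero' := by ext; simp
       map_add' := fun a b => by ext; simp } : Kos K n T →+ Km G T m)
    (by intro s w; ext; simp only [AddMonoidHom.coe_mk, ZeroHom.coe_mk, kos_sg, Submodule.coe_smul, LE_smul])
    (by intro s w; ext; simp only [AddMonoidHom.coe_mk, ZeroHom.coe_mk, kos_gm, Submodule.coe_smul, gK_pr])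

lemma prL_coe (m : ℕ) (w : Kos K n T) : (prL G T m w : Kos K n T) = LE (pr m) w := rfl

lemma prL_of_mem (m : ℕ) (w : Km G T m) : prL G T m w = w := Subtype.ext (pr_Km G w.2)

instance proj_Km [Fintype G] (m : ℕ) : Module.Projective (Lam G) (Km G T m) := by
  haveI : IsScalarTower (MvPolynomial (Fin n) K) (Lam G) (Kos K n T) := tower_of_sg (kos_sg G)
  haveI : Module.Projective (Lam G) (Kos K n T) := projective_skew
  refine Module.Projective.of_split (Km G T m).subtype (prL G T m) ?_
  ext w
  exact congrArg Subtype.val (prL_of_mem G m w)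

lemma dK_rels : Rels (aK G T) (fun i => LS (px i)) (fun i => LE (io i)) (fun i => LE (eps i)) :=
  kos_rels (xi G T) (xi_comm G)

lemma dK_sq (w : Kos K n T) : dK G T (dK G T w) = 0 := by
  haveI : Algebra ℚ (Module.End K (Kos K n T)) := by
    letI : Algebra ℚ K := DivisionRing.toRatAlgebra
    letI : Module ℚ (Kos K n T) := Module.compHom _ (algebraMap ℚ K)
    haveI : IsScalarTower ℚ K (Kos K n T) := ⟨fun a b c => by
      rw [Algebra.smul_def, mul_smul]; rfl⟩
    infer_instance
  exact LinearMap.congr_fun (dK_rels G (T := T)).sq w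

lemma dK_num (w : Kos K n T) : LE (num K n) (dK G T w) + dK G T w = dK G T (LE (num K n) w) := by
  have := LinearMap.congr_fun (dK_rels G (T := T)).num_D w
  rw [kos_num] at this
  exact this

lemma dK_mem {m : ℕ} {w : Kos K n T} (hw : w ∈ Km G T (m + 1)) : dK G T w ∈ Km G T m := by
  rw [mem_Km] at hw ⊢
  have := dK_num G w
  rw [hw, map_smul] at this
  rw [eq_sub_of_add_eq this]
  push_cast
  rw [add_smul, one_smul, add_sub_cancel_right]

lemma dK_zero {w : Kos K n T} (hw : w ∈ Km G T 0) : dK G T w = 0 := by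
  rw [mem_Km] at hw
  have h := dK_num G w
  rw [hw, Nat.cast_zero, zero_smul, map_zero] at h
  have h2 : ∀ l, LE (pr l) (dK G T w) = 0 := by
    intro l
    have h1 : (LE (pr l) * LE (num K n) : Module.End K (Kos K n T)) (dK G T w) = (l : K) • LE (pr l) (dK G T w) := by
      rw [← _root_.map_mul, pr_num, map_smul]; rfl
    rw [Module.End.mul_apply, eq_neg_of_add_eq_zero_left h, map_neg] at h1
    have h3 : ((l : K) + 1) • LE (pr l) (dK G T w) = 0 := by
      rw [add_smul, one_smul, ← h1, neg_add_cancel]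
    rcases smul_eq_zero.1 h3 with h4 | h4
    · exact absurd h4 (Nat.cast_add_one_ne_zero l)
    · exact h4
  rw [← sum_LE_pr (dK G T w)]
  exact Finset.sum_eq_zero fun l _ => h2 l

variable (T) in
/-- the Koszul differential in degree `m` -/
def Dm (m : ℕ) : Km G T (m + 1) →ₗ[Lam G] Km G T m :=
  (dL G T).restrict fun _ hw => dK_mem G hw

lemma Dm_coe (m : ℕ) (w : Km G T (m + 1)) : (Dm G T m w : Kos K n T) = dK G T w := rfl

lemma kos_descent {m : ℕ} (w : Kos K n T) (hw : w ∈ Km G T m) (hd : dK G T w = 0) :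
    ∃ w1 ∈ Km G T (m + 1), ∃ w0 ∈ Km G T m, w = dK G T w1 + w0 ∧ w0 ∈ kF 1 ∧ (0 < m → w0 = 0) := by
  obtain ⟨q, hq⟩ := mem_kF w
  obtain ⟨w1, w0, h1, h2, h3, h4, h5⟩ := descent (dK_rels G (T := T)) kF kF_zero
    (fun q w hw => kF_euler (xi G T) q w hw) m q w hq hd (by rw [kos_num]; exact (mem_Km G m w).1 hw)
  rw [kos_num] at h2 h4
  exact ⟨w1, (mem_Km G _ w1).2 h2, w0, (mem_Km G _ w0).2 h4, h1, h3, h5⟩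

lemma Dm_exact (m : ℕ) : Function.Exact (Dm G T (m + 1)) (Dm G T m) := by
  intro w
  constructor
  · intro h
    obtain ⟨w1, hw1, w0, _, h1, _, h2⟩ := kos_descent G w.1 w.2 (congrArg Subtype.val h)
    refine ⟨⟨w1, hw1⟩, Subtype.ext ?_⟩
    rw [Dm_coe, h1, h2 (Nat.succ_pos _), add_zero]
  · rintro ⟨v, rfl⟩
    exact Subtype.ext (dK_sq G v.1)

variable (T) in
/-- augmentation, as a `K`-linear map -/
def epK : Kos K n T →ₗ[K] T :=
  TensorProduct.lift (R := K) ((LinearMap.lcomp K T (TensorProduct.lift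
        ((LinearMap.lsmul K T).comp (ExteriorAlgebra.algebraMapInv (R := K) (M := Fin n → K)).toLinearMap))).comp
    ((Algebra.lsmul K K T).toLinearMap.comp
      ({ toFun := fun s => (sg s : Lam G)
         map_add' := map_add _
         map_smul' := fun c s => sg_smulK G c s } : MvPolynomial (Fin n) K →ₗ[K] Lam G)))

lemma epK_kt (s : MvPolynomial (Fin n) K) (e : EA K n) (t : T) :
    epK G T (kt s e t) = (sg s : Lam G) • (ExteriorAlgebra.algebraMapInv e • t) := rfl

lemma aInv_emap (M : Matrix (Fin n) (Fin n) K) (e : EA K n) :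
    ExteriorAlgebra.algebraMapInv (emap M e) = ExteriorAlgebra.algebraMapInv e := by
  induction e using ext_induction with
  | h0 r => rw [emap_algebraMap]
  | h1 v b hb =>
    have : ∀ (v : Fin n → K) b, ExteriorAlgebra.algebraMapInv (ExteriorAlgebra.ι K v * b) = 0 := by
      intro v b; rw [_root_.map_mul]; simp [ExteriorAlgebra.algebraMapInv]
    rw [emap_ι_mul, this, this]
  | h2 a b ha hb => rw [map_add, map_add, map_add, ha, hb]

lemma smul_c (l : Lam G) (c : K) (t : T) : l • c • t = c • l • t := by
  rw [← algebraMap_smul (Lam G) c t, ← algebraMap_smul (Lam G) c (l • t), smul_smul, smul_smul, Algebra.commutes]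

variable (T) in
/-- the augmentation -/
def epL : Kos K n T →ₗ[Lam G] T :=
  mkLin (epK G T).toAddMonoidHom
    (by
      intro s w
      simp only [LinearMap.toAddMonoidHom_coe, kos_sg]
      induction w using kos_induction with
      | h0 => simp
      | h1 r e t => rw [smul_kt, epK_kt, epK_kt, _root_.map_mul, mul_smul]
      | h2 a b ha hb => rw [smul_add, map_add, map_add, ha, hb, smul_add])
    (by
      intro g w
      simp only [LinearMap.toAddMonoidHom_coe, kos_gm]
      induction w using kos_induction with
      | h0 => simp
      | h1 r e t => rw [gK_kt, epK_kt, epK_kt, smul_smul (gm g), gm_sg, mul_smul, aInv_emap, smul_c, smul_c, smul_c]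
      | h2 a b ha hb => rw [map_add, map_add, map_add, ha, hb, smul_add])

lemma epL_apply (w : Kos K n T) : epL G T w = epK G T w := rfl

lemma epK_a (i : Fin n) (w : Kos K n T) : epK G T (aK G T i w) = 0 := by
  induction w using kos_induction with
  | h0 => simp
  | h1 s e t =>
    rw [aK, LinearMap.sub_apply, LS_kt, LT_kt, map_sub, epK_kt, epK_kt, mx_apply, xi_apply,
      mul_comm, _root_.map_mul, mul_smul, smul_c, sub_self]
  | h2 a b ha hb => rw [map_add, map_add, ha, hb, add_zero]

lemma epK_d (w : Kos K n T) : epK G T (dK G T w) = 0 := by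
  simp only [dK, LinearMap.sum_apply, Module.End.mul_apply, _root_.map_sum, epK_a, Finset.sum_const_zero]

lemma kt_mem_Km (t : T) : (kt 1 1 t : Kos K n T) ∈ Km G T 0 := by
  rw [mem_Km, LE_kt, ← map_one (algebraMap K (EA K n)), num_algebraMap, Nat.cast_zero, zero_smul,
    ← zero_smul K (0 : EA K n), kt_smul_m, zero_smul]

lemma epK_one (t : T) : epK G T (kt 1 1 t) = t := by
  rw [epK_kt, map_one, map_one, one_smul, one_smul]

variable (T) in
/-- the augmentation in degree zero -/
def ep0 : Km G T 0 →ₗ[Lam G] T := epL G T ∘ₗ (Km G T 0).subtype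

lemma ep0_surj : Function.Surjective (ep0 G T) := fun t => ⟨⟨kt 1 1 t, kt_mem_Km G t⟩, epK_one G t⟩

lemma ep0_exact : Function.Exact (Dm G T 0) (ep0 G T) := by
  intro w
  constructor
  · intro h
    obtain ⟨w1, hw1, w0, hw0, h1, h2, _⟩ := kos_descent G w.1 w.2 (dK_zero G w.2)
    obtain ⟨t, ht⟩ := kF_one w0 h2 (pr_Km G hw0)
    have h3 : epK G T w.1 = 0 := h
    rw [h1, map_add, epK_d, zero_add, ht, epK_one] at h3
    refine ⟨⟨w1, hw1⟩, Subtype.ext ?_⟩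
    rw [Dm_coe, h1, ht, h3, ← zero_smul K (0 : T), kt_smul_r, zero_smul, add_zero]
  · rintro ⟨v, rfl⟩
    exact epK_d G v.1

/-- the global dimension bound -/
lemma pd_bound [Fintype G] (T : Type) [AddCommGroup T] [Module (Lam G) T] : PD (Lam G) T (n + 1) := by
  letI : Module K T := Module.compHom T (algebraMap K (Lam G))
  haveI : IsScalarTower K (Lam G) T := ⟨fun a b c => by rw [Algebra.smul_def, mul_smul]; rfl⟩
  refine chain_pd (fun m => Km G T m) (Dm G T) (ep0 G T) (ep0_surj G) (ep0_exact G) (Dm_exact G) (n + 1) ?_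
  intro m hm
  refine ⟨fun a b => Subtype.ext ?_⟩
  rw [Km_zero G hm a.2, Km_zero G hm b.2]

end kosH
end Inv17

-- part 11
namespace Inv17

section dual
open TensorProduct
variable {K : Type} [Field K] {n : ℕ}

instance finEA : Module.Finite K (EA K n) := by
  let f : (Π m : Fin (n + 1), ⋀[K]^(m : ℕ) (Fin n → K)) →ₗ[K] EA K n :=
    ∑ m : Fin (n + 1), (Submodule.subtype (⋀[K]^(m : ℕ) (Fin n → K))).comp (LinearMap.proj m)
  refine Module.Finite.of_surjective f fun x => ⟨fun m => ⟨pr m x, pr_mem m x⟩, ?_⟩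
  have h := LinearMap.congr_fun (sum_pr (K := K) (n := n)) x
  rw [LinearMap.sum_apply, Finset.sum_range] at h
  simp only [f, LinearMap.sum_apply]
  exact h

variable (T : Type) [AddCommGroup T] [Module K T]

variable (K n) in
/-- linear maps from coefficients to polynomials -/
abbrev WW := (EA K n ⊗[K] T) →ₗ[K] MvPolynomial (Fin n) K

/-- post-composition -/
def po (f : Module.End K (MvPolynomial (Fin n) K)) : Module.End K (WW K n T) where
  toFun φ := f ∘ₗ φ
  map_add' a b := LinearMap.comp_add _ _ _
  map_smul' c a := LinearMap.comp_smul _ _ _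
/-- pre-composition -/
def pe (f : Module.End K (EA K n ⊗[K] T)) : Module.End K (WW K n T) where
  toFun φ := φ ∘ₗ f
  map_add' a b := LinearMap.add_comp _ _ _
  map_smul' c a := LinearMap.smul_comp _ _ _

variable {T}

lemma po_apply (f) (φ : WW K n T) : po T f φ = f ∘ₗ φ := rfl
lemma pe_apply (f) (φ : WW K n T) : pe T f φ = φ ∘ₗ f := rfl
lemma po_pe (f g) : Commute (po (K := K) (n := n) T f) (pe T g) := LinearMap.ext fun _ => rfl
lemma po_mul (f g) : po (n := n) (K := K) T (f * g) = po T f * po T g := LinearMap.ext fun _ => rfl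
lemma pe_mul (f g) : pe (n := n) (K := K) T (f * g) = pe T g * pe T f := LinearMap.ext fun _ => rfl
lemma po_add (f g) : po (n := n) (K := K) T (f + g) = po T f + po T g :=
  LinearMap.ext fun _ => LinearMap.add_comp _ _ _
lemma pe_add (f g) : pe (n := n) (K := K) T (f + g) = pe T f + pe T g :=
  LinearMap.ext fun _ => LinearMap.comp_add _ _ _
lemma po_one : po (n := n) (K := K) T 1 = 1 := LinearMap.ext fun _ => rfl
lemma pe_one : pe (n := n) (K := K) T 1 = 1 := LinearMap.ext fun _ => rfl
lemma pe_neg (f) : pe (n := n) (K := K) T (-f) = - pe T f :=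
  LinearMap.ext fun _ => LinearMap.comp_neg _ _
lemma po_ite (p : Prop) [Decidable p] : po (n := n) (K := K) T (if p then 1 else 0) = if p then 1 else 0 := by
  split_ifs
  · rfl
  · exact LinearMap.ext fun _ => LinearMap.zero_comp _
lemma pe_ite (p : Prop) [Decidable p] : pe (n := n) (K := K) T (if p then 1 else 0) = if p then 1 else 0 := by
  split_ifs
  · rfl
  · exact LinearMap.ext fun _ => LinearMap.comp_zero _

/-- operators on the exterior factor -/
abbrev rE (T : Type) [AddCommGroup T] [Module K T] : Module.End K (EA K n) →ₐ[K] Module.End K (EA K n ⊗[K] T) :=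
  Module.End.rTensorAlgHom K _ _
/-- operators on the module factor -/
abbrev rT : Module.End K T →ₐ[K] Module.End K (EA K n ⊗[K] T) :=
  Module.End.lTensorAlgHom K _ _

lemma rE_rT (f) (g : Module.End K T) : Commute (rE (n := n) T f) (rT g) :=
  TensorProduct.ext' fun _ _ => rfl

lemma dual_rels (ξ : Fin n → Module.End K T) (hξ : ∀ i j, Commute (ξ i) (ξ j)) :
    Rels (A := Module.End K (WW K n T)) (fun i => po T (mx i) - pe T (rT (ξ i))) (fun i => po T (px i))
      (fun i => pe T (rE T (io i))) (fun i => pe T (rE T (eps i))) := by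
  have hpe : ∀ {f g}, Commute f g → Commute (pe (n := n) (K := K) T f) (pe T g) := by
    intro f g h
    unfold Commute SemiconjBy
    rw [← pe_mul, ← pe_mul, h.eq]
  refine Rels.of3 (fun i j => ?_) (fun i j => hpe ((hξ i j).map rT)) (fun i j => po_pe _ _)
    (fun i j => ?_) (fun i j => po_pe _ _) (fun i j => po_pe _ _) (fun i j => po_pe _ _)
    (fun i j => hpe (rE_rT _ _).symm) (fun i j => hpe (rE_rT _ _).symm) (fun i j => po_pe _ _) (fun i j => po_pe _ _)
    (fun i j => ?_) (fun i j => ?_) (fun i j => ?_)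
  · unfold Commute SemiconjBy
    rw [← po_mul, (mx_comm i j).eq, po_mul]
  · rw [← po_mul, px_mx, po_add, po_mul, po_ite]
  · rw [← pe_mul, ← pe_mul, ← pe_add, ← _root_.map_mul, ← _root_.map_mul, ← _root_.map_add, add_comm, io_eps,
      ← pe_ite]
    congr 1
    split_ifs <;> simp
  · rw [← pe_mul, ← pe_mul, ← _root_.map_mul, ← _root_.map_mul, io_io, _root_.map_neg, pe_neg]
  · rw [← pe_mul, ← pe_mul, ← _root_.map_mul, ← _root_.map_mul, eps_eps, _root_.map_neg, pe_neg]

lemma sum_io_eps : ∑ i, (io i : Module.End K (EA K n)) * eps i = (n : K) • 1 - num K n := by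
  rw [eq_sub_iff_add_eq, num, ← Finset.sum_add_distrib]
  simp only [io_eps, if_true, Finset.sum_const, Finset.card_univ, Fintype.card_fin, Nat.cast_smul_eq_nsmul]

lemma dual_num (m : ℕ) (hm : m ≤ n) (φ : WW K n T) (h : φ ∘ₗ rE T (pr m) = φ) :
    (∑ i, pe T (rE T (eps i)) * pe T (rE T (io i)) : Module.End K (WW K n T)) φ = ((n - m : ℕ) : K) • φ := by
  have h1 : (∑ i, pe T (rE T (eps i)) * pe T (rE T (io i)) : Module.End K (WW K n T))
      = ∑ i, pe T (rE T (io i * eps i)) := by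
    refine Finset.sum_congr rfl fun i _ => ?_
    rw [← pe_mul, _root_.map_mul]
  have h2 : (∑ i, pe T (rE T (io i * eps i)) : Module.End K (WW K n T)) φ
      = φ ∘ₗ rE T (∑ i, io i * eps i) := by
    rw [LinearMap.sum_apply, _root_.map_sum]
    refine LinearMap.ext fun x => ?_
    simp only [LinearMap.sum_apply, pe_apply, LinearMap.comp_apply, _root_.map_sum]
  rw [h1, h2, sum_io_eps]
  conv_lhs => rw [← h]
  have h3 : (rE T (pr m) * rE T ((n : K) • 1 - num K n) : Module.End K (EA K n ⊗[K] T))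
      = ((n - m : ℕ) : K) • rE T (pr m) := by
    rw [← _root_.map_mul, mul_sub, pr_num, mul_smul_comm, mul_one, Nat.cast_sub hm, map_sub, map_smul, map_smul]
    exact LinearMap.ext fun x => (sub_smul (n : K) (m : K) (rE T (pr m) x)).symm
  rw [LinearMap.comp_assoc]
  change φ ∘ₗ (rE T (pr m) * rE T ((n : K) • 1 - num K n)) = _
  rw [h3, LinearMap.comp_smul, h]

/-- filtration by degree of values -/
def wF (q : ℕ) : Submodule K (WW K n T) where
  carrier := {φ | ∀ x, φ x ∈ Sd K n q}
  zero_mem' x := zero_mem _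
  add_mem' ha hb x := add_mem (ha x) (hb x)
  smul_mem' c _ ha x := Submodule.smul_mem _ _ (ha x)

lemma wF_zero : (wF 0 : Submodule K (WW K n T)) = ⊥ := by
  rw [eq_bot_iff]
  intro φ hφ
  rw [Submodule.mem_bot]
  refine LinearMap.ext fun x => ?_
  have := hφ x
  rw [Sd_zero] at this
  exact this

lemma mem_wF [Module.Finite K T] (φ : WW K n T) : ∃ q, φ ∈ wF q := by
  classical
  obtain ⟨s, hs⟩ := (Module.Finite.fg_top : (⊤ : Submodule K (EA K n ⊗[K] T)).FG)
  choose f hf using fun x => mem_Sd (φ x)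
  refine ⟨s.sup f, fun x => ?_⟩
  have hx : x ∈ Submodule.span K (s : Set (EA K n ⊗[K] T)) := hs ▸ Submodule.mem_top
  induction hx using Submodule.span_induction with
  | mem x hx => exact Sd_mono (Finset.le_sup hx) (hf x)
  | zero => rw [map_zero]; exact zero_mem _
  | add a b _ _ ha hb => rw [map_add]; exact add_mem ha hb
  | smul c a _ ha => rw [map_smul]; exact Submodule.smul_mem _ _ ha

lemma wF_euler (ξ : Fin n → Module.End K T) (q : ℕ) (φ : WW K n T) (hφ : φ ∈ wF (q + 1)) :
    (∑ i, (po T (mx i) - pe T (rT (ξ i))) * po T (px i) : Module.End K (WW K n T)) φ - (q : K) • φ ∈ wF q := by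
  intro x
  have h1 : ((∑ i, (po T (mx i) - pe T (rT (ξ i))) * po T (px i) : Module.End K (WW K n T)) φ - (q : K) • φ) x
    = ((∑ i, X i * pderiv i (φ x)) - (q : K) • φ x) - ∑ i, pderiv i (φ (rT (ξ i) x)) := by
    rw [LinearMap.sub_apply, LinearMap.sum_apply, LinearMap.sum_apply, LinearMap.smul_apply, sub_right_comm,
      ← Finset.sum_sub_distrib]
    rfl
  rw [h1]
  exact sub_mem (euler_Sd q (hφ x)) (sum_mem fun i _ => pderiv_Sd i q (hφ _))

/-- extension of scalars of a linear map -/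
def lfK (φ : WW K n T) : Kos K n T →ₗ[K] MvPolynomial (Fin n) K :=
  TensorProduct.lift (R := K) ((LinearMap.lcomp K _ φ).comp (LinearMap.mul K (MvPolynomial (Fin n) K)))

lemma lfK_kt (φ : WW K n T) (s : MvPolynomial (Fin n) K) (e : EA K n) (t : T) :
    lfK φ (kt s e t) = s * φ (e ⊗ₜ t) := rfl

lemma lfK_add (φ ψ : WW K n T) : lfK (φ + ψ) = lfK φ + lfK ψ := by
  refine kos_ext fun s e t => ?_
  rw [LinearMap.add_apply, lfK_kt, lfK_kt, lfK_kt, LinearMap.add_apply, mul_add]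

lemma lfK_smul (φ : WW K n T) (s : MvPolynomial (Fin n) K) (w : Kos K n T) : lfK φ (s • w) = s * lfK φ w := by
  induction w using kos_induction with
  | h0 => simp
  | h1 r e t => rw [smul_kt, lfK_kt, lfK_kt, mul_assoc]
  | h2 a b ha hb => rw [smul_add, map_add, map_add, ha, hb, mul_add]

end dual
end Inv17

-- part 12
namespace Inv17

section dualG
open TensorProduct
variable {K : Type} [Field K] {n : ℕ} (G : Subgroup (Matrix.SpecialLinearGroup (Fin n) K))

attribute [local instance] actG

/-- the polynomial ring as a module over the skew group ring -/
instance lamS : Module (Lam G) (MvPolynomial (Fin n) K) :=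
  skewModule (S := MvPolynomial (Fin n) K) (G := G) (fun g s m => smul_mul' g s m)

lemma lamS_sg (s t : MvPolynomial (Fin n) K) : (sg s : Lam G) • t = s * t :=
  skewModule_sg (S := MvPolynomial (Fin n) K) (G := G) (fun g s m => smul_mul' g s m) s t
lemma lamS_gm (g : G) (t : MvPolynomial (Fin n) K) : (gm g : Lam G) • t = g • t :=
  skewModule_gm (S := MvPolynomial (Fin n) K) (G := G) (fun g s m => smul_mul' g s m) g t

variable {T : Type} [AddCommGroup T] [Module K T] [Module (Lam G) T] [IsScalarTower K (Lam G) T]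

variable (T) in
/-- the dual differential -/
def dW : Module.End K (WW K n T) :=
  ∑ i, (po T (mx i) - pe T (rT (xi G T i))) * pe T (rE T (io i))

lemma dW_apply (φ : WW K n T) (e : EA K n) (t : T) :
    dW G T φ (e ⊗ₜ t) = ∑ i, (X i * φ (io i e ⊗ₜ t) - φ (io i e ⊗ₜ ((sg (X i) : Lam G) • t))) := by
  rw [dW, LinearMap.sum_apply, LinearMap.sum_apply]
  rfl

lemma lfK_d (φ : WW K n T) (w : Kos K n T) : lfK φ (dK G T w) = lfK (dW G T φ) w := by
  induction w using kos_induction with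
  | h0 => simp
  | h1 s e t =>
    rw [lfK_kt, dW_apply, dK, LinearMap.sum_apply, _root_.map_sum, Finset.mul_sum]
    refine Finset.sum_congr rfl fun i _ => ?_
    rw [Module.End.mul_apply, LE_kt, aK, LinearMap.sub_apply, LS_kt, LT_kt, map_sub, lfK_kt, lfK_kt, mx_apply,
      xi_apply, mul_sub, mul_left_comm, mul_assoc]
  | h2 a b ha hb => rw [map_add, map_add, map_add, ha, hb]

/-- restriction of a map to the coefficients -/
def resK (ψ : Kos K n T →ₗ[Lam G] MvPolynomial (Fin n) K) : WW K n T where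
  toFun u := ψ ((1 : MvPolynomial (Fin n) K) ⊗ₜ[K] u : MvPolynomial (Fin n) K ⊗[K] (EA K n ⊗[K] T))
  map_add' a b := by rw [TensorProduct.tmul_add]; exact map_add ψ _ _
  map_smul' c a := by
    have h : ∀ w : Kos K n T, ψ (c • w) = c • ψ w := by
      intro w
      have h1 : c • w = (C c : MvPolynomial (Fin n) K) • w := by
        induction w using kos_induction with
        | h0 => simp
        | h1 s e t => rw [smul_kt, ← kt_smul_l, smul_eq_C_mul]
        | h2 a b ha hb => rw [smul_add, smul_add, ha, hb]
      rw [h1, ← kos_sg G, map_smul, lamS_sg, smul_eq_C_mul]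
    rw [TensorProduct.tmul_smul]
    exact h _

lemma resK_apply (ψ : Kos K n T →ₗ[Lam G] MvPolynomial (Fin n) K) (e : EA K n) (t : T) :
    resK G ψ (e ⊗ₜ t) = ψ (kt 1 e t) := rfl

lemma lfK_resK (ψ : Kos K n T →ₗ[Lam G] MvPolynomial (Fin n) K) (w : Kos K n T) : lfK (resK G ψ) w = ψ w := by
  induction w using kos_induction with
  | h0 => simp
  | h1 s e t => rw [lfK_kt, resK_apply, ← lamS_sg G, ← map_smul, kos_sg, smul_kt, mul_one]
  | h2 a b ha hb => rw [map_add, map_add, ha, hb]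

variable [CharZero K]

lemma pr_dK (m : ℕ) (w : Kos K n T) : LE (pr m) (dK G T w) = dK G T (LE (pr (m + 1)) w) := by
  conv_lhs => rw [← sum_LE_pr w]
  rw [_root_.map_sum, _root_.map_sum]
  have h : ∀ l, l ≠ m + 1 → LE (pr m) (dK G T (LE (pr l) w)) = 0 := by
    intro l hl
    cases l with
    | zero => rw [dK_zero G (pr_mem_Km G 0 w), map_zero]
    | succ l => exact pr_Km_ne G (by omega) (dK_mem G (pr_mem_Km G (l + 1) w))
  by_cases hm : n < m + 1
  · rw [pr_zero_of_lt (m + 1) hm, _root_.map_zero, LinearMap.zero_apply, map_zero]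
    refine Finset.sum_eq_zero fun l hl => h l ?_
    rw [Finset.mem_range] at hl; omega
  · rw [Finset.sum_eq_single (m + 1) (fun l _ hl => h l hl), pr_Km G (dK_mem G (pr_mem_Km G (m + 1) w))]
    intro h; exact absurd (Finset.mem_range.2 (by omega)) h

lemma dual_descent [Module.Finite K T] {m : ℕ} (hm : m ≤ n) (ψ : Km G T m →ₗ[Lam G] MvPolynomial (Fin n) K)
    (hψ : ψ ∘ₗ Dm G T m = 0) : ∃ φ1 φ0 : WW K n T, φ0 ∈ wF 1 ∧ (m < n → φ0 = 0) ∧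
      ∀ w : Km G T m, ψ w = lfK φ1 (dK G T w) + lfK φ0 w := by
  set φ := resK G (ψ ∘ₗ prL G T m) with hφ
  have h1 : ∀ w, lfK φ w = ψ (prL G T m w) := fun w => lfK_resK G _ w
  have h2 : φ ∘ₗ rE T (pr m) = φ := by
    refine TensorProduct.ext' fun e t => ?_
    change φ (pr m e ⊗ₜ t) = φ (e ⊗ₜ t)
    rw [hφ, resK_apply, resK_apply]
    change ψ (prL G T m (LE (pr m) (kt 1 e t))) = ψ (prL G T m _)
    congr 1
    refine Subtype.ext ?_
    rw [prL_coe, prL_coe, pr_Km G (pr_mem_Km G m _)]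
  have h3 : dW G T φ = 0 := by
    refine TensorProduct.ext' fun e t => ?_
    have : lfK (dW G T φ) (kt 1 e t) = 0 := by
      rw [← lfK_d, h1]
      have : prL G T m (dK G T (kt 1 e t)) = Dm G T m (prL G T (m + 1) (kt 1 e t)) := by
        refine Subtype.ext ?_
        rw [prL_coe, Dm_coe, prL_coe, pr_dK]
      rw [this]
      exact LinearMap.congr_fun hψ _
    rw [lfK_kt, one_mul] at this
    exact this
  obtain ⟨q, hq⟩ := mem_wF φ
  obtain ⟨φ1, φ0, e1, e2, e3, e4, e5⟩ := descent (dual_rels (xi G T) (xi_comm G)) wF wF_zero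
    (fun q w hw => wF_euler (xi G T) q w hw) (n - m) q φ hq h3 (dual_num m hm φ h2)
  refine ⟨φ1, φ0, e3, fun h => e5 (by omega), fun w => ?_⟩
  have : ψ w = lfK φ w := by rw [h1, prL_of_mem]
  rw [this, e1, lfK_add, lfK_d]
  rfl

variable [Fintype G]

/-- averaged extension of scalars -/
def avK (φ : WW K n T) : Kos K n T →ₗ[Lam G] MvPolynomial (Fin n) K :=
  avgMap (lfK φ).toAddMonoidHom (fun s m => by
    simp only [LinearMap.toAddMonoidHom_coe, kos_sg, lamS_sg, lfK_smul])

lemma avK_apply (φ : WW K n T) (w : Kos K n T) :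
    avK G φ w = cinv (MvPolynomial (Fin n) K) G • ∑ g : G, g • lfK φ (gK G g⁻¹ w) := by
  rw [avK, avgMap_apply]
  simp only [kos_gm, lamS_gm]
  rfl

lemma const_inv (g : G) (φ : WW K n T) (hφ : φ ∈ wF 1) (u) : g • φ u = φ u := by
  obtain ⟨c, hc⟩ := Sd_one (hφ u)
  rw [hc, actG_def]
  exact (matAct K n _).commutes c

lemma avK_const (hT : ∀ t : T, (∀ g : G, (gm g : Lam G) • t = t) → t = 0) (φ : WW K n T) (hφ : φ ∈ wF 1)
    (w : Kos K n T) : avK G φ (LE (pr n) w) = 0 := by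
  induction w using kos_induction with
  | h0 => simp
  | h1 s e t =>
    rw [avK_apply, LE_kt]
    have h1 : ∀ g : G, g • lfK φ (gK G g⁻¹ (kt s (pr n e) t)) = s * φ (pr n e ⊗ₜ ((gm g⁻¹ : Lam G) • t)) := by
      intro g
      rw [gK_kt, lfK_kt, smul_mul', smul_smul, mul_inv_cancel, one_smul, const_inv G g φ hφ,
        emap_pr_top _ (g⁻¹).1.2]
    have h2 : ∑ g : G, (gm g⁻¹ : Lam G) • t = 0 := by
      refine hT _ fun h => ?_
      rw [Finset.smul_sum]
      refine Fintype.sum_equiv (Equiv.mulRight h⁻¹) _ _ fun g => ?_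
      rw [gm_smul_smul]; simp
    rw [Finset.sum_congr rfl fun g _ => h1 g, ← Finset.mul_sum, ← _root_.map_sum, ← TensorProduct.tmul_sum, h2]
    simp
  | h2 a b ha hb => rw [map_add, map_add, ha, hb, add_zero]

lemma avK_eq (φ1 φ0 : WW K n T) {m : ℕ} (ψ : Km G T m →ₗ[Lam G] MvPolynomial (Fin n) K)
    (h : ∀ w : Km G T m, ψ w = lfK φ1 (dK G T w) + lfK φ0 w) (w : Km G T m) :
    ψ w = avK G φ1 (dK G T w) + avK G φ0 w := by
  rw [avK_apply, avK_apply, ← smul_add, ← Finset.sum_add_distrib]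
  have h1 : ∀ g : G, g • lfK φ1 (gK G g⁻¹ (dK G T w)) + g • lfK φ0 (gK G g⁻¹ w) = ψ w := by
    intro g
    rw [← smul_add]
    have h2 := LinearMap.congr_fun (gK_d G g⁻¹ (T := T)) w
    rw [Module.End.mul_apply, Module.End.mul_apply] at h2
    rw [h2, ← h ⟨gK G g⁻¹ w, gK_mem G g⁻¹ w.2⟩]
    have h3 : (⟨gK G g⁻¹ w, gK_mem G g⁻¹ w.2⟩ : Km G T m) = (gm g⁻¹ : Lam G) • w :=
      Subtype.ext (kos_gm G g⁻¹ w.1).symm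
    rw [h3, map_smul, lamS_gm, smul_smul, mul_inv_cancel, one_smul]
  rw [Finset.sum_congr rfl fun g _ => h1 g, Finset.sum_const, Finset.card_univ, cinv_card]

/-- the main vanishing for finite dimensional modules without invariants -/
lemma EV_fd (hn : 0 < n) [Module.Finite K T] (hT : ∀ t : T, (∀ g : G, (gm g : Lam G) • t = t) → t = 0) (j : ℕ) :
    EV (Lam G) T (MvPolynomial (Fin n) K) j := by
  refine chain_EV (fun m => Km G T m) (Dm G T) (ep0 G T) (ep0_surj G) (ep0_exact G) (Dm_exact G) ?_ ?_ j
  · intro ψ hψ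
    obtain ⟨φ1, φ0, h0, h1, h2⟩ := dual_descent G (Nat.zero_le n) ψ hψ
    refine LinearMap.ext fun w => ?_
    have h3 := h2 w
    rw [dK_zero G w.2, h1 hn, map_zero, zero_add] at h3
    rw [h3]
    have : lfK (0 : WW K n T) = 0 := kos_ext fun s e t => by rw [lfK_kt]; simp
    rw [this]; rfl
  · intro m ψ hψ
    by_cases hm : m + 1 ≤ n
    · obtain ⟨φ1, φ0, h0, h1, h2⟩ := dual_descent G hm ψ hψ
      refine ⟨avK G φ1 ∘ₗ (Km G T m).subtype, LinearMap.ext fun w => ?_⟩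
      rw [avK_eq G φ1 φ0 ψ h2]
      have : avK G φ0 w = 0 := by
        rcases Nat.lt_or_ge (m + 1) n with h | h
        · rw [h1 h, avK_apply]
          have : lfK (0 : WW K n T) = 0 := kos_ext fun s e t => by rw [lfK_kt]; simp
          simp [this]
        · have hmn : m + 1 = n := le_antisymm hm h
          have h4 := avK_const G hT φ0 h0 w.1
          rwa [show pr n = pr (K := K) (n := n) (m + 1) by rw [hmn], pr_Km G w.2] at h4
      rw [this, add_zero]
      rfl
    · refine ⟨0, LinearMap.ext fun w => ?_⟩
      have : w = 0 := Subtype.ext (Km_zero G (by omega) w.2)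
      rw [this, map_zero, map_zero]

end dualG
end Inv17

-- part 13
namespace Inv17

lemma fin_of_killed {K R₀ : Type} [Field K] [CommRing R₀] [Algebra K R₀] [Algebra.FiniteType K R₀]
    (I : Ideal R₀) (hI : I.IsMaximal) (T : Type) [AddCommGroup T] [Module K T] [Module R₀ T]
    [IsScalarTower K R₀ T] [Module.Finite R₀ T] (hk : ∀ r ∈ I, ∀ t : T, r • t = 0) : Module.Finite K T := by
  have ht : Module.IsTorsionBySet R₀ T (I : Set R₀) := fun t r => hk r.1 r.2 t
  letI := ht.module
  haveI : IsScalarTower R₀ (R₀ ⧸ I) T := ht.isScalarTower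
  haveI : Module.Finite (R₀ ⧸ I) T := Module.Finite.of_restrictScalars_finite R₀ _ _
  haveI : Algebra.FiniteType K (R₀ ⧸ I) :=
    Algebra.FiniteType.of_surjective (Ideal.Quotient.mkₐ K I) (Ideal.Quotient.mkₐ_surjective K I)
  haveI : Module.Finite K (R₀ ⧸ I) := by
    letI := Ideal.Quotient.field I
    exact finite_of_finite_type_of_isJacobsonRing K _
  haveI : IsScalarTower K (R₀ ⧸ I) T := ⟨fun a b c => by
    obtain ⟨b, rfl⟩ := Ideal.Quotient.mk_surjective b
    change (Ideal.Quotient.mk I (a • b)) • c = a • ((Ideal.Quotient.mk I b) • c)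
    rw [Module.IsTorsionBySet.mk_smul, Module.IsTorsionBySet.mk_smul, smul_assoc]⟩
  exact Module.Finite.trans (R₀ ⧸ I) T

section vanish
variable {K : Type} [Field K] [CharZero K] {n : ℕ} (G : Subgroup (Matrix.SpecialLinearGroup (Fin n) K)) [Fintype G]

attribute [local instance] actG

/-- no invariants -/
def NoInv (T : Type) [AddCommGroup T] [Module (Lam G) T] : Prop :=
  ∀ t : T, (∀ g : G, (gm g : Lam G) • t = t) → t = 0

lemma noInv_rey {T : Type} [AddCommGroup T] [Module (Lam G) T] (h : NoInv G T) (t : T) :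
    rey (MvPolynomial (Fin n) K) G t = 0 := h _ fun g => gm_rey g t

lemma noInv_of_rey {T : Type} [AddCommGroup T] [Module (Lam G) T]
    (h : ∀ t : T, rey (MvPolynomial (Fin n) K) G t = 0) : NoInv G T := fun t ht => by
  rw [← rey_of_inv t ht, h]

lemma noInv_inj {T U : Type} [AddCommGroup T] [Module (Lam G) T] [AddCommGroup U] [Module (Lam G) U]
    (f : T →ₗ[Lam G] U) (hf : Function.Injective f) (h : NoInv G U) : NoInv G T := fun t ht =>
  hf (by rw [map_zero]; exact h _ fun g => by rw [← map_smul, ht g])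

lemma noInv_surj {T U : Type} [AddCommGroup T] [Module (Lam G) T] [AddCommGroup U] [Module (Lam G) U]
    (f : T →ₗ[Lam G] U) (hf : Function.Surjective f) (h : NoInv G T) : NoInv G U :=
  noInv_of_rey G fun u => by
    obtain ⟨t, rfl⟩ := hf u
    rw [← map_rey, noInv_rey G h, map_zero]

instance : Module.Finite (invRSL K n G) (Lam G) := Module.Finite.trans (MvPolynomial (Fin n) K) _

lemma algR_smul (r : invRSL K n G) (s : MvPolynomial (Fin n) K) :
    algebraMap (invRSL K n G) (Lam G) r • s = r • s := by
  rw [algMap_eq, lamS_sg, Algebra.smul_def]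

theorem EV_noInv (hn : 0 < n) (T : Type) [AddCommGroup T] [Module (Lam G) T] [Module.Finite (Lam G) T]
    (hT : NoInv G T) (j : ℕ) : EV (Lam G) T (MvPolynomial (Fin n) K) j := by
  refine devissage (A := Lam G) (R := invRSL K n G) (Z := MvPolynomial (Fin n) K) ?_
    (fun T _ _ => NoInv G T) ?_ ?_ ?_ T hT j
  · intro m H _ _ f hf h
    let f' : H →ₗ[invRSL K n G] (Fin m → MvPolynomial (Fin n) K) :=
      { toFun := f
        map_add' := f.map_add
        map_smul' := fun r x => by
          rw [h]; funext i; exact algR_smul G r _ }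
    exact Module.Finite.of_injective f' hf
  · intro T _ _ h U
    exact noInv_inj G U.subtype Subtype.val_injective h
  · intro T _ _ h U
    exact noInv_surj G U.mkQ U.mkQ_surjective h
  · intro I hI T _ _ _ hT hk j
    letI : Module K T := Module.compHom T (algebraMap K (Lam G))
    haveI : IsScalarTower K (Lam G) T := ⟨fun a b c => by rw [Algebra.smul_def, mul_smul]; rfl⟩
    letI : Module (invRSL K n G) T := Module.compHom T (algebraMap (invRSL K n G) (Lam G))
    haveI : IsScalarTower (invRSL K n G) (Lam G) T := ⟨fun a b c => by
      rw [show a • b = algebraMap (invRSL K n G) (Lam G) a * b from Algebra.smul_def a b, mul_smul]; rfl⟩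
    haveI : Module.Finite (invRSL K n G) T := Module.Finite.trans (Lam G) T
    haveI : IsScalarTower K (invRSL K n G) T := ⟨fun a b c => by
      rw [Algebra.smul_def]
      change algebraMap (invRSL K n G) (Lam G) _ • c = algebraMap K (Lam G) a • algebraMap (invRSL K n G) (Lam G) b • c
      rw [_root_.map_mul, mul_smul]
      rfl⟩
    haveI : Module.Finite K T := fin_of_killed (K := K) I hI T fun r hr t => hk r hr t
    exact EV_fd G hn hT j

end vanish
end Inv17

-- part 14
namespace Inv17

section assemble
variable {R : Type} [CommRing R] (S : Type) [AddCommGroup S] [Module R S]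

variable (R) in
/-- `Y` is a retract of a finite power of `S` -/
def Retr (m : ℕ) (Y : Type) [AddCommGroup Y] [Module R Y] : Prop :=
  ∃ (i : Y →ₗ[R] (Fin m → S)) (r : (Fin m → S) →ₗ[R] Y), r ∘ₗ i = LinearMap.id

variable (R) in
/-- inductive form of an `S`-proper resolution by retracts of powers of `S` -/
def Res : ℕ → ∀ (Y : Type) [AddCommGroup Y] [Module R Y], Prop
  | 0, Y, _, _ => ∃ m, Retr R S m Y
  | p + 1, Y, _, _ => ∃ (m : ℕ) (f : (Fin m → S) →ₗ[R] Y), Function.Surjective f ∧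
      (∀ φ : S →ₗ[R] Y, ∃ ψ : S →ₗ[R] (Fin m → S), f ∘ₗ ψ = φ) ∧ Res p (LinearMap.ker f)

variable (R) in
/-- the explicit form -/
def Fnl (N p : ℕ) (Y : Type) [AddCommGroup Y] [Module R Y] : Prop :=
  ∃ (C : ℕ → Submodule R (Fin N → S))
      (f : ∀ n : ℕ, ↥(C (n + 1)) →ₗ[R] ↥(C n))
      (g : ↥(C 0) →ₗ[R] Y),
      (∀ n : ℕ, p < n → C n = ⊥) ∧
      (∀ n : ℕ, ∃ D, IsCompl (C n) D) ∧
      Function.Surjective g ∧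
      Function.Exact (f 0) g ∧
      (∀ n : ℕ, Function.Exact (f (n + 1)) (f n)) ∧
      (∀ φ : S →ₗ[R] Y, ∃ ψ : S →ₗ[R] ↥(C 0), g.comp ψ = φ) ∧
      (∀ φ : S →ₗ[R] ↥(C 0), g.comp φ = 0 → ∃ ψ : S →ₗ[R] ↥(C 1), (f 0).comp ψ = φ) ∧
      (∀ (n : ℕ) (φ : S →ₗ[R] ↥(C (n + 1))), (f n).comp φ = 0 →
        ∃ ψ : S →ₗ[R] ↥(C (n + 1 + 1)), (f (n + 1)).comp ψ = φ)

variable {S}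

lemma retr_mono {m N : ℕ} (h : m ≤ N) {Y : Type} [AddCommGroup Y] [Module R Y] (hY : Retr R S m Y) :
    Retr R S N Y := by
  obtain ⟨i, r, hr⟩ := hY
  let e : (Fin m → S) →ₗ[R] (Fin N → S) :=
    { toFun := fun v j => if hj : j.1 < m then v ⟨j, hj⟩ else 0
      map_add' := fun a b => by funext j; by_cases hj : j.1 < m <;> simp [hj]
      map_smul' := fun a b => by funext j; by_cases hj : j.1 < m <;> simp [hj] }
  let q : (Fin N → S) →ₗ[R] (Fin m → S) := LinearMap.funLeft R S (Fin.castLE h)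
  refine ⟨e ∘ₗ i, r ∘ₗ q, ?_⟩
  refine LinearMap.ext fun y => ?_
  have : q (e (i y)) = i y := by
    funext j
    simp [q, e, LinearMap.funLeft_apply]
  change r (q (e (i y))) = y
  rw [this]
  exact LinearMap.congr_fun hr y

lemma retr_sub {N : ℕ} {Y : Type} [AddCommGroup Y] [Module R Y] (hY : Retr R S N Y) :
    ∃ C : Submodule R (Fin N → S), (∃ D, IsCompl C D) ∧ Nonempty (C ≃ₗ[R] Y) := by
  obtain ⟨i, r, hr⟩ := hY
  have hi : ∀ y, r (i y) = y := LinearMap.congr_fun hr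
  have hinj : Function.Injective i := Function.LeftInverse.injective hi
  refine ⟨LinearMap.range i, ⟨LinearMap.ker r, ?_⟩, ⟨(LinearEquiv.ofInjective i hinj).symm⟩⟩
  constructor
  · rw [Submodule.disjoint_def]
    rintro _ ⟨y, rfl⟩ h
    rw [LinearMap.mem_ker, hi] at h
    rw [h, map_zero]
  · rw [codisjoint_iff, Submodule.eq_top_iff']
    intro v
    rw [← sub_add_cancel v (i (r v)), add_comm]
    refine Submodule.add_mem_sup ⟨_, rfl⟩ ?_
    rw [LinearMap.mem_ker, map_sub, hi, sub_self]

/-- prepend a term -/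
def consC {N : ℕ} (C0 : Submodule R (Fin N → S)) (C : ℕ → Submodule R (Fin N → S)) :
    ℕ → Submodule R (Fin N → S)
  | 0 => C0
  | n + 1 => C n

/-- prepend a map -/
def consF {N : ℕ} (C0 : Submodule R (Fin N → S)) (C : ℕ → Submodule R (Fin N → S))
    (f0 : C 0 →ₗ[R] C0) (f : ∀ n : ℕ, ↥(C (n + 1)) →ₗ[R] ↥(C n)) :
    ∀ n : ℕ, ↥(consC C0 C (n + 1)) →ₗ[R] ↥(consC C0 C n)
  | 0 => f0
  | n + 1 => f n

theorem res_fnl (p : ℕ) : ∀ (Y : Type) [AddCommGroup Y] [Module R Y], Res R S p Y →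
    ∃ N₀, ∀ N, N₀ ≤ N → Fnl R S N p Y := by
  induction p with
  | zero =>
    rintro Y _ _ ⟨m, hm⟩
    refine ⟨m, fun N hN => ?_⟩
    obtain ⟨C, hC, ⟨e⟩⟩ := retr_sub (retr_mono hN hm)
    refine ⟨fun n => Nat.casesOn n C (fun _ => ⊥), fun n => 0, e.toLinearMap, ?_, ?_, e.surjective, ?_, ?_, ?_, ?_, ?_⟩
    · intro n hn
      cases n with
      | zero => omega
      | succ n => rfl
    · intro n
      cases n with
      | zero => exact hC
      | succ n => exact ⟨⊤, isCompl_bot_top⟩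
    · intro y
      constructor
      · intro h
        exact ⟨0, by rw [map_zero]; exact (e.map_eq_zero_iff.1 h).symm⟩
      · rintro ⟨z, rfl⟩
        simp
    · intro n y
      refine ⟨fun _ => ⟨0, ?_⟩, fun _ => rfl⟩
      rw [map_zero]
      exact Subsingleton.elim (α := (⊥ : Submodule R (Fin N → S))) _ _
    · intro φ
      exact ⟨e.symm.toLinearMap ∘ₗ φ, by ext x; simp⟩
    · intro φ hφ
      refine ⟨0, ?_⟩
      ext1 x
      have := LinearMap.congr_fun hφ x
      exact (e.map_eq_zero_iff.1 this).symm
    · intro n φ hφ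
      refine ⟨0, ?_⟩
      ext1 x
      exact Subsingleton.elim (α := (⊥ : Submodule R (Fin N → S))) _ _
  | succ p ih =>
    rintro Y _ _ ⟨m, F, hF, hl, hres⟩
    obtain ⟨N₀, hN₀⟩ := ih _ hres
    refine ⟨max m N₀, fun N hN => ?_⟩
    obtain ⟨C, f, g, h1, h2, h3, h4, h5, h6, h7, h8⟩ := hN₀ N (le_trans (le_max_right _ _) hN)
    obtain ⟨C0, hC0, ⟨e⟩⟩ := retr_sub (retr_mono (S := S) (le_trans (le_max_left m N₀) hN)
      (⟨LinearMap.id, LinearMap.id, rfl⟩ : Retr R S m (Fin m → S)))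
    let f0 : C 0 →ₗ[R] C0 := e.symm.toLinearMap ∘ₗ (LinearMap.ker F).subtype ∘ₗ g
    let f' : ∀ n : ℕ, ↥(consC C0 C (n + 1)) →ₗ[R] ↥(consC C0 C n) := consF C0 C f0 f
    have hf0 : ∀ x, f0 x = 0 ↔ g x = 0 := fun x => by
      simp [f0]
    refine ⟨consC C0 C, f', F ∘ₗ e.toLinearMap, ?_, ?_, hF.comp e.surjective, ?_, ?_, ?_, ?_, ?_⟩
    · intro n hn
      cases n with
      | zero => omega
      | succ n => exact h1 n (by omega)
    · intro n
      cases n with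
      | zero => exact hC0
      | succ n => exact h2 n
    · intro y
      constructor
      · intro h
        obtain ⟨x, hx⟩ := h3 ⟨e y, h⟩
        refine ⟨x, ?_⟩
        change e.symm (g x).1 = y
        rw [hx]; exact e.symm_apply_apply y
      · rintro ⟨x, rfl⟩
        change F (e (e.symm (g x).1)) = 0
        rw [e.apply_symm_apply]
        exact (g x).2
    · intro n
      cases n with
      | zero =>
        intro y
        exact (hf0 y).trans (h4 y)
      | succ n => exact h5 n
    · intro φ
      obtain ⟨ψ, hψ⟩ := hl φ
      refine ⟨e.symm.toLinearMap ∘ₗ ψ, ?_⟩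
      rw [← hψ]
      refine LinearMap.ext fun x => ?_
      change F (e (e.symm (ψ x))) = F (ψ x)
      rw [e.apply_symm_apply]
    · intro φ hφ
      obtain ⟨ψ, hψ⟩ := h6 ((e.toLinearMap ∘ₗ φ).codRestrict (LinearMap.ker F)
        fun x => LinearMap.congr_fun hφ x)
      refine ⟨ψ, ?_⟩
      refine LinearMap.ext fun x => ?_
      change e.symm (g (ψ x)).1 = φ x
      have := congrArg Subtype.val (LinearMap.congr_fun hψ x)
      rw [show (g (ψ x)).1 = e (φ x) from this]
      exact e.symm_apply_apply _
    · intro n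
      cases n with
      | zero =>
        intro φ hφ
        refine h7 φ ?_
        refine LinearMap.ext fun x => ?_
        exact (hf0 _).1 (LinearMap.congr_fun hφ x)
      | succ n => exact h8 n

lemma res_congr (p : ℕ) {Y Z : Type} [AddCommGroup Y] [Module R Y] [AddCommGroup Z] [Module R Z]
    (e : Y ≃ₗ[R] Z) (h : Res R S p Y) : Res R S p Z := by
  cases p with
  | zero =>
    obtain ⟨m, i, r, hr⟩ := h
    refine ⟨m, i ∘ₗ e.symm.toLinearMap, e.toLinearMap ∘ₗ r, ?_⟩
    refine LinearMap.ext fun x => ?_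
    change e (r (i (e.symm x))) = x
    rw [show r (i (e.symm x)) = e.symm x from LinearMap.congr_fun hr _, e.apply_symm_apply]
  | succ p =>
    obtain ⟨m, f, hf, hl, hr⟩ := h
    have hk : LinearMap.ker (e.toLinearMap ∘ₗ f) = LinearMap.ker f := LinearEquiv.ker_comp e f
    refine ⟨m, e.toLinearMap ∘ₗ f, e.surjective.comp hf, ?_, ?_⟩
    · intro φ
      obtain ⟨ψ, hψ⟩ := hl (e.symm.toLinearMap ∘ₗ φ)
      refine ⟨ψ, ?_⟩
      rw [LinearMap.comp_assoc, hψ]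
      refine LinearMap.ext fun x => ?_
      exact e.apply_symm_apply _
    · rw [hk]; exact hr

end assemble
end Inv17

-- part 15
namespace Inv17

section eta
open SkewMonoidAlgebra
variable (R S G : Type) [CommRing R] [CommRing S] [Group G] [MulSemiringAction G S]
  [Algebra R S] [SMulCommClass G R S]
variable {M N : Type} [AddCommGroup M] [AddCommGroup N] [Module (SkewMonoidAlgebra S G) M]
  [Module (SkewMonoidAlgebra S G) N] [Module R M] [Module R N]
  [IsScalarTower R (SkewMonoidAlgebra S G) M] [IsScalarTower R (SkewMonoidAlgebra S G) N]

lemma lam_smul_comm (l : SkewMonoidAlgebra S G) (r : R) (x : M) : l • r • x = r • l • x := by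
  rw [← algebraMap_smul (SkewMonoidAlgebra S G) r x, ← algebraMap_smul (SkewMonoidAlgebra S G) r (l • x),
    smul_smul, smul_smul, Algebra.commutes]

variable (M) in
/-- invariants -/
def invs : Submodule R M where
  carrier := {x | ∀ g : G, (gm g : SkewMonoidAlgebra S G) • x = x}
  zero_mem' := by simp
  add_mem' := by intro a b ha hb g; rw [smul_add, ha g, hb g]
  smul_mem' := by intro r a ha g; rw [lam_smul_comm, ha g]

lemma mem_invs (x : M) : x ∈ invs R S G M ↔ ∀ g : G, (gm g : SkewMonoidAlgebra S G) • x = x := Iff.rfl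

/-- induced map on invariants -/
def invsMap (f : M →ₗ[SkewMonoidAlgebra S G] N) : invs R S G M →ₗ[R] invs R S G N where
  toFun x := ⟨f x, fun g => by rw [← map_smul, x.2 g]⟩
  map_add' a b := by ext; simp
  map_smul' r a := by
    ext
    change f (r • a.1) = r • f a.1
    rw [← algebraMap_smul (SkewMonoidAlgebra S G) r a.1, map_smul, algebraMap_smul]

@[simp] lemma invsMap_coe (f : M →ₗ[SkewMonoidAlgebra S G] N) (x : invs R S G M) :
    (invsMap R S G f x : N) = f x := rfl

variable [Fintype G] [Invertible (Fintype.card G : S)]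

/-- the map eta -/
def eta (x : M) : S →ₗ[R] invs R S G M where
  toFun s := ⟨rey S G ((sg s : SkewMonoidAlgebra S G) • x), fun g => gm_rey g _⟩
  map_add' a b := by
    ext
    change rey S G _ = rey S G _ + rey S G _
    rw [map_add, add_smul, rey_add]
  map_smul' r a := by
    ext
    change rey S G ((sg (r • a) : SkewMonoidAlgebra S G) • x) = r • rey S G _
    have : (sg (r • a) : SkewMonoidAlgebra S G) = algebraMap R _ r * sg a := by
      rw [Algebra.smul_def, map_mul, algMap_eq]
    rw [this, mul_smul, algebraMap_smul]
    simp only [rey, lam_smul_comm, ← Finset.smul_sum]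

@[simp] lemma eta_coe (x : M) (s : S) :
    (eta R S G x s : M) = rey S G ((sg s : SkewMonoidAlgebra S G) • x) := rfl

lemma eta_map (f : M →ₗ[SkewMonoidAlgebra S G] N) (x : M) :
    invsMap R S G f ∘ₗ eta R S G x = eta R S G (f x) := by
  refine LinearMap.ext fun s => Subtype.ext ?_
  change f (rey S G _) = rey S G _
  rw [map_rey, map_smul]

variable (M) in
def EtaI : Prop := ∀ x : M, eta R S G x = 0 → x = 0

variable (M) in
def EtaS : Prop := ∀ φ : S →ₗ[R] invs R S G M, ∃ x : M, eta R S G x = φ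

variable {R S G}

lemma etaI_inj (f : M →ₗ[SkewMonoidAlgebra S G] N) (hf : Function.Injective f) (h : EtaI R S G N) :
    EtaI R S G M := fun x hx => hf (by
  rw [map_zero]; apply h; rw [← eta_map, hx, LinearMap.comp_zero])

lemma etaS_retr (i : M →ₗ[SkewMonoidAlgebra S G] N) (r : N →ₗ[SkewMonoidAlgebra S G] M)
    (hr : ∀ x, r (i x) = x) (h : EtaS R S G N) : EtaS R S G M := fun φ => by
  obtain ⟨y, hy⟩ := h (invsMap R S G i ∘ₗ φ)
  refine ⟨r y, ?_⟩
  rw [← eta_map, hy]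
  refine LinearMap.ext fun s => Subtype.ext ?_
  exact hr _

lemma etaS_ker (f : M →ₗ[SkewMonoidAlgebra S G] N) (hM : EtaS R S G M) (hN : EtaI R S G N) :
    EtaS R S G (LinearMap.ker f) := fun φ => by
  obtain ⟨y, hy⟩ := hM (invsMap R S G (LinearMap.ker f).subtype ∘ₗ φ)
  have h0 : f y = 0 := by
    apply hN
    rw [← eta_map, hy]
    refine LinearMap.ext fun s => Subtype.ext ?_
    exact (φ s).1.2
  refine ⟨⟨y, h0⟩, ?_⟩
  refine LinearMap.ext fun s => Subtype.ext (Subtype.ext ?_)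
  have := eta_map R S G (LinearMap.ker f).subtype ⟨y, h0⟩
  have h2 := congrArg Subtype.val (LinearMap.congr_fun (this.trans hy) s)
  exact h2

lemma etaI_pi {ι : Type} (h : EtaI R S G M) : EtaI R S G (ι → M) := fun x hx => by
  funext i
  apply h
  have := eta_map R S G (LinearMap.proj (R := SkewMonoidAlgebra S G) (φ := fun _ : ι => M) i) x
  rw [hx, LinearMap.comp_zero] at this
  exact this.symm

lemma etaS_pi {ι : Type} (h : EtaS R S G M) : EtaS R S G (ι → M) := fun φ => by
  choose x hx using fun i => h (invsMap R S G (LinearMap.proj (R := SkewMonoidAlgebra S G)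
    (φ := fun _ : ι => M) i) ∘ₗ φ)
  refine ⟨x, ?_⟩
  refine LinearMap.ext fun s => Subtype.ext ?_
  funext i
  have := eta_map R S G (LinearMap.proj (R := SkewMonoidAlgebra S G) (φ := fun _ : ι => M) i) x
  have h2 := LinearMap.congr_fun (this.trans (hx i)) s
  exact congrArg Subtype.val h2

lemma coeff_gm (g h : G) (y : SkewMonoidAlgebra S G) :
    ((gm g : SkewMonoidAlgebra S G) * y).coeff h = g • y.coeff (g⁻¹ * h) := by
  classical
  induction y using SkewMonoidAlgebra.induction_on with
  | zero => simp
  | single a s =>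
    rw [gm, single_mul_single, one_mul, coeff_single_apply, coeff_single_apply]
    simp only [eq_inv_mul_iff_mul_eq]
    split_ifs <;> simp
  | add a b ha hb => rw [mul_add, SkewMonoidAlgebra.coeff_add, SkewMonoidAlgebra.coeff_add, Finsupp.add_apply, Finsupp.add_apply, ha, hb, smul_add]

lemma coeff_sg (s : S) (h : G) (y : SkewMonoidAlgebra S G) :
    ((sg s : SkewMonoidAlgebra S G) * y).coeff h = s * y.coeff h := by
  rw [← smul_eq_sg, SkewMonoidAlgebra.coeff_smul]; rfl

lemma coeff_sum' (f : G → SkewMonoidAlgebra S G) (h : G) : (∑ g, f g).coeff h = ∑ g, (f g).coeff h := by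
  classical
  induction (Finset.univ : Finset G) using Finset.induction_on with
  | empty => simp
  | insert a t ha ih => rw [Finset.sum_insert ha, Finset.sum_insert ha, SkewMonoidAlgebra.coeff_add, Finsupp.add_apply, ih]

lemma coeff_rey (s : S) (x : SkewMonoidAlgebra S G) :
    (rey S G ((sg s : SkewMonoidAlgebra S G) • x)).coeff 1 =
      ∑ g : G, (⅟(Fintype.card G : S) * g • x.coeff g⁻¹) * g • s := by
  simp only [rey, smul_eq_mul, cinv]
  rw [coeff_sg, coeff_sum', Finset.mul_sum]
  refine Finset.sum_congr rfl fun g _ => ?_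
  rw [coeff_gm, coeff_sg, mul_one, smul_mul']
  ring

lemma invs_ext {x y : SkewMonoidAlgebra S G} (hx : x ∈ invs R S G (SkewMonoidAlgebra S G))
    (hy : y ∈ invs R S G (SkewMonoidAlgebra S G)) (h : x.coeff 1 = y.coeff 1) : x = y := by
  refine SkewMonoidAlgebra.ext fun g => ?_
  rw [← hx g, ← hy g, smul_eq_mul, smul_eq_mul, coeff_gm, coeff_gm, inv_mul_cancel, h]

variable (R S G) in
/-- invariants of the skew group ring -/
def invsLam : invs R S G (SkewMonoidAlgebra S G) ≃ₗ[R] S where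
  toFun x := x.1.coeff 1
  map_add' a b := by simp
  map_smul' r a := by
    simp
  invFun s := ⟨∑ g : G, single g (g • s), fun h => by
    rw [smul_eq_mul, Finset.mul_sum]
    refine Fintype.sum_equiv (Equiv.mulLeft h) _ _ fun g => ?_
    simp [gm, single_mul_single, mul_smul]⟩
  left_inv x := Subtype.ext (invs_ext (R := R) (Subtype.prop _) x.2 (by
    classical
    change (∑ g : G, single g (g • x.1.coeff 1)).coeff 1 = _
    rw [coeff_sum', Finset.sum_eq_single 1]
    · simp
    · intro b _ hb; rw [coeff_single_apply, if_neg hb]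
    · simp))
  right_inv s := by
    classical
    change (∑ g : G, single g (g • s)).coeff 1 = _
    rw [coeff_sum', Finset.sum_eq_single 1]
    · simp
    · intro b _ hb; rw [coeff_single_apply, if_neg hb]
    · simp

variable (R S G) in
/-- invariants of powers of the skew group ring -/
def invsPow (m : ℕ) : invs R S G (Fin m → SkewMonoidAlgebra S G) ≃ₗ[R] (Fin m → S) where
  toFun x i := invsLam R S G ⟨x.1 i, fun g => congrFun (x.2 g) i⟩
  map_add' a b := by funext i; exact (invsLam R S G).map_add ⟨a.1 i, fun g => congrFun (a.2 g) i⟩ ⟨b.1 i, fun g => congrFun (b.2 g) i⟩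
  map_smul' r a := by funext i; exact (invsLam R S G).map_smul r ⟨a.1 i, fun g => congrFun (a.2 g) i⟩
  invFun v := ⟨fun i => (invsLam R S G).symm (v i), fun g => funext fun i => ((invsLam R S G).symm (v i)).2 g⟩
  left_inv x := Subtype.ext (funext fun i => by
    change ((invsLam R S G).symm (invsLam R S G ⟨x.1 i, fun g => congrFun (x.2 g) i⟩)).1 = x.1 i
    rw [LinearEquiv.symm_apply_apply])
  right_inv v := funext fun i => (invsLam R S G).apply_symm_apply (v i)

variable [IsDomain S] [UniqueFactorizationMonoid S] [Algebra.IsInvariant R S G] (hc : Codim2 S G)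

lemma etaI_lam (hc : Codim2 S G) : EtaI R S G (SkewMonoidAlgebra S G) := fun x hx => by
  have h := indep hc (fun g => ⅟(Fintype.card G : S) * g • x.coeff g⁻¹) (fun s => by
    rw [← coeff_rey]
    have := congrArg Subtype.val (LinearMap.congr_fun hx s)
    rw [eta_coe] at this
    rw [this]; rfl)
  refine SkewMonoidAlgebra.ext fun g => ?_
  have := congrFun h g⁻¹
  simp only [Pi.zero_apply, inv_inv] at this
  have h2 : (Fintype.card G : S) * (⅟(Fintype.card G : S) * g⁻¹ • x.coeff g) = 0 := by rw [this, mul_zero]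
  rw [← mul_assoc, mul_invOf_self, one_mul] at h2
  have h3 : g • g⁻¹ • x.coeff g = 0 := by rw [h2, smul_zero]
  rw [smul_inv_smul] at h3
  rw [h3]; rfl

lemma etaS_lam (hc : Codim2 S G) : EtaS R S G (SkewMonoidAlgebra S G) := fun φ => by
  obtain ⟨b, hb⟩ := auslander (R := R) hc ((invsLam R S G).toLinearMap ∘ₗ φ)
  refine ⟨⟨Finsupp.equivFunOnFinite.symm fun h => (Fintype.card G : S) * h • b h⁻¹⟩, ?_⟩
  refine LinearMap.ext fun s => Subtype.ext (invs_ext (R := R) (Subtype.prop _) (φ s).2 ?_)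
  rw [eta_coe, coeff_rey]
  refine Eq.trans ?_ (hb s).symm
  refine Finset.sum_congr rfl fun g _ => ?_
  congr 1
  simp only [Finsupp.equivFunOnFinite_symm_apply_apply, inv_inv, smul_mul', smul_inv_smul]
  have : g • (Fintype.card G : S) = (Fintype.card G : S) := map_natCast (MulSemiringAction.toRingHom G S g) _
  rw [this, ← mul_assoc, invOf_mul_self, one_mul]

lemma etaI_proj (hc : Codim2 S G) [Module.Finite (SkewMonoidAlgebra S G) M] [Module.Projective (SkewMonoidAlgebra S G) M] :
    EtaI R S G M ∧ EtaS R S G M := by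
  obtain ⟨m, f, hf⟩ := Module.Finite.exists_fin' (SkewMonoidAlgebra S G) M
  obtain ⟨i, hi⟩ := Module.projective_lifting_property f LinearMap.id hf
  have hi' : ∀ x, f (i x) = x := LinearMap.congr_fun hi
  exact ⟨etaI_inj i (Function.LeftInverse.injective hi') (etaI_pi (etaI_lam hc)),
    etaS_retr i f hi' (etaS_pi (etaS_lam hc))⟩

open CategoryTheory in
theorem res_main (hc : Codim2 S G) [IsNoetherianRing (SkewMonoidAlgebra S G)] (p : ℕ) :
    ∀ (N : Type) [AddCommGroup N] [Module (SkewMonoidAlgebra S G) N] [Module R N]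
      [IsScalarTower R (SkewMonoidAlgebra S G) N] [Module.Finite (SkewMonoidAlgebra S G) N],
      EtaI R S G N → EtaS R S G N → PD (SkewMonoidAlgebra S G) N (p + 1) → Res R S p (invs R S G N) := by
  induction p with
  | zero =>
    intro N _ _ _ _ _ hI hS hp
    have hproj : Module.Projective (SkewMonoidAlgebra S G) N := by
      have h1 : HasProjectiveDimensionLT (ModuleCat.of (SkewMonoidAlgebra S G) N) 1 := hp
      have : Projective (ModuleCat.of (SkewMonoidAlgebra S G) N) := by
        rwa [projective_iff_hasProjectiveDimensionLT_one]
      exact (IsProjective.iff_projective _).2 this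
    obtain ⟨m, f, hf⟩ := Module.Finite.exists_fin' (SkewMonoidAlgebra S G) N
    obtain ⟨i, hi⟩ := Module.projective_lifting_property f LinearMap.id hf
    have hi' : ∀ x, f (i x) = x := LinearMap.congr_fun hi
    refine ⟨m, (invsPow R S G m).toLinearMap ∘ₗ invsMap R S G i, invsMap R S G f ∘ₗ (invsPow R S G m).symm.toLinearMap, ?_⟩
    refine LinearMap.ext fun x => Subtype.ext ?_
    change f ((invsPow R S G m).symm (invsPow R S G m (invsMap R S G i x))).1 = x
    rw [LinearEquiv.symm_apply_apply]
    exact hi' x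
  | succ p ih =>
    intro N _ _ _ _ _ hI hS hp
    obtain ⟨m, f, hf⟩ := Module.Finite.exists_fin' (SkewMonoidAlgebra S G) N
    have hker : PD (SkewMonoidAlgebra S G) (LinearMap.ker f) (p + 1) := by
      have he : Function.Exact (LinearMap.ker f).subtype f := by intro y; simp
      have : Projective (ModuleCat.of (SkewMonoidAlgebra S G) (Fin m → SkewMonoidAlgebra S G)) :=
        (IsProjective.iff_projective _).1 inferInstance
      exact (sc_exact Subtype.val_injective he hf).hasProjectiveDimensionLT_X₁ (p + 1)
        (hasProjectiveDimensionLT_of_ge _ 1 _ (by omega)) hp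
    have hr := ih (LinearMap.ker f)
      (etaI_inj (LinearMap.ker f).subtype Subtype.val_injective (etaI_pi (etaI_lam hc)))
      (etaS_ker f (etaS_pi (etaS_lam hc)) hI) hker
    let F : (Fin m → S) →ₗ[R] invs R S G N := invsMap R S G f ∘ₗ (invsPow R S G m).symm.toLinearMap
    have hF : ∀ y, F (invsPow R S G m y) = invsMap R S G f y := fun y => by
      change invsMap R S G f ((invsPow R S G m).symm _) = _
      rw [LinearEquiv.symm_apply_apply]
    refine ⟨m, F, ?_, ?_, ?_⟩
    · intro y
      obtain ⟨x, hx⟩ := hf y.1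
      refine ⟨invsPow R S G m ⟨rey S G x, fun g => gm_rey g x⟩, ?_⟩
      rw [hF]
      refine Subtype.ext ?_
      change f (rey S G x) = y.1
      rw [map_rey, hx, rey_of_inv _ y.2]
    · intro φ
      obtain ⟨y, hy⟩ := hS φ
      obtain ⟨x, rfl⟩ := hf y
      refine ⟨(invsPow R S G m).toLinearMap ∘ₗ eta R S G x, ?_⟩
      rw [← hy, ← eta_map]
      refine LinearMap.ext fun s => ?_
      exact hF _
    · let e : invs R S G (LinearMap.ker f) →ₗ[R] LinearMap.ker F :=
        ((invsPow R S G m).toLinearMap ∘ₗ invsMap R S G (LinearMap.ker f).subtype).codRestrict _ (fun x => by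
          rw [LinearMap.mem_ker]
          change F (invsPow R S G m _) = 0
          rw [hF]
          exact Subtype.ext x.1.2)
      refine res_congr p (LinearEquiv.ofBijective e ⟨?_, ?_⟩) hr
      · intro a b hab
        have h1 := (invsPow R S G m).injective (congrArg Subtype.val hab)
        have h2 := congrArg Subtype.val h1
        exact Subtype.ext (Subtype.ext h2)
      · rintro ⟨v, hv⟩
        obtain ⟨y, rfl⟩ := (invsPow R S G m).surjective v
        rw [LinearMap.mem_ker, hF] at hv
        refine ⟨⟨⟨y.1, congrArg Subtype.val hv⟩, fun g => Subtype.ext (y.2 g)⟩, ?_⟩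
        exact Subtype.ext rfl

end eta
end Inv17

-- part 16
namespace Inv17

section tens
open SkewMonoidAlgebra TensorProduct
variable (R S G : Type) [CommRing R] [CommRing S] [Group G] [MulSemiringAction G S]
  [Algebra R S] [SMulCommClass G R S]

/-- `S` as a module over the skew group ring -/
@[reducible] def lamSg : Module (SkewMonoidAlgebra S G) S := skewModule (fun g s m => smul_mul' g s m)

attribute [local instance] lamSg

lemma lamSg_sg (s t : S) : (sg s : SkewMonoidAlgebra S G) • t = s * t :=
  skewModule_sg (S := S) (G := G) (fun g s m => smul_mul' g s m) s t
lemma lamSg_gm (g : G) (t : S) : (gm g : SkewMonoidAlgebra S G) • t = g • t :=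
  skewModule_gm (S := S) (G := G) (fun g s m => smul_mul' g s m) g t

/-- the group acting on the left factor -/
def gTen (W : Type) [AddCommGroup W] [Module R W] (g : G) : S ⊗[R] W →ₗ[R] S ⊗[R] W :=
  LinearMap.rTensor W (MulSemiringAction.toAlgHom R S g).toLinearMap

lemma gTen_tmul {W : Type} [AddCommGroup W] [Module R W] (g : G) (s : S) (w : W) :
    gTen R S G W g (s ⊗ₜ w) = (g • s) ⊗ₜ w := rfl

/-- the group acting on the left factor -/
@[reducible] def actTen (W : Type) [AddCommGroup W] [Module R W] : DistribMulAction G (S ⊗[R] W) where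
  smul g t := gTen R S G W g t
  one_smul t := by
    change gTen R S G W 1 t = t
    induction t with
    | zero => simp
    | tmul s w => rw [gTen_tmul, one_smul]
    | add a b ha hb => rw [map_add, ha, hb]
  mul_smul g h t := by
    change gTen R S G W (g * h) t = gTen R S G W g (gTen R S G W h t)
    induction t with
    | zero => simp
    | tmul s w => rw [gTen_tmul, gTen_tmul, gTen_tmul, mul_smul]
    | add a b ha hb => rw [map_add, map_add, map_add, ha, hb]
  smul_zero g := map_zero (gTen R S G W g)
  smul_add g := map_add (gTen R S G W g)

attribute [local instance] actTen

lemma ten_semi (W : Type) [AddCommGroup W] [Module R W] (g : G) (s : S) (t : S ⊗[R] W) :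
    g • s • t = (g • s) • g • t := by
  change gTen R S G W g (s • t) = (g • s) • gTen R S G W g t
  induction t with
  | zero => simp
  | tmul a w => rw [smul_tmul', gTen_tmul, gTen_tmul, smul_tmul', smul_eq_mul, smul_mul', smul_eq_mul]
  | add a b ha hb => rw [smul_add, map_add, map_add, smul_add, ha, hb]

/-- `S ⊗ W` as a module over the skew group ring -/
@[reducible] def lamTen (W : Type) [AddCommGroup W] [Module R W] : Module (SkewMonoidAlgebra S G) (S ⊗[R] W) :=
  skewModule (ten_semi R S G W)

attribute [local instance] lamTen

variable {W W₁ W₂ W₃ : Type} [AddCommGroup W] [Module R W] [AddCommGroup W₁] [Module R W₁]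
  [AddCommGroup W₂] [Module R W₂] [AddCommGroup W₃] [Module R W₃]

lemma ten_sg (s : S) (t : S ⊗[R] W) : (sg s : SkewMonoidAlgebra S G) • t = s • t :=
  skewModule_sg (ten_semi R S G W) s t
lemma ten_gm (g : G) (t : S ⊗[R] W) : (gm g : SkewMonoidAlgebra S G) • t = gTen R S G W g t :=
  skewModule_gm (ten_semi R S G W) g t

lemma ten_tower : IsScalarTower S (SkewMonoidAlgebra S G) (S ⊗[R] W) := tower_of_sg (ten_sg R S G)

/-- functoriality -/
def tmap (f : W₁ →ₗ[R] W₂) : S ⊗[R] W₁ →ₗ[SkewMonoidAlgebra S G] S ⊗[R] W₂ :=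
  mkLin (f.baseChange S).toAddMonoidHom
    (fun s m => by
      rw [ten_sg, ten_sg]; exact (f.baseChange S).map_smul s m)
    (fun g m => by
      rw [ten_gm, ten_gm]
      change f.baseChange S _ = gTen R S G W₂ g (f.baseChange S m)
      induction m with
      | zero => simp
      | tmul a w => rw [gTen_tmul, LinearMap.baseChange_tmul, LinearMap.baseChange_tmul, gTen_tmul]
      | add a b ha hb => rw [map_add, map_add, map_add, map_add, ha, hb])

lemma tmap_tmul (f : W₁ →ₗ[R] W₂) (s : S) (w : W₁) : tmap R S G f (s ⊗ₜ w) = s ⊗ₜ f w := rfl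

/-- evaluation of a functional -/
def tfun (l : W →ₗ[R] R) : S ⊗[R] W →ₗ[SkewMonoidAlgebra S G] S :=
  mkLin (TensorProduct.lift (LinearMap.mk₂ R (fun (s : S) (w : W) => l w • s)
      (by intro a b c; rw [smul_add]) (by intro a b c; rw [smul_comm])
      (by intro a b c; rw [map_add, add_smul]) (by intro a b c; rw [map_smul, smul_assoc]))).toAddMonoidHom
    (fun s m => by
      rw [ten_sg, lamSg_sg]
      simp only [LinearMap.toAddMonoidHom_coe]
      induction m with
      | zero => simp
      | tmul a w => 
        rw [smul_tmul', lift.tmul, lift.tmul, LinearMap.mk₂_apply, LinearMap.mk₂_apply, smul_eq_mul, mul_smul_comm]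
      | add a b ha hb => rw [smul_add, map_add, map_add, mul_add, ha, hb])
    (fun g m => by
      rw [ten_gm, lamSg_gm]
      simp only [LinearMap.toAddMonoidHom_coe]
      induction m with
      | zero => simp
      | tmul a w => 
        rw [gTen_tmul, lift.tmul, lift.tmul, LinearMap.mk₂_apply, LinearMap.mk₂_apply, smul_comm g (l w) a]
      | add a b ha hb => rw [map_add, map_add, map_add, smul_add, ha, hb])

lemma tfun_tmul (l : W →ₗ[R] R) (s : S) (w : W) : tfun R S G l (s ⊗ₜ w) = l w • s := rfl

variable [Fintype G] [Invertible (Fintype.card G : S)] [Algebra.IsInvariant R S G]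

lemma ten_rey (t : S ⊗[R] W) : ∃ w : W, rey S G t = 1 ⊗ₜ w := by
  induction t with
  | zero => exact ⟨0, by simp [rey]⟩
  | tmul s w =>
    obtain ⟨r, hr⟩ := Algebra.IsInvariant.isInvariant (A := R) (G := G) (rey S G s) (fun g => by rw [← lamSg_gm, gm_rey])
    refine ⟨r • w, ?_⟩
    rw [← smul_tmul, ← Algebra.algebraMap_eq_smul_one, hr]
    simp only [rey, cinv, ten_sg, ten_gm, gTen_tmul, lamSg_sg, lamSg_gm, ← sum_tmul, smul_tmul', smul_eq_mul]
  | add a b ha hb =>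
    obtain ⟨w, hw⟩ := ha
    obtain ⟨v, hv⟩ := hb
    exact ⟨w + v, by rw [rey_add, hw, hv, tmul_add]⟩

variable [FaithfulSMul R S]

lemma exists_retr : ∃ ρ : S →ₗ[R] R, ρ 1 = 1 ∧ ∀ s, algebraMap R S (ρ s) = rey S G s := by
  have hinj : Function.Injective (Algebra.linearMap R S) := FaithfulSMul.algebraMap_injective R S
  have hr : ∀ s : S, ∃ r : R, algebraMap R S r = rey S G s := fun s =>
    Algebra.IsInvariant.isInvariant (A := R) (G := G) (rey S G s) (fun g => by rw [← lamSg_gm, gm_rey])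
  choose ρ hρ using hr
  have hsm : ∀ (r : R) (s : S), rey S G (r • s) = r • rey S G s := fun r s => by
    simp only [rey, cinv, lamSg_sg, lamSg_gm, smul_comm _ r, ← Finset.smul_sum, mul_smul_comm]
  refine ⟨⟨⟨ρ, fun a b => hinj ?_⟩, fun r a => hinj ?_⟩, hinj ?_, hρ⟩
  · change algebraMap R S _ = algebraMap R S _
    rw [map_add, hρ, hρ, hρ, rey_add]
  · change algebraMap R S _ = algebraMap R S (r * ρ a)
    rw [map_mul, hρ, hρ, hsm, Algebra.smul_def]
  · change algebraMap R S (ρ 1) = algebraMap R S 1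
    rw [hρ, map_one, rey_of_inv]
    intro g
    rw [lamSg_gm, smul_one]

lemma one_tmul_inj (w : W) (h : (1 : S) ⊗ₜ[R] w = 0) (ρ : S →ₗ[R] R) (hρ : ρ 1 = 1) : w = 0 := by
  have := congrArg (fun t => TensorProduct.lid R W (LinearMap.rTensor W ρ t)) h
  simpa [hρ] using this

lemma tmap_ker (f : W₁ →ₗ[R] W₂) (hf : Function.Injective f) (t : LinearMap.ker (tmap R S G f))
    (ht : ∀ g : G, (gm g : SkewMonoidAlgebra S G) • t = t) : t = 0 := by
  obtain ⟨t, h0⟩ := t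
  have h1 : ∀ g : G, (gm g : SkewMonoidAlgebra S G) • t = t := fun g => congrArg Subtype.val (ht g)
  obtain ⟨w, hw⟩ := ten_rey R S G t
  rw [rey_of_inv _ h1] at hw
  subst hw
  rw [LinearMap.mem_ker, tmap_tmul] at h0
  obtain ⟨ρ, hρ, -⟩ := exists_retr R S G
  have := hf ((one_tmul_inj R S _ h0 ρ hρ).trans (map_zero f).symm)
  subst this
  exact Subtype.ext (tmul_zero _ _)

variable [IsNoetherianRing (SkewMonoidAlgebra S G)] [Module.Finite R W₁] [Module.Projective R W₂]
  (hNI : ∀ (T : Type) [AddCommGroup T] [Module (SkewMonoidAlgebra S G) T]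
    [Module.Finite (SkewMonoidAlgebra S G) T],
    (∀ t : T, (∀ g : G, (gm g : SkewMonoidAlgebra S G) • t = t) → t = 0) → ∀ j, EV (SkewMonoidAlgebra S G) T S j)

lemma ten_fin [Module.Finite R W] : Module.Finite (SkewMonoidAlgebra S G) (S ⊗[R] W) := by
  haveI := ten_tower R S G (W := W)
  exact Module.Finite.of_restrictScalars_finite S _ _

lemma ten_proj [Module.Projective R W] : Module.Projective (SkewMonoidAlgebra S G) (S ⊗[R] W) := by
  haveI := ten_tower R S G (W := W)
  exact projective_skew

lemma ten_ses {a : W₁ →ₗ[R] W₂} {b : W₂ →ₗ[R] W₃} (he : Function.Exact a b) (hb : Function.Surjective b) :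
    Function.Exact (LinearMap.range (tmap R S G a)).subtype (tmap R S G b) ∧
      Function.Surjective (tmap R S G b) := by
  have h1 : Function.Exact (tmap R S G a) (tmap R S G b) := lTensor_exact S he hb
  refine ⟨fun y => ?_, LinearMap.lTensor_surjective S hb⟩
  rw [h1 y]; simp

lemma ten_shift {a : W₁ →ₗ[R] W₂} {b : W₂ →ₗ[R] W₃} (ha : Function.Injective a)
    (he : Function.Exact a b) (hb : Function.Surjective b)
    (hNI : ∀ (T : Type) [AddCommGroup T] [Module (SkewMonoidAlgebra S G) T]
    [Module.Finite (SkewMonoidAlgebra S G) T],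
    (∀ t : T, (∀ g : G, (gm g : SkewMonoidAlgebra S G) • t = t) → t = 0) → ∀ j, EV (SkewMonoidAlgebra S G) T S j)
    (j : ℕ)
    (h : EV (SkewMonoidAlgebra S G) (S ⊗[R] W₃) S (j + 1 + 1)) :
    EV (SkewMonoidAlgebra S G) (S ⊗[R] W₁) S (j + 1) := by
  haveI := ten_fin R S G (W := W₁)
  haveI := ten_proj R S G (W := W₂)
  obtain ⟨h1, h2⟩ := ten_ses R S G he hb
  refine EV_mid (f := (LinearMap.ker (tmap R S G a)).subtype) (g := (tmap R S G a).rangeRestrict)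
    Subtype.val_injective (by intro y; rw [Subtype.ext_iff]; simp) (LinearMap.surjective_rangeRestrict _) ?_ ?_
  · exact hNI _ (tmap_ker R S G a ha) _
  · exact EV_left Subtype.val_injective h1 h2 (EV_projective j) h

lemma ten_extend {a : W₁ →ₗ[R] W₂} {b : W₂ →ₗ[R] W₃} (ha : Function.Injective a)
    (he : Function.Exact a b) (hb : Function.Surjective b)
    (hNI : ∀ (T : Type) [AddCommGroup T] [Module (SkewMonoidAlgebra S G) T]
    [Module.Finite (SkewMonoidAlgebra S G) T],
    (∀ t : T, (∀ g : G, (gm g : SkewMonoidAlgebra S G) • t = t) → t = 0) → ∀ j, EV (SkewMonoidAlgebra S G) T S j)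
    (h : EV (SkewMonoidAlgebra S G) (S ⊗[R] W₃) S 1) (l : W₁ →ₗ[R] R) :
    ∃ m : W₂ →ₗ[R] R, m ∘ₗ a = l := by
  haveI := ten_fin R S G (W := W₁)
  obtain ⟨h1, h2⟩ := ten_ses R S G he hb
  have hk : ∀ t ∈ LinearMap.ker (tmap R S G a), tfun R S G l t = 0 := fun t ht => by
    have := (EV_zero_iff.1 (hNI (LinearMap.ker (tmap R S G a)) (tmap_ker R S G a ha) 0))
      (tfun R S G l ∘ₗ (LinearMap.ker (tmap R S G a)).subtype)
    exact LinearMap.congr_fun this ⟨t, ht⟩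
  let q := (LinearMap.ker (tmap R S G a)).liftQ (tfun R S G l) hk
  obtain ⟨ψ, hψ⟩ := EV_extend Subtype.val_injective h1 h2 h
    (q ∘ₗ (tmap R S G a).quotKerEquivRange.symm.toLinearMap)
  have hψ' : ∀ t, ψ (tmap R S G a t) = tfun R S G l t := fun t => by
    have := LinearMap.congr_fun hψ ⟨tmap R S G a t, t, rfl⟩
    refine this.trans ?_
    change q ((tmap R S G a).quotKerEquivRange.symm ⟨tmap R S G a t, t, rfl⟩) = _
    rw [show (⟨tmap R S G a t, t, rfl⟩ : LinearMap.range (tmap R S G a))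
      = (tmap R S G a).quotKerEquivRange (Submodule.Quotient.mk t) from rfl, LinearEquiv.symm_apply_apply]
    rfl
  have hinj := FaithfulSMul.algebraMap_injective R S
  have hr : ∀ w : W₂, ∃ r : R, algebraMap R S r = ψ (1 ⊗ₜ w) := fun w =>
    Algebra.IsInvariant.isInvariant (A := R) (G := G) _ (fun g => by
      rw [← lamSg_gm, ← map_smul, ten_gm, gTen_tmul, smul_one])
  choose μ hμ using hr
  refine ⟨⟨⟨μ, fun x y => hinj ?_⟩, fun r x => hinj ?_⟩, LinearMap.ext fun x => hinj ?_⟩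
  · rw [map_add, hμ, hμ, hμ, tmul_add, map_add]
  · change _ = algebraMap R S (r * μ x)
    rw [map_mul, hμ, hμ, ← lamSg_sg S G, ← map_smul, ten_sg, algebraMap_smul, tmul_smul]
  · change algebraMap R S (μ (a x)) = _
    rw [hμ, ← tmap_tmul R S G, hψ', tfun_tmul, Algebra.algebraMap_eq_smul_one]

end tens
end Inv17

-- part 17
namespace Inv17

section refl
open SkewMonoidAlgebra TensorProduct
variable (R S G : Type) [CommRing R] [CommRing S] [Group G] [MulSemiringAction G S]
  [Algebra R S] [SMulCommClass G R S]

attribute [local instance] lamSg actTen lamTen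

variable [Fintype G] [Invertible (Fintype.card G : S)] [Algebra.IsInvariant R S G] [FaithfulSMul R S]
  [IsNoetherianRing (SkewMonoidAlgebra S G)] [IsNoetherianRing R]

lemma good_ker {R : Type} [CommRing R] {X : Type} [AddCommGroup X] [Module R X] (hX : ∀ j, EV R X R (j + 1)) {m : ℕ}
    (ε : (Fin m → R) →ₗ[R] X) (hε : Function.Surjective ε) (j : ℕ) :
    EV R (LinearMap.ker ε) R (j + 1) :=
  EV_left (f := (LinearMap.ker ε).subtype) (g := ε) Subtype.val_injective
    (by intro y; simp) hε (EV_projective j) (hX (j + 1))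

lemma dual_exact {R : Type} [CommRing R] {X : Type} [AddCommGroup X] [Module R X] {m : ℕ}
    (ε : (Fin m → R) →ₗ[R] X) (hε : Function.Surjective ε) :
    Function.Exact ε.dualMap (LinearMap.ker ε).subtype.dualMap := by
  intro φ
  constructor
  · intro h
    have h2 : ∀ v ∈ LinearMap.ker ε, φ v = 0 := fun v hv => LinearMap.congr_fun h ⟨v, hv⟩
    choose σ hσ using hε
    have h3 : ∀ v w, ε v = ε w → φ v = φ w := fun v w hvw => by
      rw [← sub_eq_zero, ← map_sub]
      exact h2 _ (by rw [LinearMap.mem_ker, map_sub, hvw, sub_self])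
    refine ⟨⟨⟨fun x => φ (σ x), fun x y => ?_⟩, fun r x => ?_⟩, LinearMap.ext fun v => ?_⟩
    · rw [← map_add]; exact h3 _ _ (by rw [map_add, hσ, hσ, hσ])
    · change _ = r • φ (σ x)
      rw [← map_smul]; exact h3 _ _ (by rw [map_smul, hσ, hσ])
    · exact h3 _ _ (hσ _)
  · rintro ⟨ψ, rfl⟩
    refine LinearMap.ext fun v => ?_
    have : ε v.1 = 0 := v.2
    change ψ (ε v.1) = 0
    rw [this, map_zero]

lemma dual_surj {R : Type} [CommRing R] {X : Type} [AddCommGroup X] [Module R X] (hX : ∀ j, EV R X R (j + 1)) {m : ℕ}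
    (ε : (Fin m → R) →ₗ[R] X) (hε : Function.Surjective ε) :
    Function.Surjective (LinearMap.ker ε).subtype.dualMap := fun φ =>
  EV_extend (f := (LinearMap.ker ε).subtype) (g := ε) Subtype.val_injective
    (by intro y; simp) hε (hX 0) φ

lemma dual_inj {R : Type} [CommRing R] {X : Type} [AddCommGroup X] [Module R X] {m : ℕ}
    (ε : (Fin m → R) →ₗ[R] X) (hε : Function.Surjective ε) :
    Function.Injective ε.dualMap := LinearMap.dualMap_injective_of_surjective hε

lemma dual_fin {R : Type} [CommRing R] [IsNoetherianRing R] {X : Type} [AddCommGroup X] [Module R X]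
    [Module.Finite R X] : Module.Finite R (Module.Dual R X) := by
  obtain ⟨m, ε, hε⟩ := Module.Finite.exists_fin' R X
  exact Module.Finite.of_injective _ (dual_inj ε hε)

lemma dual_EV {n : ℕ} (hPD : ∀ (T : Type) [AddCommGroup T] [Module (SkewMonoidAlgebra S G) T],
      PD (SkewMonoidAlgebra S G) T (n + 1))
    (hNI : ∀ (T : Type) [AddCommGroup T] [Module (SkewMonoidAlgebra S G) T]
    [Module.Finite (SkewMonoidAlgebra S G) T],
    (∀ t : T, (∀ g : G, (gm g : SkewMonoidAlgebra S G) • t = t) → t = 0) → ∀ j, EV (SkewMonoidAlgebra S G) T S j)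
    (m : ℕ) : ∀ (j : ℕ) (_ : n ≤ j + m) (X : Type) [AddCommGroup X] [Module R X] [Module.Finite R X]
    (_ : ∀ j, EV R X R (j + 1)), EV (SkewMonoidAlgebra S G) (S ⊗[R] Module.Dual R X) S (j + 1) := by
  induction m with
  | zero =>
    intro j hj X _ _ _ hX x
    haveI := hPD (S ⊗[R] Module.Dual R X)
    unfold PD at this
    exact CategoryTheory.Abelian.Ext.eq_zero_of_hasProjectiveDimensionLT x (n + 1) (by omega)
  | succ m ih =>
    intro j hj X _ _ _ hX
    obtain ⟨a, ε, hε⟩ := Module.Finite.exists_fin' R X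
    haveI := dual_fin (R := R) (X := X)
    exact ten_shift R S G (dual_inj ε hε) (dual_exact ε hε) (dual_surj hX ε hε) hNI j
      (ih (j + 1) (by omega) (LinearMap.ker ε) (good_ker hX ε hε))

lemma eval_surj {n : ℕ} (hPD : ∀ (T : Type) [AddCommGroup T] [Module (SkewMonoidAlgebra S G) T],
      PD (SkewMonoidAlgebra S G) T (n + 1))
    (hNI : ∀ (T : Type) [AddCommGroup T] [Module (SkewMonoidAlgebra S G) T]
    [Module.Finite (SkewMonoidAlgebra S G) T],
    (∀ t : T, (∀ g : G, (gm g : SkewMonoidAlgebra S G) • t = t) → t = 0) → ∀ j, EV (SkewMonoidAlgebra S G) T S j)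
    (X : Type) [AddCommGroup X] [Module R X] [Module.Finite R X]
    (hX : ∀ j, EV R X R (j + 1)) : Function.Surjective (Module.Dual.eval R X) := by
  intro l
  obtain ⟨a, ε, hε⟩ := Module.Finite.exists_fin' R X
  haveI := dual_fin (R := R) (X := X)
  obtain ⟨μ, hμ⟩ := ten_extend R S G (dual_inj ε hε) (dual_exact ε hε) (dual_surj hX ε hε) hNI
    (dual_EV R S G hPD hNI n 0 (by omega) (LinearMap.ker ε) (good_ker hX ε hε)) l
  obtain ⟨v, rfl⟩ := (Module.bijective_dual_eval R (Fin a → R)).2 μ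
  exact ⟨ε v, by rw [← hμ]; rfl⟩

lemma eval_bij {n : ℕ} (hPD : ∀ (T : Type) [AddCommGroup T] [Module (SkewMonoidAlgebra S G) T],
      PD (SkewMonoidAlgebra S G) T (n + 1))
    (hNI : ∀ (T : Type) [AddCommGroup T] [Module (SkewMonoidAlgebra S G) T]
    [Module.Finite (SkewMonoidAlgebra S G) T],
    (∀ t : T, (∀ g : G, (gm g : SkewMonoidAlgebra S G) • t = t) → t = 0) → ∀ j, EV (SkewMonoidAlgebra S G) T S j)
    (X : Type) [AddCommGroup X] [Module R X] [Module.Finite R X]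
    (hX : ∀ j, EV R X R (j + 1)) : Function.Bijective (Module.Dual.eval R X) := by
  refine ⟨?_, eval_surj R S G hPD hNI X hX⟩
  rw [injective_iff_map_eq_zero]
  intro x hx
  obtain ⟨a, ε, hε⟩ := Module.Finite.exists_fin' R X
  obtain ⟨v, rfl⟩ := hε x
  -- the functional on the dual of the kernel
  have hs := dual_surj hX ε hε
  have he := dual_exact ε hε
  have h0 : ∀ φ, (LinearMap.ker ε).subtype.dualMap φ = 0 → φ v = 0 := fun φ hφ => by
    obtain ⟨ψ, rfl⟩ := (he φ).1 hφ
    exact LinearMap.congr_fun hx ψ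
  have h1 : ∀ φ ψ, (LinearMap.ker ε).subtype.dualMap φ = (LinearMap.ker ε).subtype.dualMap ψ → φ v = ψ v :=
    fun φ ψ h => by
      have := h0 (φ - ψ) (by rw [map_sub, h, sub_self])
      rwa [LinearMap.sub_apply, sub_eq_zero] at this
  choose σ hσ using hs
  let l : Module.Dual R (Module.Dual R (LinearMap.ker ε)) :=
    { toFun := fun φ => σ φ v
      map_add' := fun φ ψ => h1 _ (σ φ + σ ψ) (by rw [map_add, hσ, hσ, hσ])
      map_smul' := fun r φ => h1 _ (r • σ φ) (by rw [map_smul, hσ, hσ]) }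
  obtain ⟨w, hw⟩ := eval_surj R S G hPD hNI (LinearMap.ker ε) (good_ker hX ε hε) l
  have h2 : Module.Dual.eval R (Fin a → R) v = Module.Dual.eval R (Fin a → R) w.1 := by
    refine LinearMap.ext fun φ => ?_
    have h3 := LinearMap.congr_fun hw ((LinearMap.ker ε).subtype.dualMap φ)
    have h4 : φ w.1 = σ ((LinearMap.ker ε).subtype.dualMap φ) v := h3
    change φ v = φ w.1
    rw [h4]
    exact h1 _ _ (hσ _).symm
  rw [(Module.bijective_dual_eval R (Fin a → R)).1 h2]
  exact w.2

end refl
end Inv17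

-- part 18
namespace Inv17

section extcm
open CategoryTheory Abelian

section pos
variable {A Z T : Type} [Ring A] [AddCommGroup Z] [Module A Z] [AddCommGroup T] [Module A T]
  (P : ℕ → Type) [∀ m, AddCommGroup (P m)]
  [∀ m, Module A (P m)] [∀ m, Module.Projective A (P m)]
  (D : ∀ m, P (m + 1) →ₗ[A] P m) (ε : P 0 →ₗ[A] T)

lemma chain_EV_pos (hε : Function.Surjective ε)
  (he0 : Function.Exact (D 0) ε) (he : ∀ m, Function.Exact (D (m + 1)) (D m))
    (h : ∀ m, ∀ ψ : P (m + 1) →ₗ[A] Z, ψ ∘ₗ D (m + 1) = 0 → ∃ ψ' : P m →ₗ[A] Z, ψ' ∘ₗ D m = ψ)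
    (j : ℕ) : EV A T Z (j + 1) := by
  have hext : ∀ m, ∀ φ : LinearMap.range (D m) →ₗ[A] Z, ∃ ψ : P m →ₗ[A] Z,
      ψ ∘ₗ (LinearMap.range (D m)).subtype = φ := by
    intro m φ
    obtain ⟨ψ, hψ⟩ := h m (φ ∘ₗ (D m).rangeRestrict) (by
      ext x
      have : (D m).rangeRestrict (D (m + 1) x) = 0 :=
        Subtype.ext ((he m).apply_apply_eq_zero x)
      simp [this])
    refine ⟨ψ, ?_⟩
    ext ⟨_, x, rfl⟩
    exact LinearMap.congr_fun hψ x
  have h1 : ∀ j m, EV A (LinearMap.range (D m)) Z (j + 1) := by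
    intro j
    induction j with
    | zero =>
      intro m
      obtain ⟨a1, a2, a3⟩ := range_ses (he m)
      exact EV_one_of_extend a1 a2 a3 (hext (m + 1))
    | succ j ih =>
      intro m
      obtain ⟨a1, a2, a3⟩ := range_ses (he m)
      exact EV_right a1 a2 a3 (ih (m + 1)) (EV_projective _)
  have a2 : Function.Exact (LinearMap.range (D 0)).subtype ε := by
    intro y; rw [he0 y]; simp
  rcases j with _ | j
  · exact EV_one_of_extend Subtype.val_injective a2 hε (hext 0)
  · exact EV_right Subtype.val_injective a2 hε (h1 j 0) (EV_projective _)


end pos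

lemma EV_of_ext (R X : Type) [CommRing R] [AddCommGroup X] [Module R X]
    (hCM : ∀ i : ℕ, 0 < i → Subsingleton
        (((_root_.Ext R (ModuleCat R) i).obj (Opposite.op (ModuleCat.of R X))).obj (ModuleCat.of R R)))
    (j : ℕ) : EV R X R (j + 1) := by
  let P := ProjectiveResolution.of (ModuleCat.of R X)
  have hex : ∀ m, ∀ ψ : P.complex.X (m + 1) →ₗ[R] R, ψ ∘ₗ (P.complex.d (m + 1 + 1) (m + 1)).hom = 0 →
      ∃ ψ' : P.complex.X m →ₗ[R] R, ψ' ∘ₗ (P.complex.d (m + 1) m).hom = ψ := by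
    intro m ψ hψ
    have h1 := hCM (m + 1) (Nat.succ_pos m)
    have h2 : Limits.IsZero ((P.complex.linearYonedaObj R (ModuleCat.of R R)).homology (m + 1)) :=
      (ModuleCat.isZero_of_subsingleton _).of_iso (P.isoExt (m + 1) (ModuleCat.of R R)).symm
    rw [← HomologicalComplex.exactAt_iff_isZero_homology,
      HomologicalComplex.exactAt_iff' _ m (m + 1) (m + 1 + 1) (by simp) (by simp),
      ShortComplex.moduleCat_exact_iff] at h2
    obtain ⟨y, hy⟩ := h2 (ModuleCat.ofHom ψ) (by
      change P.complex.d _ _ ≫ ModuleCat.ofHom ψ = 0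
      ext x; exact LinearMap.congr_fun hψ x)
    change P.complex.d _ _ ≫ y = _ at hy
    exact ⟨y.hom, congrArg ModuleCat.Hom.hom hy⟩
  haveI : ∀ m, Module.Projective R (P.complex.X m) := fun m =>
    (IsProjective.iff_projective _).2 (P.projective m)
  refine chain_EV_pos (fun m => P.complex.X m) (fun m => (P.complex.d (m + 1) m).hom)
    (P.π.f 0).hom ?_ ?_ ?_ hex j
  · exact (ModuleCat.epi_iff_surjective _).1 inferInstance
  · have := P.exact₀
    rw [ShortComplex.ShortExact.moduleCat_exact_iff_function_exact] at this
    exact this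
  · intro m
    have := P.exact_succ m
    rw [ShortComplex.ShortExact.moduleCat_exact_iff_function_exact] at this
    exact this

end extcm
end Inv17

-- part 19
namespace Inv17

section pres
open SkewMonoidAlgebra
variable (R S G : Type) [CommRing R] [CommRing S] [Group G] [MulSemiringAction G S]
  [Algebra R S] [SMulCommClass G R S]

attribute [local instance] lamSg actTen lamTen

lemma towR : IsScalarTower R (SkewMonoidAlgebra S G) S :=
  ⟨fun r l s => by
    rw [Algebra.smul_def r l, mul_smul, algMap_eq, lamSg_sg, Algebra.smul_def]⟩

lemma towS : IsScalarTower S (SkewMonoidAlgebra S G) S := tower_of_sg (lamSg_sg S G)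

attribute [local instance] towR towS

/-- scalar multiplication by an invariant -/
def rs (r : R) : S →ₗ[SkewMonoidAlgebra S G] S where
  toFun s := r • s
  map_add' := smul_add r
  map_smul' l s := (lam_smul_comm R S G l r s).symm

variable {a b : ℕ}

/-- matrix map -/
def matL (u : Fin b → Fin a → R) : (Fin a → S) →ₗ[SkewMonoidAlgebra S G] (Fin b → S) :=
  LinearMap.pi fun j => ∑ i, rs R S G (u j i) ∘ₗ LinearMap.proj i

lemma matL_apply (u : Fin b → Fin a → R) (v : Fin a → S) (j : Fin b) :
    matL R S G u v j = ∑ i, u j i • v i := by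
  simp [matL, rs]

variable [FaithfulSMul R S] [Algebra.IsInvariant R S G]

lemma pres_iso {X : Type} [AddCommGroup X] [Module R X] (hX : Function.Bijective (Module.Dual.eval R X))
    (q : (Fin a → R) →ₗ[R] Module.Dual R X) (hq : Function.Surjective q)
    (p : (Fin b → R) →ₗ[R] LinearMap.ker q) (hp : Function.Surjective p) :
    Nonempty (X ≃ₗ[R] invs R S G (LinearMap.ker (matL R S G fun j => (p (Pi.single j 1)).1))) := by
  have hinj := FaithfulSMul.algebraMap_injective R S
  have hw : ∀ (w : Fin a → R) , q w = ∑ i, w i • q (Pi.single i 1) := fun w => by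
    conv_lhs => rw [pi_eq_sum_univ' w]
    rw [_root_.map_sum]
    refine Finset.sum_congr rfl fun i _ => ?_
    rw [map_smul]
  have hw2 : ∀ (w : Fin b → R) , p w = ∑ i, w i • p (Pi.single i 1) := fun w => by
    conv_lhs => rw [pi_eq_sum_univ' w]
    rw [_root_.map_sum]
    refine Finset.sum_congr rfl fun i _ => ?_
    rw [map_smul]
  have hk : ∀ x : X, matL R S G (fun j => (p (Pi.single j 1)).1)
      (fun i => algebraMap R S (q (Pi.single i 1) x)) = 0 := fun x => by
    funext j
    rw [matL_apply]
    have h1 : q (p (Pi.single j 1)).1 = 0 := (p (Pi.single j 1)).2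
    rw [hw] at h1
    have h2 := LinearMap.congr_fun h1 x
    rw [LinearMap.sum_apply] at h2
    have h3 := congrArg (algebraMap R S) h2
    rw [_root_.map_sum, LinearMap.zero_apply, map_zero] at h3
    rw [Pi.zero_apply, ← h3]
    refine Finset.sum_congr rfl fun i _ => ?_
    rw [LinearMap.smul_apply, smul_eq_mul, map_mul, Algebra.smul_def]
  let F : X →ₗ[R] invs R S G (LinearMap.ker (matL R S G fun j => (p (Pi.single j 1)).1)) :=
    { toFun := fun x => ⟨⟨fun i => algebraMap R S (q (Pi.single i 1) x), hk x⟩, fun g => Subtype.ext (by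
        funext i
        change (gm g : SkewMonoidAlgebra S G) • algebraMap R S (q (Pi.single i 1) x) = _
        rw [lamSg_gm, smul_algebraMap])⟩
      map_add' := fun x y => by
        refine Subtype.ext (Subtype.ext (funext fun i => ?_))
        change algebraMap R S _ = algebraMap R S _ + algebraMap R S _
        rw [map_add, map_add]
      map_smul' := fun r x => by
        refine Subtype.ext (Subtype.ext (funext fun i => ?_))
        change algebraMap R S _ = r • algebraMap R S _
        rw [map_smul, smul_eq_mul, map_mul, Algebra.smul_def] }
  refine ⟨LinearEquiv.ofBijective F ⟨?_, ?_⟩⟩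
  · rw [injective_iff_map_eq_zero]
    intro x hx
    apply hX.1
    rw [map_zero]
    refine LinearMap.ext fun φ => ?_
    obtain ⟨w, rfl⟩ := hq φ
    have h1 : ∀ i, q (Pi.single i 1) x = 0 := fun i => hinj (by
      have := congrFun (congrArg (fun t => t.1.1) hx) i
      rw [map_zero]; exact this)
    change q w x = 0
    rw [hw, LinearMap.sum_apply]
    exact Finset.sum_eq_zero fun i _ => by rw [LinearMap.smul_apply, h1, smul_zero]
  · rintro ⟨⟨v, hv⟩, hvi⟩
    have hr : ∀ i, ∃ r : R, algebraMap R S r = v i := fun i =>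
      Algebra.IsInvariant.isInvariant (A := R) (G := G) (v i) (fun g => by
        have h1 := congrArg Subtype.val (hvi g)
        rw [← lamSg_gm]
        exact congrFun h1 i)
    choose r hr using hr
    let L : (Fin a → R) →ₗ[R] R := Fintype.linearCombination R r
    have hL : ∀ w, L w = ∑ i, w i * r i := fun w => by
      simp [L, Fintype.linearCombination_apply]
    have hL1 : ∀ j, L (p (Pi.single j 1)).1 = 0 := fun j => hinj (by
      rw [hL, _root_.map_sum, map_zero]
      have := congrFun (LinearMap.mem_ker.1 hv) j
      rw [matL_apply] at this
      refine Eq.trans (Finset.sum_congr rfl fun i _ => ?_) this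
      rw [map_mul, hr, Algebra.smul_def])
    have hL2 : ∀ w, q w = 0 → L w = 0 := fun w h => by
      obtain ⟨c, hc⟩ := hp ⟨w, h⟩
      have h1 : w = (p c).1 := by rw [hc]
      have h2 : (p c).1 = ∑ i, c i • (p (Pi.single i 1)).1 := by
        rw [hw2 c]
        simp
      rw [h1, h2, _root_.map_sum]
      exact Finset.sum_eq_zero fun i _ => by rw [map_smul, hL1, smul_zero]
    have hL3 : ∀ w w', q w = q w' → L w = L w' := fun w w' h => by
      rw [← sub_eq_zero, ← map_sub]
      exact hL2 _ (by rw [map_sub, h, sub_self])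
    choose σ hσ using hq
    let l : Module.Dual R (Module.Dual R X) :=
      { toFun := fun φ => L (σ φ)
        map_add' := fun φ ψ => by
          rw [← map_add]; exact hL3 _ _ (by rw [map_add, hσ, hσ, hσ])
        map_smul' := fun r φ => by
          change _ = r • L (σ φ)
          rw [← map_smul]; exact hL3 _ _ (by rw [map_smul, hσ, hσ]) }
    obtain ⟨x, hx⟩ := hX.2 l
    refine ⟨x, Subtype.ext (Subtype.ext (funext fun i => ?_))⟩
    change algebraMap R S (q (Pi.single i 1) x) = v i
    rw [← hr i]
    congr 1
    have h1 : q (Pi.single i 1) x = L (σ (q (Pi.single i 1))) := LinearMap.congr_fun hx (q (Pi.single i 1))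
    rw [h1, hL3 _ (Pi.single i 1) (hσ _), hL]
    rw [Finset.sum_eq_single i (fun j _ hj => by rw [Pi.single_eq_of_ne hj, zero_mul]) (by simp)]
    rw [Pi.single_eq_same, one_mul]

variable [Fintype G] [Invertible (Fintype.card G : S)]

lemma S_proj : Module.Projective (SkewMonoidAlgebra S G) S := projective_skew
lemma S_fin : Module.Finite (SkewMonoidAlgebra S G) S := Module.Finite.of_restrictScalars_finite S _ _
attribute [local instance] S_proj S_fin

lemma ker_pd (A : (Fin a → S) →ₗ[SkewMonoidAlgebra S G] (Fin b → S)) (p : ℕ)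
    (hPD : ∀ (T : Type) [AddCommGroup T] [Module (SkewMonoidAlgebra S G) T],
      PD (SkewMonoidAlgebra S G) T (p + 2 + 1)) : PD (SkewMonoidAlgebra S G) (LinearMap.ker A) (p + 1) := by
  have hP : ∀ c : ℕ, CategoryTheory.Projective (ModuleCat.of (SkewMonoidAlgebra S G) (Fin c → S)) := fun c =>
    (IsProjective.iff_projective _).1 (projective_skew (S := S) (G := G))
  have h1 : PD (SkewMonoidAlgebra S G) (LinearMap.range A) (p + 1 + 1) := by
    have := hP b
    refine (sc_exact (f := (LinearMap.range A).subtype) (g := (LinearMap.range A).mkQ) Subtype.val_injective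
      (by intro y; simp) (Submodule.mkQ_surjective _)).hasProjectiveDimensionLT_X₁ (p + 2)
      (CategoryTheory.hasProjectiveDimensionLT_of_ge _ 1 _ (by omega)) (hPD _)
  have := hP a
  exact (sc_exact (f := (LinearMap.ker A).subtype) (g := A.rangeRestrict) Subtype.val_injective
      (by intro y; rw [Subtype.ext_iff]; simp) (LinearMap.surjective_rangeRestrict _)).hasProjectiveDimensionLT_X₁ (p + 1)
      (CategoryTheory.hasProjectiveDimensionLT_of_ge _ 1 _ (by omega)) h1

variable [IsNoetherianRing (SkewMonoidAlgebra S G)] [IsNoetherianRing R] [IsDomain S] [UniqueFactorizationMonoid S]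

theorem res_all (hc : Codim2 S G) (p : ℕ)
    (hPD : ∀ (T : Type) [AddCommGroup T] [Module (SkewMonoidAlgebra S G) T],
      PD (SkewMonoidAlgebra S G) T (p + 2 + 1))
    (hNI : ∀ (T : Type) [AddCommGroup T] [Module (SkewMonoidAlgebra S G) T]
    [Module.Finite (SkewMonoidAlgebra S G) T],
    (∀ t : T, (∀ g : G, (gm g : SkewMonoidAlgebra S G) • t = t) → t = 0) → ∀ j, EV (SkewMonoidAlgebra S G) T S j)
    (X : Type) [AddCommGroup X] [Module R X] [Module.Finite R X]
    (hX : ∀ j, EV R X R (j + 1)) : Res R S p X := by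
  haveI := dual_fin (R := R) (X := X)
  obtain ⟨a, q, hq⟩ := Module.Finite.exists_fin' R (Module.Dual R X)
  obtain ⟨b, r, hr⟩ := Module.Finite.exists_fin' R (LinearMap.ker q)
  obtain ⟨e⟩ := pres_iso R S G (eval_bij R S G hPD hNI X hX) q hq r hr
  obtain ⟨hI, hS⟩ := etaI_proj (R := R) (S := S) (G := G) (M := S) hc
  refine res_congr p e.symm (res_main hc p _ ?_ ?_ ?_)
  · exact etaI_inj (LinearMap.ker _).subtype Subtype.val_injective (etaI_pi hI)
  · exact etaS_ker _ (etaS_pi hS) (etaI_pi hI)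
  · exact ker_pd S G _ p hPD

end pres
end Inv17

namespace Inv17

section final
variable {K : Type} [Field K] [CharZero K]

attribute [local instance] actG

theorem res_concrete {p : ℕ} (G : Subgroup (Matrix.SpecialLinearGroup (Fin (p + 2)) K)) [Fintype G]
    (X : Type) [AddCommGroup X] [Module (invRSL K (p + 2) G) X] [Module.Finite (invRSL K (p + 2) G) X]
    (hX : ∀ j, EV (invRSL K (p + 2) G) X (invRSL K (p + 2) G) (j + 1)) :
    Res (invRSL K (p + 2) G) (MvPolynomial (Fin (p + 2)) K) p X := by
  haveI : IsNoetherianRing (Lam G) := noeth_skew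
  exact res_all (invRSL K (p + 2) G) (MvPolynomial (Fin (p + 2)) K) G (codim2 G) p
    (fun T _ _ => pd_bound G T) (fun T _ _ _ hT j => EV_noInv G (by omega) T hT j) X hX

end final
end Inv17

open CategoryTheory in
set_option maxHeartbeats 2000000 in
set_option synthInstance.maxHeartbeats 1000000 in
/-- **Statement 17** (Proposition 4.4): let `G ≤ SL_d(k)` be finite (char `k` = 0) with
`R = S^G` an isolated singularity.  For every finitely generated maximal Cohen–Macaulay
`R`-module `X` there is an exact sequence `0 → C_{d-2} → ⋯ → C_1 → C_0 → X → 0` with each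
`C_i` a direct summand of a finite direct sum of copies of `S` (encoded: `C_i` is a
complemented `R`-submodule of `S^N`, and `C_n = 0` for `n ≥ d - 1`), which stays exact
after applying `Hom_R(S, −)`. -/
theorem stmt_17 [CharZero k] (G : Subgroup (Matrix.SpecialLinearGroup (Fin d) k))
    [Fintype G] (hiso : IsIsolatedSing k d G) (hd : 2 ≤ d)
    (X : Type) [AddCommGroup X] [Module ↥(invRSL k d G) X]
    [Module.Finite ↥(invRSL k d G) X]
    (hCM : ∀ i : ℕ, 0 < i →
      Subsingleton
        (((Ext ↥(invRSL k d G) (ModuleCat ↥(invRSL k d G)) i).obj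
            (Opposite.op (ModuleCat.of ↥(invRSL k d G) X))).obj
          (ModuleCat.of ↥(invRSL k d G) ↥(invRSL k d G)))) :
    ∃ (N : ℕ)
      (C : ℕ → Submodule ↥(invRSL k d G) (Fin N → MvPolynomial (Fin d) k))
      (f : ∀ n : ℕ, ↥(C (n + 1)) →ₗ[↥(invRSL k d G)] ↥(C n))
      (g : ↥(C 0) →ₗ[↥(invRSL k d G)] X),
      -- the sequence has length `d - 1`: `C_n = 0` for `n ≥ d - 1`
      (∀ n : ℕ, d - 1 ≤ n → C n = ⊥) ∧
      -- each `C_n` is a direct summand of `S^N`, i.e. lies in `add S`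
      (∀ n : ℕ, ∃ D, IsCompl (C n) D) ∧
      -- the sequence `0 → C_{d-2} → ⋯ → C_0 → X → 0` is exact
      Function.Surjective g ∧
      Function.Exact (f 0) g ∧
      (∀ n : ℕ, Function.Exact (f (n + 1)) (f n)) ∧
      -- the sequence stays exact after applying `Hom_R(S, −)`
      (∀ φ : MvPolynomial (Fin d) k →ₗ[↥(invRSL k d G)] X,
        ∃ ψ : MvPolynomial (Fin d) k →ₗ[↥(invRSL k d G)] ↥(C 0), g.comp ψ = φ) ∧
      (∀ φ : MvPolynomial (Fin d) k →ₗ[↥(invRSL k d G)] ↥(C 0), g.comp φ = 0 →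
        ∃ ψ : MvPolynomial (Fin d) k →ₗ[↥(invRSL k d G)] ↥(C 1), (f 0).comp ψ = φ) ∧
      (∀ (n : ℕ) (φ : MvPolynomial (Fin d) k →ₗ[↥(invRSL k d G)] ↥(C (n + 1))),
        (f n).comp φ = 0 →
        ∃ ψ : MvPolynomial (Fin d) k →ₗ[↥(invRSL k d G)] ↥(C (n + 1 + 1)),
          (f (n + 1)).comp ψ = φ) := by
  obtain ⟨p, rfl⟩ : ∃ p, d = p + 2 := ⟨d - 2, by omega⟩
  obtain ⟨N, hN⟩ := Inv17.res_fnl p X (Inv17.res_concrete G X (Inv17.EV_of_ext _ X hCM))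
  obtain ⟨C, f, g, h1, h2⟩ := hN N le_rfl
  exact ⟨N, C, f, g, fun n hn => h1 n (by omega), h2⟩
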